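/- arXiv:hep-th/9611137 — 3 statements merged into one kernel-verified Lean document; each statement's English description precedes it below -/
import Mathlib

section
/- Let r ≥ 1 and let A be a symmetric r×r integer matrix which is even (xᵀAx is an even integer for every x ∈ ℤʳ) and unimodular (det A = 1 or det A = −1). If, regarded as a real symmetric matrix, A has exactly m positive and n negative eigenvalues counted with multiplicity (so m + n = r, since unimodularity forces nondegeneracy), then m ≡ n (mod 8). -/
open Matrix

open Filter Topology

theorem tendsto_sqrt_mul_evenKernel (N : ℕ) [NeZero N] (a : ℝ) :
    Tendsto (fun t : ℝ => √t * HurwitzZeta.evenKernel (a : UnitAddCircle) ((N : ℝ) ^ 2 * t))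
      (𝓝[>] 0) (𝓝 (1 / N)) := by
  have hN : (0 : ℝ) < N := Nat.cast_pos.mpr (NeZero.pos N)
  have hcos : Tendsto (HurwitzZeta.cosKernel (a : UnitAddCircle)) atTop (𝓝 1) := by
    obtain ⟨p, hp, h⟩ := HurwitzZeta.isBigO_atTop_cosKernel_sub (a : UnitAddCircle)
    have hexp : Tendsto (fun x : ℝ => Real.exp (-p * x)) atTop (𝓝 0) :=
      Real.tendsto_exp_atBot.comp (tendsto_id.const_mul_atTop_of_neg (neg_neg_of_pos hp))
    simpa using (h.trans_tendsto hexp).add_const 1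
  have harg : Tendsto (fun t : ℝ => 1 / ((N : ℝ) ^ 2 * t)) (𝓝[>] 0) atTop := by
    have := tendsto_inv_nhdsGT_zero.const_mul_atTop (show (0 : ℝ) < ((N : ℝ) ^ 2)⁻¹ by positivity)
    refine this.congr fun t => ?_
    rw [one_div, mul_inv]
  have := (hcos.comp harg).const_mul (1 / (N : ℝ))
  rw [mul_one] at this
  refine this.congr' ?_
  filter_upwards [self_mem_nhdsWithin] with t ht
  have ht : 0 < t := ht
  have hst : √t ≠ 0 := (Real.sqrt_pos.mpr ht).ne'
  rw [HurwitzZeta.evenKernel_functional_equation, ← Real.sqrt_eq_rpow,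
    Real.sqrt_mul (by positivity), Real.sqrt_sq hN.le]
  simp only [Function.comp]
  field_simp

theorem hasSum_mul_gaussian_of_periodic (N : ℕ) [NeZero N] (g : ℤ → ℂ)
    (hg : ∀ q c : ℤ, g (q * N + c) = g c) {t : ℝ} (ht : 0 < t) :
    HasSum (fun n : ℤ => g n * (Real.exp (-Real.pi * n ^ 2 * t) : ℂ))
      (∑ c : Fin N, g (c : ℕ) *
        (HurwitzZeta.evenKernel (((c : ℕ) / N : ℝ) : UnitAddCircle) ((N : ℝ) ^ 2 * t) : ℂ)) := by
  have hN : (0 : ℝ) < N := Nat.cast_pos.mpr (NeZero.pos N)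
  set f : ℤ → ℂ := fun n => g n * (Real.exp (-Real.pi * n ^ 2 * t) : ℂ) with hf
  have hgmod (n : ℤ) : g n = g (n % N) := by
    conv_lhs => rw [← Int.ediv_mul_add_emod n N, hg]
  have hsum : Summable f := by
    have h0 := (HurwitzZeta.hasSum_int_evenKernel 0 ht).summable
    refine Summable.of_norm_bounded (h0.mul_left (∑ c ∈ Finset.Ico (0 : ℤ) N, ‖g c‖)) fun n => ?_
    rw [hf, norm_mul, Complex.norm_real, Real.norm_eq_abs, Real.abs_exp, add_zero]
    gcongr
    rw [hgmod]
    exact Finset.single_le_sum (f := fun c => ‖g c‖) (fun _ _ => norm_nonneg _)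
      (Finset.mem_Ico.mpr ⟨Int.emod_nonneg _ (by simp [NeZero.ne]),
        Int.emod_lt_of_pos _ (by exact_mod_cast NeZero.pos N)⟩)
  let e : Fin N × ℤ ≃ ℤ := (Equiv.prodComm _ _).trans (Int.divModEquiv N).symm
  have he (c : Fin N) (q : ℤ) : e (c, q) = q * N + (c : ℕ) := by
    simp [e, Int.divModEquiv_symm_apply]
  have h1 : HasSum (f ∘ e) (∑' n, f n) := e.hasSum_iff.mpr hsum.hasSum
  have h2 := h1.prod_fiberwise (g := fun c : Fin N => g (c : ℕ) *
        (HurwitzZeta.evenKernel (((c : ℕ) / N : ℝ) : UnitAddCircle) ((N : ℝ) ^ 2 * t) : ℂ))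
    fun c => by
      have := (Complex.hasSum_ofReal.mpr (HurwitzZeta.hasSum_int_evenKernel ((c : ℕ) / N : ℝ)
        (show 0 < (N : ℝ) ^ 2 * t by positivity))).mul_left (g (c : ℕ))
      refine this.congr_fun ?_
      intro q
      simp only [Function.comp, he, hf, hg]
      congr 3
      push_cast
      field_simp
  rw [(hasSum_fintype _).unique h2]
  exact hsum.hasSum

/-- The Gaussian average of a periodic function tends to its mean value. -/
theorem tendsto_sqrt_mul_tsum_of_periodic (N : ℕ) [NeZero N] (g : ℤ → ℂ)
    (hg : ∀ q c : ℤ, g (q * N + c) = g c) :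
    Tendsto (fun t : ℝ => (√t : ℂ) *
        ∑' n : ℤ, g n * (Real.exp (-Real.pi * n ^ 2 * t) : ℂ))
      (𝓝[>] 0) (𝓝 ((∑ c : Fin N, g (c : ℕ)) / N)) := by
  have h : Tendsto (fun t : ℝ => ∑ c : Fin N, g (c : ℕ) *
      ((√t * HurwitzZeta.evenKernel (((c : ℕ) / N : ℝ) : UnitAddCircle) ((N : ℝ) ^ 2 * t) : ℝ) : ℂ))
      (𝓝[>] 0) (𝓝 (∑ c : Fin N, g (c : ℕ) * ((1 / N : ℝ) : ℂ))) :=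
    tendsto_finsetSum _ fun c _ => ((Complex.continuous_ofReal.tendsto _).comp
      (tendsto_sqrt_mul_evenKernel N _)).const_mul _
  rw [← Finset.sum_mul] at h
  convert h.congr' ?_ using 2
  · push_cast; ring
  · filter_upwards [self_mem_nhdsWithin] with t ht
    rw [(hasSum_mul_gaussian_of_periodic N g hg ht).tsum_eq, Finset.mul_sum]
    refine Finset.sum_congr rfl fun c _ => ?_
    push_cast
    ring

theorem jacobiTheta_neg_one_div {τ : ℂ} (hτ : 0 < τ.im) :
    jacobiTheta (-1 / τ) = (-Complex.I * τ) ^ (1 / 2 : ℂ) * jacobiTheta τ := by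
  have h := jacobiTheta_S_smul ⟨τ, hτ⟩
  rw [UpperHalfPlane.modular_S_smul] at h
  simpa [neg_div] using h

theorem jacobiTheta_sub_even (τ : ℂ) {d : ℤ} (hd : Even d) :
    jacobiTheta (τ - d) = jacobiTheta τ := by
  obtain ⟨k, rfl⟩ := hd
  have hper : Function.Periodic jacobiTheta 2 := fun z => by
    rw [add_comm, jacobiTheta_two_add]
  have := hper.sub_zsmul_eq (x := τ) k
  rw [← this]
  congr 1
  push_cast
  simp
  ring

theorem tendsto_jacobiTheta_im_atTop :
    Tendsto jacobiTheta (comap Complex.im atTop) (𝓝 1) := by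
  have hexp : Tendsto (fun τ : ℂ => Real.exp (-Real.pi * τ.im)) (comap Complex.im atTop) (𝓝 0) :=
    Real.tendsto_exp_atBot.comp
      (tendsto_comap.const_mul_atTop_of_neg (neg_neg_of_pos Real.pi_pos))
  simpa using (isBigO_at_im_infty_jacobiTheta_sub_one.trans_tendsto hexp).add_const 1

theorem neg_I_div_cpow_half {d : ℤ} (hd : d ≠ 0) :
    (-Complex.I * (1 / d)) ^ (1 / 2 : ℂ) =
      (1 / √|(d : ℝ)| : ℝ) * Complex.exp (-(Real.pi * Complex.I * d.sign / 4)) := by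
  have hd' : (0 : ℝ) < |(d : ℝ)| := by positivity
  have key : -Complex.I * (1 / d) =
      Complex.exp (((-Real.log |(d : ℝ)| : ℝ) : ℂ) + ((-(Real.pi * d.sign / 2) : ℝ) : ℂ) * Complex.I) := by
    rw [Complex.exp_add, ← Complex.ofReal_exp, Real.exp_neg, Real.exp_log hd']
    rcases lt_or_gt_of_ne hd with h | h
    · have h' : (d : ℝ) < 0 := by exact_mod_cast h
      have : ((-(Real.pi * d.sign / 2) : ℝ) : ℂ) * Complex.I = (Real.pi / 2) * Complex.I := by
        rw [Int.sign_eq_neg_one_of_neg h]; push_cast; ring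
      rw [this, Complex.exp_pi_div_two_mul_I, abs_of_neg h']
      push_cast
      field_simp
    · have h' : (0 : ℝ) < d := by exact_mod_cast h
      have : ((-(Real.pi * d.sign / 2) : ℝ) : ℂ) * Complex.I = -((Real.pi / 2) * Complex.I) := by
        rw [Int.sign_eq_one_of_pos h]; push_cast; ring
      rw [this, Complex.exp_neg, Complex.exp_pi_div_two_mul_I, abs_of_pos h', Complex.inv_I]
      push_cast
      field_simp
  have hs : |(d.sign : ℝ)| ≤ 1 := by
    rcases lt_or_gt_of_ne hd with h | h
    · simp [Int.sign_eq_neg_one_of_neg h]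
    · simp [Int.sign_eq_one_of_pos h]
  rw [abs_le] at hs
  have hpi := Real.pi_pos
  rw [Complex.cpow_def_of_ne_zero (by simpa using hd), key, Complex.log_exp]
  · rw [add_mul, Complex.exp_add]
    congr 1
    · rw [show ((-Real.log |(d : ℝ)| : ℝ) : ℂ) * (1 / 2) = ((-(Real.log |(d : ℝ)| / 2) : ℝ) : ℂ) by
        push_cast; ring, ← Complex.ofReal_exp, Real.exp_neg, ← Real.log_sqrt hd'.le,
        Real.exp_log (Real.sqrt_pos.mpr hd'), one_div]
    · congr 1
      push_cast
      ring
  · simp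
    nlinarith
  · simp
    nlinarith

/-- Asymptotics of the Jacobi theta function at the cusp `1 / d`, for `d` even. -/
theorem tendsto_sqrt_mul_jacobiTheta {d : ℤ} (hd : d ≠ 0) (heven : Even d) :
    Tendsto (fun t : ℝ => (√t : ℂ) * jacobiTheta (1 / d + Complex.I * t)) (𝓝[>] 0)
      (𝓝 ((1 / √|(d : ℝ)| : ℝ) * Complex.exp (Real.pi * Complex.I * d.sign / 4))) := by
  have hdC : (d : ℂ) ≠ 0 := Int.cast_ne_zero.mpr hd
  have hd' : (0 : ℝ) < |(d : ℝ)| := by positivity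
  have hslit : -Complex.I * (1 / d + Complex.I * (0 : ℝ)) ∈ Complex.slitPlane := by
    rw [Complex.mem_slitPlane_iff]
    right
    simpa using hd
  have h1 : Tendsto (fun t : ℝ => ((-Complex.I * (1 / d + Complex.I * t)) ^ (1 / 2 : ℂ))⁻¹)
      (𝓝[>] 0) (𝓝 ((-Complex.I * (1 / d)) ^ (1 / 2 : ℂ))⁻¹) := by
    have hc : ContinuousAt (fun t : ℝ => (-Complex.I * (1 / d + Complex.I * t)) ^ (1 / 2 : ℂ)) 0 :=
      ContinuousAt.cpow (by fun_prop) (by fun_prop) hslit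
    have := (hc.inv₀ ?_).tendsto
    · simpa [Pi.inv_def] using this.mono_left nhdsWithin_le_nhds
    · rw [Complex.cpow_ne_zero_iff_of_exponent_ne_zero (by norm_num)]
      exact Complex.slitPlane_ne_zero hslit
  have h2 : Tendsto (fun t : ℝ => ((1 + Complex.I * d * t)⁻¹ ^ (1 / 2 : ℂ))⁻¹)
      (𝓝[>] 0) (𝓝 1) := by
    have hc : ContinuousAt (fun t : ℝ => ((1 + Complex.I * d * t)⁻¹ ^ (1 / 2 : ℂ))) 0 :=
      ContinuousAt.cpow (ContinuousAt.inv₀ (by fun_prop) (by simp)) (by fun_prop) (by simp)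
    have := (hc.inv₀ (by simp)).tendsto
    simpa [Pi.inv_def] using this.mono_left nhdsWithin_le_nhds
  have h3 : Tendsto (fun t : ℝ => jacobiTheta (Complex.I * (1 / (d ^ 2 * t) : ℝ) - 1 / d))
      (𝓝[>] 0) (𝓝 1) := by
    refine tendsto_jacobiTheta_im_atTop.comp (tendsto_comap_iff.mpr ?_)
    have := tendsto_inv_nhdsGT_zero.const_mul_atTop (show (0 : ℝ) < ((d : ℝ) ^ 2)⁻¹ by positivity)
    refine this.congr fun t => ?_
    have him : (1 / (d : ℂ)).im = 0 := by
      rw [← Complex.ofReal_intCast, ← Complex.ofReal_one, ← Complex.ofReal_div, Complex.ofReal_im]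
    simp only [Function.comp, Complex.sub_im, him, Complex.I_mul_im, Complex.ofReal_re]
    rw [one_div, mul_inv, sub_zero]
  have h4 := ((h1.mul h2).mul h3).mul_const ((1 / |(d : ℝ)| : ℝ) : ℂ)
  convert h4.congr' ?_ using 2
  · rw [neg_I_div_cpow_half hd, Complex.exp_neg, mul_inv, inv_inv, mul_one, mul_one]
    generalize Complex.exp (Real.pi * Complex.I * d.sign / 4) = w
    rw [mul_right_comm]
    congr 1
    rw [← Complex.ofReal_inv, ← Complex.ofReal_mul]
    congr 1
    have := Real.sq_sqrt hd'.le
    have := (Real.sqrt_pos.mpr hd').ne'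
    field_simp
    linarith
  · filter_upwards [self_mem_nhdsWithin] with t ht
    have ht : 0 < t := ht
    have htC : (t : ℂ) ≠ 0 := by exact_mod_cast ht.ne'
    have hu : (1 + Complex.I * d * t) ≠ 0 := fun h => by
      have := congrArg Complex.re h
      simp at this
    have him : (1 / (d : ℂ)).im = 0 := by
      rw [← Complex.ofReal_intCast, ← Complex.ofReal_one, ← Complex.ofReal_div, Complex.ofReal_im]
    set τ : ℂ := 1 / d + Complex.I * t with hτdef
    have hτ : 0 < τ.im := by simp [hτdef, ht]
    have hτ0 : τ ≠ 0 := fun h => by simp [h] at hτ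
    set σ : ℂ := -1 / τ + d with hσdef
    have hσ : 0 < σ.im := by
      have : 0 < (-1 / τ).im := by
        rw [neg_div, one_div, ← inv_neg, Complex.inv_im]
        have := Complex.normSq_pos.mpr (neg_ne_zero.mpr hτ0)
        simp only [Complex.neg_im, neg_neg]
        positivity
      simpa [hσdef] using this
    have hσeq : σ = Complex.I * (d ^ 2 * t) / (1 + Complex.I * d * t) := by
      have : τ = (1 + Complex.I * d * t) / d := by rw [hτdef]; field_simp
      rw [hσdef, this]
      field_simp
      ring
    have hinv : -1 / σ = Complex.I * (1 / (d ^ 2 * t) : ℝ) - 1 / d := by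
      rw [hσeq]
      push_cast
      field_simp
      linear_combination (-1 : ℂ) * Complex.I_sq
    have e1 := jacobiTheta_neg_one_div hτ
    have e2 := jacobiTheta_neg_one_div hσ
    have e3 : jacobiTheta (-1 / τ) = jacobiTheta σ := by
      rw [← jacobiTheta_sub_even σ heven, hσdef, add_sub_cancel_right]
    have e4 : (-Complex.I * σ) ^ (1 / 2 : ℂ) =
        ((|(d : ℝ)| * √t : ℝ) : ℂ) * (1 + Complex.I * d * t)⁻¹ ^ (1 / 2 : ℂ) := by
      have : -Complex.I * σ = ((d ^ 2 * t : ℝ) : ℂ) * (1 + Complex.I * d * t)⁻¹ := by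
        rw [hσeq]
        push_cast
        field_simp
        linear_combination (-1 : ℂ) * Complex.I_sq
      rw [this, Complex.cpow_def_of_ne_zero (mul_ne_zero (Complex.ofReal_ne_zero.mpr (by positivity)) (inv_ne_zero hu)),
        Complex.log_ofReal_mul (by positivity) (inv_ne_zero hu), add_mul, Complex.exp_add,
        ← Complex.cpow_def_of_ne_zero (inv_ne_zero hu)]
      congr 1
      rw [show ((Real.log (d ^ 2 * t) : ℝ) : ℂ) * (1 / 2) = ((Real.log (d ^ 2 * t) / 2 : ℝ) : ℂ) by
        push_cast; ring, ← Complex.ofReal_exp, ← Real.log_sqrt (by positivity),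
        Real.exp_log (Real.sqrt_pos.mpr (by positivity)), Real.sqrt_mul (by positivity),
        Real.sqrt_sq_eq_abs]
    have c1 : (-Complex.I * τ) ^ (1 / 2 : ℂ) ≠ 0 := by
      rw [Complex.cpow_ne_zero_iff_of_exponent_ne_zero (by norm_num)]
      simpa using hτ0
    have c2 : (1 + Complex.I * d * t)⁻¹ ^ (1 / 2 : ℂ) ≠ 0 := by
      rw [Complex.cpow_ne_zero_iff_of_exponent_ne_zero (by norm_num)]
      exact inv_ne_zero hu
    rw [← hinv, e2, ← e3, e1, e4]
    have : ((|(d : ℝ)| : ℝ) : ℂ) ≠ 0 := by exact_mod_cast hd'.ne'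
    push_cast
    generalize (1 + Complex.I * d * t)⁻¹ ^ (1 / 2 : ℂ) = w at c2 ⊢
    field_simp

/-- Evaluation of the quadratic Gauss sum with even denominator `d`. -/
theorem sum_exp_sq_div {d : ℤ} (hd : d ≠ 0) (heven : Even d) (N : ℕ) [NeZero N]
    (hg : ∀ q c : ℤ, Complex.exp (Real.pi * Complex.I * (((q * N + c : ℤ) : ℂ) ^ 2 / d)) =
      Complex.exp (Real.pi * Complex.I * ((c : ℂ) ^ 2 / d))) :
    ∑ c : ZMod N, Complex.exp (Real.pi * Complex.I * ((c.val : ℂ) ^ 2 / d)) =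
      (N / √|(d : ℝ)| : ℝ) * Complex.exp (Real.pi * Complex.I * d.sign / 4) := by
  have h1 := tendsto_sqrt_mul_tsum_of_periodic N
    (fun n : ℤ => Complex.exp (Real.pi * Complex.I * ((n : ℂ) ^ 2 / d))) hg
  have h2 := tendsto_sqrt_mul_jacobiTheta hd heven
  have hN : (N : ℂ) ≠ 0 := Nat.cast_ne_zero.mpr (NeZero.ne N)
  have := tendsto_nhds_unique (h1.congr fun t => ?_) h2
  · rw [div_eq_iff hN] at this
    rw [show ∑ c : ZMod N, Complex.exp (Real.pi * Complex.I * ((c.val : ℂ) ^ 2 / d)) =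
      ∑ c : Fin N, Complex.exp (Real.pi * Complex.I * (((c : ℕ) : ℂ) ^ 2 / d)) by
        obtain ⟨M, rfl⟩ := Nat.exists_eq_succ_of_ne_zero (NeZero.ne N)
        rfl]
    simp only [Int.cast_natCast] at this
    rw [this]
    push_cast
    ring
  · rw [jacobiTheta]
    congr 1
    refine tsum_congr fun n => ?_
    rw [Complex.ofReal_exp, ← Complex.exp_add]
    congr 1
    push_cast
    linear_combination (-(Real.pi * n ^ 2 * t) : ℂ) * Complex.I_sq

/-- A Gauss sum of a function `F` of quadratic type along `φ`, equal to `1` on the orthogonal of the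
image of `φ`, is a natural number (the order of that orthogonal). -/
theorem sum_eq_card_of_quadratic {V W : Type*} [AddCommGroup V] [Fintype V]
    [AddCommGroup W] [Fintype W] (F : V → ℂ) (φ : W →+ V)
    (hφ : ∀ z x y, F (z + φ (x + y)) * F z = F (z + φ x) * F (z + φ y))
    (hfix : ∀ z, (∀ x, F (z + φ x) = F z) → F z = 1) :
    ∃ k : ℕ, ∑ z, F z = k := by
  classical
  have hsum (z : V) : ∑ x, F (z + φ x) =
      if ∀ x, F (z + φ x) = F z then (Fintype.card W : ℂ) else 0 := by
    split_ifs with h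
    · simp [h, hfix z h]
    · push Not at h
      obtain ⟨x, hx⟩ := h
      have h1 : (∑ y, F (z + φ (x + y))) * F z = F (z + φ x) * ∑ y, F (z + φ y) := by
        rw [Finset.sum_mul, Finset.mul_sum]
        exact Finset.sum_congr rfl fun y _ => hφ z x y
      rw [show ∑ y, F (z + φ (x + y)) = ∑ y, F (z + φ y) from
        Equiv.sum_comp (Equiv.addLeft x) fun y => F (z + φ y)] at h1
      have h2 : (F (z + φ x) - F z) * ∑ y, F (z + φ y) = 0 := by linear_combination -h1
      exact (mul_eq_zero.mp h2).resolve_left (sub_ne_zero.mpr hx)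
  refine ⟨(Finset.univ.filter fun z => ∀ x, F (z + φ x) = F z).card, ?_⟩
  have hW : (Fintype.card W : ℂ) ≠ 0 := Nat.cast_ne_zero.mpr Fintype.card_ne_zero
  have h1 : (Fintype.card W : ℂ) * ∑ z, F z = ∑ z, ∑ x, F (z + φ x) := by
    rw [Finset.sum_comm]
    have (x : W) : ∑ z, F (z + φ x) = ∑ z, F z := Equiv.sum_comp (Equiv.addRight (φ x)) F
    simp [this]
  rw [Finset.sum_congr rfl fun z _ => hsum z, ← Finset.sum_filter, Finset.sum_const,
    nsmul_eq_mul, mul_comm] at h1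
  exact mul_right_cancel₀ hW h1

theorem exp_pi_mul_I_mul_eq_iff (x y : ℝ) :
    Complex.exp (Real.pi * Complex.I * x) = Complex.exp (Real.pi * Complex.I * y) ↔
      ∃ k : ℤ, x = y + 2 * k := by
  rw [Complex.exp_eq_exp_iff_exists_int]
  refine exists_congr fun k => ?_
  have hpi : (Real.pi : ℂ) * Complex.I ≠ 0 := by simp [Real.pi_ne_zero]
  rw [show (Real.pi : ℂ) * Complex.I * y + k * (2 * Real.pi * Complex.I) =
    Real.pi * Complex.I * ((y + 2 * k : ℝ) : ℂ) by push_cast; ring, mul_right_inj' hpi,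
    Complex.ofReal_inj]

/-- A symmetric integer matrix can be diagonalized by a nonsingular integer change of variables. -/
theorem exists_integral_diagonalization {r : ℕ} (A : Matrix (Fin r) (Fin r) ℤ) (hsymm : A.IsSymm) :
    ∃ (P : Matrix (Fin r) (Fin r) ℤ) (d : Fin r → ℤ), P.det ≠ 0 ∧ Pᵀ * A * P = diagonal d := by
  set Aq : Matrix (Fin r) (Fin r) ℚ := A.map (Int.castRingHom ℚ) with hAq
  have hB : LinearMap.IsSymm (Matrix.toBilin' Aq) :=
    LinearMap.BilinForm.isSymm_iff.mp (Matrix.isSymm_toBilin'_iff_isSymm.mpr (hsymm.map _))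
  have : Invertible (2 : ℚ) := invertibleOfNonzero two_ne_zero
  obtain ⟨v', hv'⟩ := LinearMap.BilinForm.exists_orthogonal_basis hB
  let e : Fin (Module.finrank ℚ (Fin r → ℚ)) ≃ Fin r := finCongr (by simp)
  let v := v'.reindex e
  have hv (i j : Fin r) (hij : i ≠ j) : v i ⬝ᵥ Aq *ᵥ v j = 0 := by
    have := hv' (show e.symm i ≠ e.symm j by simpa using hij)
    simpa [v, Matrix.toBilin'_apply', Function.onFun] using this
  let U : Matrix (Fin r) (Fin r) ℚ := (Pi.basisFun ℚ (Fin r)).toMatrix v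
  have hU : U.det ≠ 0 := by
    have := (Pi.basisFun ℚ (Fin r)).invertibleToMatrix v
    exact (Matrix.isUnit_det_of_invertible U).ne_zero
  obtain ⟨b, hb⟩ := IsLocalization.exist_integer_multiples_of_finite (nonZeroDivisors ℤ)
    (fun p : Fin r × Fin r => U p.1 p.2)
  choose p hp using hb
  let P : Matrix (Fin r) (Fin r) ℤ := of fun i j => p (i, j)
  have hPU : P.map (Int.castRingHom ℚ) = ((b : ℤ) : ℚ) • U := by
    ext i j
    simpa [P] using hp (i, j)
  have hPij (i j : Fin r) (hij : i ≠ j) : (Pᵀ * A * P) i j = 0 := by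
    have h1 : (Pᵀ * A * P).map (Int.castRingHom ℚ) =
        (((b : ℤ) : ℚ) * ((b : ℤ) : ℚ)) • (Uᵀ * Aq * U) := by
      rw [Matrix.map_mul, Matrix.map_mul, Matrix.transpose_map, hPU, hAq]
      simp [smul_smul]
    have h2 : (Uᵀ * Aq * U) i j = v i ⬝ᵥ Aq *ᵥ v j := by
      rw [Matrix.mul_assoc, Matrix.mul_apply']
      rfl
    have h3 := congrFun (congrFun h1 i) j
    rw [Matrix.smul_apply, h2, hv i j hij] at h3
    simpa using h3
  refine ⟨P, fun i => (Pᵀ * A * P) i i, fun h => ?_, ?_⟩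
  · have h1 : (P.map (Int.castRingHom ℚ)).det = 0 := by
      rw [← RingHom.mapMatrix_apply, ← RingHom.map_det, h, map_zero]
    rw [hPU, Matrix.det_smul] at h1
    have hb0 : ((b : ℤ) : ℚ) ≠ 0 := Int.cast_ne_zero.mpr (nonZeroDivisors.coe_ne_zero b)
    exact mul_ne_zero (pow_ne_zero _ hb0) hU h1
  · ext i j
    by_cases hij : i = j
    · subst hij; simp
    · rw [hPij i j hij, diagonal_apply_ne _ hij]

theorem equivalent_weightedSumSquares_of_diagonal {r : ℕ} (A U : Matrix (Fin r) (Fin r) ℝ) (w : Fin r → ℝ)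
    (hU : IsUnit U.det) (h : Uᵀ * A * U = diagonal w) :
    QuadraticMap.Equivalent (Matrix.toQuadraticForm' A) (QuadraticMap.weightedSumSquares ℝ w) := by
  refine QuadraticMap.Equivalent.symm ⟨⟨Matrix.toLinearEquiv' U (U.invertibleOfIsUnitDet hU), fun x => ?_⟩⟩
  have : (Matrix.toQuadraticForm' A) (U *ᵥ x) = (U *ᵥ x) ⬝ᵥ A *ᵥ (U *ᵥ x) := by
    simp [Matrix.toQuadraticForm', Matrix.toLinearMap₂'_apply']
  have h2 : (U *ᵥ x) ⬝ᵥ A *ᵥ (U *ᵥ x) = x ⬝ᵥ (Uᵀ * A * U) *ᵥ x := by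
    rw [← Matrix.mulVec_mulVec, ← Matrix.mulVec_mulVec, Matrix.dotProduct_mulVec x Uᵀ,
      Matrix.vecMul_transpose]
  change (Matrix.toQuadraticForm' A) (U *ᵥ x) = _
  rw [this, h2, h, QuadraticMap.weightedSumSquares_apply, dotProduct]
  refine Finset.sum_congr rfl fun i _ => ?_
  rw [mulVec_diagonal, smul_eq_mul]
  ring

/-- Sylvester's law of inertia, comparing eigenvalues with any diagonalization by congruence. -/
theorem card_eigenvalues_eq_of_diagonal {r : ℕ} (A : Matrix (Fin r) (Fin r) ℝ) (hA : A.IsHermitian)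
    (U : Matrix (Fin r) (Fin r) ℝ) (w : Fin r → ℝ)
    (hU : IsUnit U.det) (h : Uᵀ * A * U = diagonal w) :
    {i | 0 < hA.eigenvalues i}.ncard = {i | 0 < w i}.ncard ∧
      {i | hA.eigenvalues i < 0}.ncard = {i | w i < 0}.ncard := by
  have e1 := equivalent_weightedSumSquares_of_diagonal A U w hU h
  have e2 : QuadraticMap.Equivalent (Matrix.toQuadraticForm' A)
      (QuadraticMap.weightedSumSquares ℝ hA.eigenvalues) := by
    refine equivalent_weightedSumSquares_of_diagonal A hA.eigenvectorUnitary _ ?_ ?_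
    · exact (Matrix.isUnit_iff_isUnit_det _).mp (Unitary.toUnits hA.eigenvectorUnitary).isUnit
    · have := hA.conjStarAlgAut_star_eigenvectorUnitary
      rw [Unitary.conjStarAlgAut_star_apply] at this
      exact this
  exact ⟨(QuadraticForm.sigPos_of_equiv_weightedSumSquares e2).symm.trans
      (QuadraticForm.sigPos_of_equiv_weightedSumSquares e1),
    (QuadraticForm.sigNeg_of_equiv_weightedSumSquares e2).symm.trans
      (QuadraticForm.sigNeg_of_equiv_weightedSumSquares e1)⟩

/-- The Gauss sum attached to a diagonalization of an even unimodular matrix is a natural number. -/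
theorem exists_sum_exp_eq_natCast {r : ℕ} (A P : Matrix (Fin r) (Fin r) ℤ) (hsymm : A.IsSymm)
    (heven : ∀ x : Fin r → ℤ, Even (x ⬝ᵥ A *ᵥ x)) (hdet : IsUnit A.det) (d : Fin r → ℤ)
    (hd : ∀ i, d i ≠ 0) (hP : Pᵀ * A * P = diagonal d) (N : ℕ) [NeZero N]
    (hper : ∀ i, ∀ q c : ℤ,
      Complex.exp (Real.pi * Complex.I * (((q * N + c : ℤ) : ℂ) ^ 2 / d i)) =
        Complex.exp (Real.pi * Complex.I * ((c : ℂ) ^ 2 / d i))) :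
    ∃ k : ℕ, ∑ z : Fin r → ZMod N,
      ∏ i, Complex.exp (Real.pi * Complex.I * (((z i).val : ℂ) ^ 2 / d i)) = k := by
  let ι := Int.castRingHom ℝ
  let v (z : Fin r → ℤ) : Fin r → ℝ := fun i => z i
  let D : Matrix (Fin r) (Fin r) ℝ := diagonal fun i => (d i : ℝ)⁻¹
  let M := Pᵀ * A
  let Q (z : Fin r → ℤ) : ℝ := v z ⬝ᵥ D *ᵥ v z
  let f (z : Fin r → ℤ) : ℂ := Complex.exp (Real.pi * Complex.I * Q z)
  have hv (X : Matrix (Fin r) (Fin r) ℤ) (z : Fin r → ℤ) : v (X *ᵥ z) = X.map ι *ᵥ v z := by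
    ext i
    exact RingHom.map_mulVec ι X z i
  have hvdot (x y : Fin r → ℤ) : v x ⬝ᵥ v y = ((x ⬝ᵥ y : ℤ) : ℝ) :=
    (RingHom.map_dotProduct ι x y).symm
  have hDP : D * ((P.map ι)ᵀ * A.map ι * P.map ι) = 1 := by
    have : (P.map ι)ᵀ * A.map ι * P.map ι = diagonal fun i => (d i : ℝ) := by
      have := congrArg (fun X : Matrix (Fin r) (Fin r) ℤ => X.map ι) hP
      simp only [Matrix.map_mul, Matrix.transpose_map] at this
      rw [this, diagonal_map (map_zero ι)]
      rfl
    rw [this, diagonal_mul_diagonal, ← diagonal_one]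
    congr 1
    ext i
    exact inv_mul_cancel₀ (Int.cast_ne_zero.mpr (hd i))
  have hMmap : M.map ι = (P.map ι)ᵀ * A.map ι := by
    simp [M, Matrix.map_mul, Matrix.transpose_map]
  have hPDM : P.map ι * (D * M.map ι) = 1 := by
    rw [mul_eq_one_comm, hMmap, Matrix.mul_assoc, hDP]
  have hMPD : M.map ι * (P.map ι * D) = 1 := by
    rw [mul_eq_one_comm, Matrix.mul_assoc, hPDM]
  have hMT : (M.map ι)ᵀ = A.map ι * P.map ι := by
    rw [hMmap, transpose_mul, transpose_transpose, ← transpose_map, hsymm.eq]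
  have hDT : Dᵀ = D := diagonal_transpose _
  have hB (x y : Fin r → ℤ) : v (M *ᵥ x) ⬝ᵥ D *ᵥ v (M *ᵥ y) = ((x ⬝ᵥ A *ᵥ y : ℤ) : ℝ) := by
    rw [← hvdot, hv, hv, hv, ← vecMul_transpose, ← dotProduct_mulVec, hMT]
    simp only [mulVec_mulVec]
    rw [Matrix.mul_assoc, hPDM, Matrix.mul_one]
  have hDsymm (x y : Fin r → ℝ) : x ⬝ᵥ D *ᵥ y = y ⬝ᵥ D *ᵥ x := by
    rw [dotProduct_mulVec, ← mulVec_transpose, hDT, dotProduct_comm]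
  have hvadd (x y : Fin r → ℤ) : v (x + y) = v x + v y := by
    ext i; simp [v]
  have hQadd (x y : Fin r → ℤ) : Q (x + y) = Q x + 2 * (v x ⬝ᵥ D *ᵥ v y) + Q y := by
    simp only [Q, hvadd, mulVec_add, dotProduct_add, add_dotProduct]
    rw [hDsymm (v y) (v x)]
    ring
  have hfprod (z : Fin r → ℤ) :
      f z = ∏ i, Complex.exp (Real.pi * Complex.I * ((z i : ℂ) ^ 2 / d i)) := by
    rw [← Complex.exp_sum, ← Finset.mul_sum]
    simp only [f, Q, D, dotProduct, mulVec_diagonal, v]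
    congr 2
    push_cast
    refine Finset.sum_congr rfl fun i _ => ?_
    ring
  let lift (z : Fin r → ZMod N) : Fin r → ℤ := fun i => ((z i).val : ℤ)
  let red (z : Fin r → ℤ) : Fin r → ZMod N := fun i => (z i : ZMod N)
  let F (z : Fin r → ZMod N) : ℂ := f (lift z)
  have hred_lift (z : Fin r → ZMod N) : red (lift z) = z := by
    ext i; simp [red, lift]
  have hred_add (x y : Fin r → ℤ) : red (x + y) = red x + red y := by
    ext i; simp [red]
  have hF (z : Fin r → ℤ) : F (red z) = f z := by
    simp only [F, hfprod]
    refine Finset.prod_congr rfl fun i _ => ?_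
    have : lift (red z) i = z i % N := by
      simp only [lift, red, ZMod.val_intCast]
    rw [this, ← hper i (z i / N), Int.ediv_mul_add_emod]
  let φ : (Fin r → ZMod N) →+ (Fin r → ZMod N) :=
    (M.map (Int.castRingHom (ZMod N))).mulVecLin.toAddMonoidHom
  have hφ (x : Fin r → ℤ) : φ (red x) = red (M *ᵥ x) := by
    ext i
    exact (RingHom.map_mulVec (Int.castRingHom (ZMod N)) M x i).symm
  have hsurj : Function.Surjective red := fun z => ⟨lift z, hred_lift z⟩
  have hFφ (z x : Fin r → ℤ) : F (red z + φ (red x)) = f (z + M *ᵥ x) := by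
    rw [hφ, ← hred_add, hF]
  have hQM (x : Fin r → ℤ) : ∃ k : ℤ, Q (M *ᵥ x) = 2 * k := by
    obtain ⟨k, hk⟩ := heven x
    refine ⟨k, ?_⟩
    simp only [Q]
    rw [hB, hk]
    push_cast
    ring
  have hf1 (z : Fin r → ℤ) : f z = 1 ↔ ∃ k : ℤ, Q z = 2 * k := by
    have := exp_pi_mul_I_mul_eq_iff (Q z) 0
    simpa [f] using this
  have hsumF : ∃ k : ℕ, ∑ z, F z = k := by
    refine sum_eq_card_of_quadratic F φ ?_ ?_
    · intro z x y
      obtain ⟨z, rfl⟩ := hsurj z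
      obtain ⟨x, rfl⟩ := hsurj x
      obtain ⟨y, rfl⟩ := hsurj y
      rw [← hred_add, hFφ, hFφ, hFφ, hF]
      simp only [f]
      rw [← Complex.exp_add, ← Complex.exp_add, ← mul_add, ← mul_add, ← Complex.ofReal_add,
        ← Complex.ofReal_add, exp_pi_mul_I_mul_eq_iff]
      refine ⟨x ⬝ᵥ A *ᵥ y, ?_⟩
      rw [← hB]
      simp only [hQadd, mulVec_add, hvadd, dotProduct_add]
      ring
    · intro z h
      obtain ⟨z, rfl⟩ := hsurj z
      rw [hF]
      have hz (x : Fin r → ℤ) : ∃ k : ℤ, v z ⬝ᵥ D *ᵥ v (M *ᵥ x) = k := by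
        have := h (red x)
        rw [hFφ, hF] at this
        obtain ⟨k, hk⟩ := (exp_pi_mul_I_mul_eq_iff _ _).mp this
        obtain ⟨l, hl⟩ := hQM x
        rw [hQadd, hl] at hk
        exact ⟨k - l, by push_cast; linarith⟩
      choose w hw using fun j => hz (Pi.single j 1)
      have hvw : v w = (A.map ι * P.map ι * D) *ᵥ v z := by
        ext j
        have h1 : v (Pi.single j 1) = Pi.single j 1 := by
          ext i
          by_cases hij : i = j
          · subst hij; simp [v]
          · simp [v, hij]
        have h2 := hw j
        rw [hDsymm, hv, ← vecMul_transpose, ← dotProduct_mulVec, h1, single_one_dotProduct, hMT,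
          mulVec_mulVec] at h2
        exact h2.symm
      have hAinv : A⁻¹.map ι * A.map ι = 1 := by
        rw [← Matrix.map_mul, Matrix.nonsing_inv_mul A hdet]
        exact Matrix.map_one ι (map_zero ι) (map_one ι)
      have hvx : v (A⁻¹ *ᵥ w) = (P.map ι * D) *ᵥ v z := by
        rw [hv, hvw, mulVec_mulVec, Matrix.mul_assoc (A.map ι), ← Matrix.mul_assoc, hAinv,
          Matrix.one_mul]
      have hMx : M *ᵥ (A⁻¹ *ᵥ w) = z := by
        have : v (M *ᵥ (A⁻¹ *ᵥ w)) = v z := by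
          rw [hv, hvx, mulVec_mulVec, hMPD, one_mulVec]
        ext i
        exact Int.cast_injective (congrFun this i)
      rw [hf1, ← hMx]
      exact hQM _
  obtain ⟨k, h⟩ := hsumF
  refine ⟨k, ?_⟩
  rw [← h]
  refine Finset.sum_congr rfl fun z _ => ?_
  simp only [F, hfprod, lift, Int.cast_natCast]

theorem exp_sq_div_periodic {d : ℤ} (hd : d ≠ 0) {N : ℕ} (hdN : d ∣ N) (h2 : 2 ∣ N) (q c : ℤ) :
    Complex.exp (Real.pi * Complex.I * (((q * N + c : ℤ) : ℂ) ^ 2 / d)) =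
      Complex.exp (Real.pi * Complex.I * ((c : ℂ) ^ 2 / d)) := by
  obtain ⟨e, he⟩ := hdN
  obtain ⟨m, hm⟩ := h2
  have hdR : (d : ℝ) ≠ 0 := Int.cast_ne_zero.mpr hd
  have heR : (N : ℝ) = d * e := by exact_mod_cast he
  have hmR : (N : ℝ) = 2 * m := by exact_mod_cast hm
  have := (exp_pi_mul_I_mul_eq_iff (((q * N + c : ℤ) : ℝ) ^ 2 / d) ((c : ℝ) ^ 2 / d)).mpr
    ⟨q * c * e + q ^ 2 * m * e, by
      push_cast
      field_simp
      linear_combination (q ^ 2 * N + 2 * q * c : ℝ) * heR + (q ^ 2 * d * e : ℝ) * hmR⟩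
  simpa using this

/-- If the eighth roots of unity attached to the signs of the `d i` multiply to a positive number, the
numbers of positive and negative `d i` agree modulo `8`. -/
theorem modEq_eight_of_prod_exp_eq {r : ℕ} (d : Fin r → ℤ) (a : Fin r → ℝ) (ha : ∀ i, 0 < a i)
    {k : ℕ} (h : ∏ i, ((a i : ℂ) * Complex.exp (Real.pi * Complex.I * (d i).sign / 4)) = k) :
    ((Finset.univ.filter fun i => 0 < d i).card : ℤ) ≡
      ((Finset.univ.filter fun i => d i < 0).card : ℤ) [ZMOD 8] := by
  set s : ℤ := ∑ i, (d i).sign with hs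
  have hcard : s = ((Finset.univ.filter fun i => 0 < d i).card : ℤ) -
      ((Finset.univ.filter fun i => d i < 0).card : ℤ) := by
    rw [hs, Finset.card_filter, Finset.card_filter]
    push_cast
    rw [← Finset.sum_sub_distrib]
    refine Finset.sum_congr rfl fun i _ => ?_
    rcases lt_trichotomy (d i) 0 with h | h | h
    · simp [Int.sign_eq_neg_one_of_neg h, h, not_lt.mpr h.le]
    · simp [h]
    · simp [Int.sign_eq_one_of_pos h, h, not_lt.mpr h.le]
  have hpos : 0 < ∏ i, a i := Finset.prod_pos fun i _ => ha i
  have hexp : ((∏ i, a i : ℝ) : ℂ) * Complex.exp ((Real.pi * s / 4 : ℝ) * Complex.I) = k := by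
    rw [← h, Finset.prod_mul_distrib, ← Complex.exp_sum]
    push_cast
    congr 2
    rw [hs, ← Finset.sum_div, ← Finset.mul_sum]
    push_cast
    ring
  have hk : (∏ i, a i) = k := by
    have := congrArg norm hexp
    rwa [norm_mul, Complex.norm_exp_ofReal_mul_I, Complex.norm_real, Real.norm_eq_abs,
      abs_of_pos hpos, mul_one, Complex.norm_natCast] at this
  have hone : Complex.exp ((Real.pi * s / 4 : ℝ) * Complex.I) = 1 := by
    have h0 : ((∏ i, a i : ℝ) : ℂ) ≠ 0 := Complex.ofReal_ne_zero.mpr hpos.ne'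
    refine mul_left_cancel₀ h0 ?_
    rw [hexp, mul_one, hk, Complex.ofReal_natCast]
  obtain ⟨n, hn⟩ := Complex.exp_eq_one_iff.mp hone
  have hn' : (s : ℂ) = 8 * n := by
    have hpi : (Real.pi : ℂ) * Complex.I ≠ 0 := by simp [Real.pi_ne_zero]
    refine mul_left_cancel₀ hpi ?_
    push_cast at hn
    linear_combination 4 * hn
  have hn'' : s = 8 * n := by exact_mod_cast hn'
  exact (Int.modEq_iff_dvd.mpr ⟨n, by rw [← hcard, hn'']⟩).symm


/-- An even unimodular symmetric integer matrix of signature `(m, n)` satisfies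
`m ≡ n (mod 8)`. -/
theorem even_unimodular_signature_mod_eight
    (r : ℕ) (hr : 1 ≤ r) (A : Matrix (Fin r) (Fin r) ℤ)
    (hsymm : A.IsSymm)
    (heven : ∀ x : Fin r → ℤ, Even (x ⬝ᵥ A.mulVec x))
    (hdet : A.det = 1 ∨ A.det = -1)
    (hA : (A.map ((↑) : ℤ → ℝ)).IsHermitian)
    (m n : ℕ)
    (hm : (Finset.univ.filter fun i => 0 < hA.eigenvalues i).card = m)
    (hn : (Finset.univ.filter fun i => hA.eigenvalues i < 0).card = n)
    (hmn : m + n = r) :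
    (m : ℤ) ≡ (n : ℤ) [ZMOD 8] := by
  obtain ⟨P, d, hPdet, hP⟩ := exists_integral_diagonalization A hsymm
  have hunit : IsUnit A.det := Int.isUnit_iff.mpr hdet
  have hd (i : Fin r) : d i ≠ 0 := by
    have h := congrArg Matrix.det hP
    rw [det_mul, det_mul, det_transpose, det_diagonal] at h
    have h0 : ∏ i, d i ≠ 0 := h ▸ mul_ne_zero (mul_ne_zero hPdet hunit.ne_zero) hPdet
    exact Finset.prod_ne_zero_iff.mp h0 i (Finset.mem_univ i)
  have hdeven (i : Fin r) : Even (d i) := by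
    have h : d i = (P *ᵥ Pi.single i 1) ⬝ᵥ A *ᵥ (P *ᵥ Pi.single i 1) := by
      rw [mulVec_mulVec, ← vecMul_transpose, ← dotProduct_mulVec, mulVec_mulVec, ← Matrix.mul_assoc,
        hP]
      simp
    exact h ▸ heven _
  let N : ℕ := 2 * ∏ i, (d i).natAbs
  have : NeZero N := ⟨mul_ne_zero two_ne_zero
    (Finset.prod_ne_zero_iff.mpr fun i _ => Int.natAbs_ne_zero.mpr (hd i))⟩
  have hper (i : Fin r) := exp_sq_div_periodic (N := N) (hd i)
    (Int.natAbs_dvd.mp (Int.natCast_dvd_natCast.mpr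
      ((Finset.dvd_prod_of_mem (fun i => (d i).natAbs) (Finset.mem_univ i)).mul_left 2)))
    (dvd_mul_right _ _)
  obtain ⟨k, hk⟩ := exists_sum_exp_eq_natCast A P hsymm heven hunit d hd hP N hper
  have hprod : ∏ i, ∑ c : ZMod N,
      Complex.exp (Real.pi * Complex.I * ((c.val : ℂ) ^ 2 / d i)) = k := by
    rw [Finset.prod_univ_sum, Fintype.piFinset_univ, hk]
  rw [Finset.prod_congr rfl fun i _ => sum_exp_sq_div (hd i) (hdeven i) N (hper i)] at hprod
  have hmod := modEq_eight_of_prod_exp_eq d (fun i => N / √|(d i : ℝ)|) (fun i => by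
    have := hd i
    have : (0 : ℝ) < N := Nat.cast_pos.mpr (NeZero.pos N)
    positivity) hprod
  obtain ⟨hp, hq⟩ := card_eigenvalues_eq_of_diagonal _ hA (P.map ((↑) : ℤ → ℝ))
    (fun i => (d i : ℝ)) (by
      have : (P.map ((↑) : ℤ → ℝ)).det = P.det := ((Int.castRingHom ℝ).map_det P).symm
      rw [this]
      exact (Int.cast_ne_zero.mpr hPdet).isUnit) (by
      have := congrArg (fun X : Matrix (Fin r) (Fin r) ℤ => X.map (Int.castRingHom ℝ)) hP
      simp only [Matrix.map_mul, Matrix.transpose_map, diagonal_map (map_zero _)] at this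
      exact this)
  have hcard (p : Fin r → Prop) [DecidablePred p] :
      (Finset.univ.filter p).card = {i | p i}.ncard := by
    rw [← Set.ncard_coe_finset, Finset.coe_filter_univ]
  rw [← hm, ← hn, hcard, hcard, hp, hq]
  rw [hcard, hcard] at hmod
  simpa only [Int.cast_pos, Int.cast_lt_zero] using hmod
end

section
/- Let m ≥ 1 and n ≥ 1, and let A and A' be symmetric (m+n)×(m+n) integer matrices, both even (xᵀAx is an even integer for every integer vector x) and unimodular (determinant ±1), and both of signature (m, n), i.e. each has exactly m positive and n negative eigenvalues as a real symmetric matrix. Then A and A' are integrally equivalent: there exists an integer matrix P with det P = ±1 such that PᵀAP = A'. -/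
open Matrix

section DiagonalForms

variable {K : Type*} [Field K] {ι κ μ : Type*} [Fintype ι] [Fintype κ] [Fintype μ]

/-- The diagonal bilinear form `⟨a i⟩` on `ι → K`. -/
noncomputable def diagForm (a : ι → Kˣ) : LinearMap.BilinForm K (ι → K) :=
  LinearMap.mk₂ K (fun x y => ∑ i, (a i : K) * x i * y i)
    (fun x x' y => by simp [mul_add, add_mul, Finset.sum_add_distrib])
    (fun c x y => by simp [Finset.mul_sum]; exact Finset.sum_congr rfl fun i _ => by ring)
    (fun x y y' => by simp [mul_add, Finset.sum_add_distrib])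
    (fun c x y => by simp [Finset.mul_sum]; exact Finset.sum_congr rfl fun i _ => by ring)

lemma diagForm_apply (a : ι → Kˣ) (x y : ι → K) :
    diagForm a x y = ∑ i, (a i : K) * x i * y i := rfl

lemma diagForm_comm (a : ι → Kˣ) (x y : ι → K) : diagForm a x y = diagForm a y x := by
  simp only [diagForm_apply]
  exact Finset.sum_congr rfl fun i _ => by ring

lemma diagForm_isSymm (a : ι → Kˣ) : (diagForm a).IsSymm := ⟨fun x y => diagForm_comm a x y⟩

lemma diagForm_isRefl (a : ι → Kˣ) : (diagForm a).IsRefl := (diagForm_isSymm a).isRefl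

lemma diagForm_nondegenerate (a : ι → Kˣ) : (diagForm a).Nondegenerate := by
  classical
  refine (diagForm_isRefl a).nondegenerate_iff_separatingLeft.mpr fun x hx => ?_
  funext i
  have := hx (Pi.single i 1)
  simpa [diagForm_apply, Pi.single_apply] using this

lemma diagForm_neg (a : ι → Kˣ) (x y : ι → K) :
    diagForm (fun i => -a i) x y = -diagForm a x y := by
  simp [diagForm_apply]

lemma diagForm_sumElim (a : ι → Kˣ) (b : κ → Kˣ) (x y : ι ⊕ κ → K) :
    diagForm (Sum.elim a b) x y
      = diagForm a (x ∘ Sum.inl) (y ∘ Sum.inl) + diagForm b (x ∘ Sum.inr) (y ∘ Sum.inr) := by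
  simp [diagForm_apply]

/-- A diagonal form is metabolic if it has a totally isotropic subspace of half the dimension. -/
def Metabolic (a : ι → Kˣ) : Prop :=
  ∃ W : Submodule K (ι → K), (∀ x ∈ W, ∀ y ∈ W, diagForm a x y = 0) ∧
    Fintype.card ι ≤ 2 * Module.finrank K W

lemma orthogonal_eq_self_of_isotropic {a : ι → Kˣ} {W : Submodule K (ι → K)}
    (hW : ∀ x ∈ W, ∀ y ∈ W, diagForm a x y = 0)
    (hcard : Fintype.card ι ≤ 2 * Module.finrank K W) :
    (diagForm a).orthogonal W = W := by
  symm
  apply Submodule.eq_of_le_of_finrank_le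
  · intro x hx y hy
    exact hW y hy x hx
  · rw [LinearMap.BilinForm.finrank_orthogonal (diagForm_nondegenerate a)]
    simp
    omega

lemma Metabolic.comp_equiv {a : ι → Kˣ} (h : Metabolic a) (e : κ ≃ ι) : Metabolic (a ∘ e) := by
  obtain ⟨W, hW, hc⟩ := h
  refine ⟨W.map (LinearEquiv.funCongrLeft K K e).toLinearMap, ?_, ?_⟩
  · rintro _ ⟨x, hx, rfl⟩ _ ⟨y, hy, rfl⟩
    rw [← hW x hx y hy]
    simp only [diagForm_apply]
    exact Fintype.sum_equiv e _ _ fun i => rfl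
  · rw [LinearEquiv.finrank_map_eq, Fintype.card_congr e]
    exact hc

lemma Metabolic.neg {a : ι → Kˣ} (h : Metabolic a) : Metabolic (fun i => -a i) := by
  obtain ⟨W, hW, hc⟩ := h
  exact ⟨W, fun x hx y hy => by rw [diagForm_neg, hW x hx y hy, neg_zero], hc⟩

lemma Metabolic.sumElim {a : ι → Kˣ} {b : κ → Kˣ} (ha : Metabolic a) (hb : Metabolic b) :
    Metabolic (Sum.elim a b) := by
  obtain ⟨W, hW, hc⟩ := ha
  obtain ⟨W', hW', hc'⟩ := hb
  let S : (W × W') →ₗ[K] (ι ⊕ κ → K) :=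
    (LinearEquiv.sumArrowLequivProdArrow ι κ K K).symm.toLinearMap ∘ₗ W.subtype.prodMap W'.subtype
  have hinl : ∀ x, S x ∘ Sum.inl = x.1 := fun x => rfl
  have hinr : ∀ x, S x ∘ Sum.inr = x.2 := fun x => rfl
  refine ⟨LinearMap.range S, ?_, ?_⟩
  · rintro _ ⟨x, rfl⟩ _ ⟨y, rfl⟩
    rw [diagForm_sumElim, hinl, hinl, hinr, hinr, hW _ x.1.2 _ y.1.2, hW' _ x.2.2 _ y.2.2, add_zero]
  · rw [LinearMap.finrank_range_of_inj, Module.finrank_prod, Fintype.card_sum]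
    · omega
    · intro x y hxy
      refine Prod.ext (Subtype.ext ?_) (Subtype.ext ?_)
      · rw [← hinl x, hxy, hinl]
      · rw [← hinr x, hxy, hinr]

/-- The graph of an isometry is a totally isotropic subspace of half the dimension. -/
lemma metabolic_of_isometry {a : ι → Kˣ} {b : κ → Kˣ} (T : (κ → K) →ₗ[K] (ι → K))
    (hT : ∀ x y, diagForm a (T x) (T y) = diagForm b x y)
    (hcard : Fintype.card ι = Fintype.card κ) :
    Metabolic (Sum.elim a fun j => -b j) := by
  let S : (κ → K) →ₗ[K] (ι ⊕ κ → K) :=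
    (LinearEquiv.sumArrowLequivProdArrow ι κ K K).symm.toLinearMap ∘ₗ T.prod LinearMap.id
  have hinl : ∀ x, S x ∘ Sum.inl = T x := fun x => rfl
  have hinr : ∀ x, S x ∘ Sum.inr = x := fun x => rfl
  refine ⟨LinearMap.range S, ?_, ?_⟩
  · rintro _ ⟨x, rfl⟩ _ ⟨y, rfl⟩
    rw [diagForm_sumElim, diagForm_neg, hinl, hinl, hinr, hinr, hT, add_neg_cancel]
  · rw [LinearMap.finrank_range_of_inj]
    · simp
      omega
    · intro x y hxy
      rw [← hinr x, hxy, hinr]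

/-- Metabolic summands can be cancelled. -/
lemma Metabolic.cancel {a : ι → Kˣ} {b : κ → Kˣ} (h : Metabolic (Sum.elim a b))
    (hb : Metabolic b) : Metabolic a := by
  obtain ⟨W, hW, hc⟩ := h
  obtain ⟨N, hN, hcN⟩ := hb
  have hWo := orthogonal_eq_self_of_isotropic hW hc
  have hNo := orthogonal_eq_self_of_isotropic hN hcN
  let E := LinearEquiv.sumArrowLequivProdArrow ι κ K K
  let inr : (κ → K) →ₗ[K] (ι ⊕ κ → K) := E.symm.toLinearMap ∘ₗ LinearMap.inr K _ _
  have hinr : Function.Injective inr := E.symm.injective.comp LinearMap.inr_injective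
  let N' := N.map inr
  let pr : (ι ⊕ κ → K) →ₗ[K] (ι → K) := LinearMap.fst K _ _ ∘ₗ E.toLinearMap
  have hform : ∀ y ∈ N, ∀ x, diagForm (Sum.elim a b) (inr y) x = diagForm b y (x ∘ Sum.inr) := by
    intro y _ x
    rw [diagForm_sumElim]
    have h1 : inr y ∘ Sum.inl = 0 := rfl
    have h2 : inr y ∘ Sum.inr = y := rfl
    rw [h1, h2]
    simp
  have hN'o : ∀ x, x ∈ (diagForm (Sum.elim a b)).orthogonal N' ↔ x ∘ Sum.inr ∈ N := by
    intro x
    rw [← hNo]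
    constructor
    · intro hx y hy
      have := hx (inr y) ⟨y, hy, rfl⟩
      change diagForm _ _ _ = 0 at this
      rw [hform y hy] at this
      exact this
    · rintro hx _ ⟨y, hy, rfl⟩
      change diagForm _ _ _ = 0
      rw [hform y hy]
      exact hx y (hNo ▸ hy)
  let P := W ⊓ (diagForm (Sum.elim a b)).orthogonal N'
  have hP : P = (diagForm (Sum.elim a b)).orthogonal (W ⊔ N') := by
    ext x
    constructor
    · rintro ⟨hx, hx'⟩ y hy
      obtain ⟨w, hw, n, hn, rfl⟩ := Submodule.mem_sup.mp hy
      change diagForm _ _ _ = 0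
      rw [map_add, LinearMap.add_apply, hW w hw x hx, zero_add]
      exact hx' n hn
    · intro hx
      refine ⟨?_, fun y hy => hx y (Submodule.mem_sup_right hy)⟩
      rw [SetLike.mem_coe, ← hWo]
      exact fun y hy => hx y (Submodule.mem_sup_left hy)
  refine ⟨P.map pr, ?_, ?_⟩
  · rintro _ ⟨x, hx, rfl⟩ _ ⟨y, hy, rfl⟩
    have h1 := hW x hx.1 y hy.1
    rw [diagForm_sumElim] at h1
    have h2 := hN _ ((hN'o x).mp hx.2) _ ((hN'o y).mp hy.2)
    rw [h2, add_zero] at h1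
    exact h1
  · have hker : Module.finrank K (LinearMap.ker (pr.domRestrict P)) ≤
        Module.finrank K (W ⊓ N' : Submodule K _) := by
      let ψ : LinearMap.ker (pr.domRestrict P) →ₗ[K] (W ⊓ N' : Submodule K _) :=
        (P.subtype ∘ₗ (LinearMap.ker (pr.domRestrict P)).subtype).codRestrict _ fun x => by
          have hx0 : (x.1.1 ∘ Sum.inl : ι → K) = 0 := x.2
          refine ⟨x.1.2.1, _, (hN'o _).mp x.1.2.2, ?_⟩
          funext i
          rcases i with i | i
          · exact (congrFun hx0 i).symm
          · rfl
      refine LinearMap.finrank_le_finrank_of_injective (f := ψ) fun x y hxy => ?_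
      have h : (ψ x).1 = (ψ y).1 := by rw [hxy]
      exact Subtype.ext (Subtype.ext h)
    have hrn := LinearMap.finrank_range_add_finrank_ker (pr.domRestrict P)
    rw [LinearMap.range_domRestrict] at hrn
    have hPd : Module.finrank K P =
        Fintype.card ι + Fintype.card κ - Module.finrank K (W ⊔ N' : Submodule K _) := by
      rw [hP, LinearMap.BilinForm.finrank_orthogonal (diagForm_nondegenerate _)]
      simp
    have hsi := Submodule.finrank_sup_add_finrank_inf_eq W N'
    have hN'd : Module.finrank K N' = Module.finrank K N :=
      (Submodule.equivMapOfInjective inr hinr N).finrank_eq.symm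
    rw [Fintype.card_sum] at hc
    have e1 : Module.finrank K W = Fintype.card ι + Fintype.card κ - Module.finrank K W := by
      conv_lhs => rw [← hWo]
      rw [LinearMap.BilinForm.finrank_orthogonal (diagForm_nondegenerate _)]
      simp
    have e2 : Module.finrank K N = Fintype.card κ - Module.finrank K N := by
      conv_lhs => rw [← hNo]
      rw [LinearMap.BilinForm.finrank_orthogonal (diagForm_nondegenerate _)]
      simp
    omega

end DiagonalForms

section WittGroup

variable (K : Type*) [Field K]

/-- Two diagonal forms are Witt equivalent if their difference is metabolic. -/
def wittSetoid : Setoid (Σ n : ℕ, Fin n → Kˣ) where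
  r s t := Metabolic (Sum.elim s.2 fun j => -t.2 j)
  iseqv :=
    { refl := fun s => metabolic_of_isometry LinearMap.id (fun _ _ => rfl) rfl
      symm := fun {s t} h => by
        convert! h.neg.comp_equiv (Equiv.sumComm _ _) using 1
        funext i
        rcases i with i | i <;> simp
      trans := fun {s t u} h h' => by
        refine Metabolic.cancel (b := Sum.elim (fun j => -t.2 j) t.2) ?_ ?_
        · convert! (h.sumElim (h'.comp_equiv (Equiv.sumComm _ _))).comp_equiv
            (Equiv.sumSumSumComm _ _ _ _) using 1
          funext i
          rcases i with (i | i) | (i | i) <;> simp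
        · convert! (metabolic_of_isometry (a := t.2) (b := t.2) LinearMap.id
            (fun _ _ => rfl) rfl).comp_equiv (Equiv.sumComm _ _) using 1
          funext i
          rcases i with i | i <;> simp }

/-- The Witt group of nondegenerate diagonal forms over `K`. -/
def WittGroup : Type _ := Quotient (wittSetoid K)

variable {K} {ι κ μ : Type*} [Fintype ι] [Fintype κ] [Fintype μ]

namespace WittGroup

/-- The Witt class of a diagonal form. -/
noncomputable def cls (a : ι → Kˣ) : WittGroup K :=
  Quotient.mk (wittSetoid K) ⟨Fintype.card ι, a ∘ (Fintype.equivFin ι).symm⟩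

lemma cls_eq_cls_iff {a : ι → Kˣ} {b : κ → Kˣ} :
    cls a = cls b ↔ Metabolic (Sum.elim a fun j => -b j) := by
  refine Quotient.eq.trans ⟨fun h => ?_, fun h => ?_⟩
  · convert! Metabolic.comp_equiv h
      (Equiv.sumCongr (Fintype.equivFin ι) (Fintype.equivFin κ)) using 1
    funext i
    rcases i with i | i <;> simp
  · change Metabolic _
    convert! Metabolic.comp_equiv h
      (Equiv.sumCongr (Fintype.equivFin ι).symm (Fintype.equivFin κ).symm) using 1
    funext i
    rcases i with i | i <;> simp

lemma cls_comp_equiv (a : ι → Kˣ) (e : κ ≃ ι) : cls (a ∘ e) = cls a := by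
  rw [eq_comm, cls_eq_cls_iff]
  refine metabolic_of_isometry (LinearEquiv.funCongrLeft K K e.symm).toLinearMap (fun x y => ?_)
    (Fintype.card_congr e.symm)
  simp only [diagForm_apply]
  refine (Fintype.sum_equiv e _ _ fun i => ?_).symm
  simp [LinearEquiv.funCongrLeft_apply, LinearMap.funLeft_apply]

lemma exists_eq_cls (x : WittGroup K) : ∃ (n : ℕ) (a : Fin n → Kˣ), x = cls a := by
  induction x using Quotient.inductionOn with
  | h s =>
    refine ⟨s.1, s.2, Quotient.sound ?_⟩
    convert! (cls_eq_cls_iff (a := s.2) (b := s.2 ∘ (Fintype.equivFin (Fin s.1)).symm)).mp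
      (cls_comp_equiv _ _).symm using 1

noncomputable instance : Zero (WittGroup K) := ⟨cls (Fin.elim0 : Fin 0 → Kˣ)⟩

noncomputable instance : Neg (WittGroup K) :=
  ⟨Quotient.lift (fun s => cls fun i => -s.2 i) fun s t h => by
    rw [cls_eq_cls_iff]
    convert! Metabolic.neg h using 1
    funext i
    rcases i with i | i <;> simp⟩

noncomputable instance : Add (WittGroup K) :=
  ⟨Quotient.lift₂ (fun s t => cls (Sum.elim s.2 t.2)) fun s t s' t' h h' => by
    rw [cls_eq_cls_iff]
    convert! (Metabolic.sumElim h h').comp_equiv (Equiv.sumSumSumComm _ _ _ _) using 1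
    funext i
    rcases i with (i | i) | (i | i) <;> simp⟩

lemma neg_cls (a : ι → Kˣ) : -cls a = cls fun i => -a i :=
  cls_comp_equiv (fun i => -a i) (Fintype.equivFin ι).symm

lemma cls_add_cls (a : ι → Kˣ) (b : κ → Kˣ) : cls a + cls b = cls (Sum.elim a b) := by
  rw [← cls_comp_equiv (Sum.elim a b)
    (Equiv.sumCongr (Fintype.equivFin ι).symm (Fintype.equivFin κ).symm)]
  refine congrArg cls ?_
  funext i
  rcases i with i | i <;> simp

lemma cls_of_isEmpty [IsEmpty ι] (a : ι → Kˣ) : cls a = 0 := by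
  rw [← cls_comp_equiv a (Equiv.equivOfIsEmpty (Fin 0) ι)]
  exact congrArg cls (Subsingleton.elim _ _)

lemma cls_eq_zero_iff {a : ι → Kˣ} : cls a = 0 ↔ Metabolic a := by
  rw [← cls_of_isEmpty (Empty.elim : Empty → Kˣ), cls_eq_cls_iff]
  refine ⟨fun h => ?_, fun h => ?_⟩
  · convert! h.comp_equiv (Equiv.sumEmpty ι Empty).symm using 1
  · convert! h.comp_equiv (Equiv.sumEmpty ι Empty) using 1
    funext i
    rcases i with i | i
    · simp
    · exact i.elim

private lemma add_comm' (x y : WittGroup K) : x + y = y + x := by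
  obtain ⟨n, a, rfl⟩ := exists_eq_cls x
  obtain ⟨m, b, rfl⟩ := exists_eq_cls y
  rw [cls_add_cls, cls_add_cls, ← cls_comp_equiv _ (Equiv.sumComm _ _)]
  refine congrArg cls ?_
  funext i
  rcases i with i | i <;> simp

private lemma zero_add' (x : WittGroup K) : 0 + x = x := by
  obtain ⟨n, a, rfl⟩ := exists_eq_cls x
  change cls (Fin.elim0 : Fin 0 → Kˣ) + cls a = cls a
  rw [cls_add_cls, ← cls_comp_equiv a (Equiv.emptySum (Fin 0) (Fin n))]
  refine congrArg cls ?_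
  funext i
  rcases i with i | i
  · exact i.elim0
  · simp

noncomputable instance : AddCommGroup (WittGroup K) where
  add_assoc x y z := by
    obtain ⟨n, a, rfl⟩ := exists_eq_cls x
    obtain ⟨m, b, rfl⟩ := exists_eq_cls y
    obtain ⟨k, c, rfl⟩ := exists_eq_cls z
    rw [cls_add_cls, cls_add_cls, cls_add_cls, cls_add_cls,
      ← cls_comp_equiv _ (Equiv.sumAssoc _ _ _)]
    refine congrArg cls ?_
    funext i
    rcases i with (i | i) | i <;> simp
  zero_add := zero_add'
  add_zero x := by rw [add_comm', zero_add']
  add_comm := add_comm'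
  nsmul := nsmulRec
  zsmul := zsmulRec
  neg_add_cancel x := by
    obtain ⟨n, a, rfl⟩ := exists_eq_cls x
    rw [neg_cls, add_comm', cls_add_cls, cls_eq_zero_iff]
    exact metabolic_of_isometry LinearMap.id (fun _ _ => rfl) rfl

/-- The class of the one-dimensional form `⟨u⟩`. -/
noncomputable def unary (u : Kˣ) : WittGroup K := cls fun _ : Unit => u

lemma cls_eq_sum_fin {n : ℕ} (a : Fin n → Kˣ) : cls a = ∑ i, unary (a i) := by
  induction n with
  | zero => simp [cls_of_isEmpty]
  | succ n ih =>
    rw [Fin.sum_univ_succ, ← ih, unary, cls_add_cls,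
      ← cls_comp_equiv _ ((Equiv.sumComm _ _).trans
        ((Equiv.optionEquivSumPUnit (Fin n)).symm.trans (finSuccEquiv n).symm))]
    refine congrArg cls ?_
    funext i
    rcases i with i | i <;> simp

lemma cls_eq_sum (a : ι → Kˣ) : cls a = ∑ i, unary (a i) := by
  rw [← cls_comp_equiv a (Fintype.equivFin ι).symm, cls_eq_sum_fin]
  exact Fintype.sum_equiv _ _ _ fun i => rfl

lemma sum_unary_eq_zero_iff (a : ι → Kˣ) : ∑ i, unary (a i) = 0 ↔ Metabolic a := by
  rw [← cls_eq_sum, cls_eq_zero_iff]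

lemma sum_unary_eq_of_isometry {a : ι → Kˣ} {b : κ → Kˣ} (T : (κ → K) →ₗ[K] (ι → K))
    (hT : ∀ x y, diagForm a (T x) (T y) = diagForm b x y)
    (hcard : Fintype.card ι = Fintype.card κ) : ∑ i, unary (a i) = ∑ j, unary (b j) := by
  rw [← cls_eq_sum, ← cls_eq_sum, cls_eq_cls_iff]
  exact metabolic_of_isometry T hT hcard

lemma unary_neg (u : Kˣ) : unary (-u) = -unary u := (neg_cls _).symm

lemma unary_mul_sq (u v : Kˣ) : unary (u * v ^ 2) = unary u := by
  have := sum_unary_eq_of_isometry (a := fun _ : Unit => u) (b := fun _ : Unit => u * v ^ 2)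
    ((v : K) • LinearMap.id) (fun x y => by simp [diagForm_apply]; ring) rfl
  simpa using this.symm

lemma unary_add_unary (u v w : Kˣ) (h : (u : K) + v = w) :
    unary u + unary v = unary w + unary (u * v * w) := by
  have := sum_unary_eq_of_isometry (a := ![u, v]) (b := ![w, u * v * w])
    (Matrix.toLin' !![1, (v : K); 1, -u]) (fun x y => by
      simp [diagForm_apply, Fin.sum_univ_two, dotProduct, ← h]; ring) rfl
  simpa using this

end WittGroup

end WittGroup

section WittMaps

/-- A map on `Kˣ` satisfying the defining relations of the Witt group. -/
structure IsWittMap {K : Type*} [Field K] {A : Type*} [AddCommGroup A] (f : Kˣ → A) : Prop where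
  map_mul_sq : ∀ u v : Kˣ, f (u * v ^ 2) = f u
  map_neg : ∀ u : Kˣ, f (-u) = -f u
  map_add : ∀ u v w : Kˣ, (u : K) + v = w → f u + f v = f w + f (u * v * w)

variable {K : Type*} [Field K] {A : Type*} [AddCommGroup A]

lemma WittGroup.isWittMap_unary : IsWittMap (WittGroup.unary : Kˣ → WittGroup K) :=
  ⟨unary_mul_sq, unary_neg, unary_add_unary⟩

lemma IsWittMap.prodMk {B : Type*} [AddCommGroup B] {f : Kˣ → A} {g : Kˣ → B}
    (hf : IsWittMap f) (hg : IsWittMap g) : IsWittMap fun u => (f u, g u) where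
  map_mul_sq u v := by rw [hf.map_mul_sq, hg.map_mul_sq]
  map_neg u := by rw [hf.map_neg, hg.map_neg]; rfl
  map_add u v w h := by
    rw [Prod.mk_add_mk, Prod.mk_add_mk, hf.map_add u v w h, hg.map_add u v w h]

/-- A value represented by a diagonal form can be split off as far as Witt maps are concerned; if
the value is zero, a hyperbolic plane can be dropped. -/
lemma IsWittMap.exists_split {f : Kˣ → A} (hf : IsWittMap f) {n : ℕ} (a : Fin n → Kˣ)
    (x : Fin n → K) :
    (∀ c : Kˣ, ∑ i, (a i : K) * x i ^ 2 = c →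
      ∃ (m : ℕ) (b : Fin m → Kˣ), m + 1 = n ∧ ∑ i, f (a i) = f c + ∑ i, f (b i)) ∧
    (∑ i, (a i : K) * x i ^ 2 = 0 → x ≠ 0 →
      ∃ (m : ℕ) (b : Fin m → Kˣ), m + 2 = n ∧ ∑ i, f (a i) = ∑ i, f (b i)) := by
  induction n with
  | zero =>
    refine ⟨fun c hc => ?_, fun _ hx => (hx (Subsingleton.elim _ _)).elim⟩
    simp only [Finset.univ_eq_empty, Finset.sum_empty] at hc
    exact (c.ne_zero hc.symm).elim
  | succ n ih =>
    obtain ⟨ih1, ih2⟩ := ih (fun i => a i.succ) (fun i => x i.succ)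
    have hsum := Fin.sum_univ_succ fun i => (a i : K) * x i ^ 2
    have hfsum := Fin.sum_univ_succ fun i => f (a i)
    by_cases hx0 : x 0 = 0
    · rw [hx0, zero_pow two_ne_zero, mul_zero, zero_add] at hsum
      rw [hsum, hfsum]
      refine ⟨fun c hc => ?_, fun hc hx => ?_⟩
      · obtain ⟨m, b, hm, hb⟩ := ih1 c hc
        refine ⟨m + 1, Fin.cons (a 0) b, by omega, ?_⟩
        rw [hb, Fin.sum_univ_succ]
        simp only [Fin.cons_zero, Fin.cons_succ]
        abel
      · obtain ⟨m, b, hm, hb⟩ := ih2 hc fun h => hx (by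
          funext i
          refine Fin.cases hx0 (fun i => congrFun h i) i)
        refine ⟨m + 1, Fin.cons (a 0) b, by omega, ?_⟩
        rw [hb, Fin.sum_univ_succ]
        simp only [Fin.cons_zero, Fin.cons_succ]
    · rw [hsum, hfsum]
      have hfa : f (a 0) = f (a 0 * (Units.mk0 _ hx0) ^ 2) := (hf.map_mul_sq _ _).symm
      have hval : (a 0 : K) * x 0 ^ 2 = (a 0 * (Units.mk0 _ hx0) ^ 2 : Kˣ) := by simp
      rw [hval, hfa]
      generalize a 0 * (Units.mk0 _ hx0) ^ 2 = t
      by_cases hc' : ∑ i : Fin n, (a i.succ : K) * x i.succ ^ 2 = 0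
      · rw [hc', add_zero]
        refine ⟨fun c hc => ?_, fun hc => (t.ne_zero hc).elim⟩
        exact ⟨n, _, rfl, by rw [Units.ext hc]⟩
      · obtain ⟨m, b, hm, hb⟩ := ih1 (Units.mk0 _ hc') rfl
        have hs : (Units.mk0 _ hc' : K) = ∑ i : Fin n, (a i.succ : K) * x i.succ ^ 2 := rfl
        rw [← hs, hb]
        generalize Units.mk0 _ hc' = s
        refine ⟨fun c hc => ?_, fun hc _ => ?_⟩
        · refine ⟨m + 1, Fin.cons (t * s * c) b, by omega, ?_⟩
          rw [Fin.sum_univ_succ]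
          simp only [Fin.cons_zero, Fin.cons_succ]
          rw [← add_assoc, hf.map_add t s c hc, add_assoc]
        · refine ⟨m, b, by omega, ?_⟩
          have : t = -s := Units.ext (by simpa using eq_neg_of_add_eq_zero_left hc)
          rw [this, hf.map_neg]
          abel

open WittGroup in
/-- Witt maps vanish on metabolic forms. -/
lemma IsWittMap.sum_eq_zero {f : Kˣ → A} (hf : IsWittMap f) {ι : Type*} [Fintype ι] {a : ι → Kˣ}
    (ha : Metabolic a) : ∑ i, f (a i) = 0 := by
  suffices h : ∀ (n : ℕ) (a : Fin n → Kˣ), Metabolic a → ∑ i, f (a i) = 0 by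
    rw [← h _ _ (ha.comp_equiv (Fintype.equivFin ι).symm)]
    exact (Fintype.sum_equiv _ _ _ fun i => rfl).symm
  intro n
  induction n using Nat.strong_induction_on with
  | _ n ih =>
    intro a ha
    obtain ⟨W, hW, hc⟩ := id ha
    rcases Nat.eq_zero_or_pos n with rfl | hn
    · simp
    · have hWbot : W ≠ ⊥ := by
        rintro rfl
        simp at hc
        omega
      obtain ⟨x, hx, hx0⟩ := Submodule.exists_mem_ne_zero_of_ne_bot hWbot
      have hxx : ∑ i, (a i : K) * x i ^ 2 = 0 := by
        rw [← hW x hx x hx, diagForm_apply]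
        exact Finset.sum_congr rfl fun i _ => by ring
      obtain ⟨m, b, hm, hb⟩ := ((isWittMap_unary.prodMk hf).exists_split a x).2 hxx hx0
      have h1 := congrArg Prod.fst hb
      have h2 := congrArg Prod.snd hb
      simp only [Prod.fst_sum, Prod.snd_sum] at h1 h2
      rw [h2]
      refine ih m (by omega) b ?_
      rw [← sum_unary_eq_zero_iff, ← h1, sum_unary_eq_zero_iff]
      exact ha

open WittGroup in
/-- The homomorphism out of the Witt group induced by a Witt map. -/
noncomputable def IsWittMap.lift {f : Kˣ → A} (hf : IsWittMap f) : WittGroup K →+ A :=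
  AddMonoidHom.mk' (Quotient.lift (fun s => ∑ i, f (s.2 i)) fun s t h => by
    have := hf.sum_eq_zero h
    simpa [hf.map_neg, add_neg_eq_zero] using this) fun x y => by
    induction x using Quotient.inductionOn with
    | h s =>
      induction y using Quotient.inductionOn with
      | h t =>
        change ∑ i, f ((Sum.elim s.2 t.2 ∘ (Fintype.equivFin _).symm) i) = _ + _
        rw [show ∑ i, f ((Sum.elim s.2 t.2 ∘ (Fintype.equivFin _).symm) i)
          = ∑ i, f (Sum.elim s.2 t.2 i) from Fintype.sum_equiv _ _ _ fun i => rfl]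
        simp

lemma IsWittMap.lift_unary {f : Kˣ → A} (hf : IsWittMap f) (u : Kˣ) :
    hf.lift (WittGroup.unary u) = f u := by
  exact (Fintype.sum_equiv (Fintype.equivFin Unit).symm _ (fun _ : Unit => f u)
    fun _ => rfl).trans (by simp)

end WittMaps

section Residue

variable {A : Type*} [AddCommGroup A]

lemma IsWittMap.comp_ringHom {K L : Type*} [Field K] [Field L] {f : Lˣ → A} (hf : IsWittMap f)
    (φ : K →+* L) : IsWittMap fun u : Kˣ => f (Units.map (φ : K →* L) u) where
  map_mul_sq u v := by rw [map_mul, map_pow, hf.map_mul_sq]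
  map_neg u := by
    rw [← hf.map_neg]
    exact congrArg f (Units.ext (by simp))
  map_add u v w h := by
    rw [map_mul, map_mul]
    exact hf.map_add _ _ _ (by simp [← h])

variable {p : ℕ} [Fact p.Prime]

lemma Padic.exists_eq_zpow_mul_unit (x : ℚ_[p]ˣ) :
    ∃ (k : ℤ) (u : ℤ_[p]ˣ), (x : ℚ_[p]) = (p : ℚ_[p]) ^ k * ((u : ℤ_[p]) : ℚ_[p]) := by
  have hp : (p : ℚ_[p]) ≠ 0 := by exact_mod_cast (Fact.out : p.Prime).ne_zero
  have hnorm : ‖(x : ℚ_[p]) * (p : ℚ_[p]) ^ (-(x : ℚ_[p]).valuation)‖ = 1 := by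
    rw [norm_mul, Padic.norm_p_zpow, Padic.norm_eq_zpow_neg_valuation x.ne_zero, ← zpow_add₀]
    · simp
    · exact_mod_cast (Fact.out : p.Prime).ne_zero
  refine ⟨(x : ℚ_[p]).valuation, PadicInt.mkUnits hnorm, ?_⟩
  rw [PadicInt.mkUnits_eq, mul_comm, mul_assoc, ← zpow_add₀ hp]
  simp

lemma Padic.valuation_zpow_mul_unit (k : ℤ) (u : ℤ_[p]ˣ) :
    ((p : ℚ_[p]) ^ k * ((u : ℤ_[p]) : ℚ_[p])).valuation = k := by
  have hp : (p : ℚ_[p]) ≠ 0 := by exact_mod_cast (Fact.out : p.Prime).ne_zero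
  have hu : ((u : ℤ_[p]) : ℚ_[p]) ≠ 0 := fun h => u.ne_zero (Subtype.ext h)
  rw [Padic.valuation_mul (zpow_ne_zero _ hp) hu, Padic.valuation_zpow, Padic.valuation_p]
  have : ((u : ℤ_[p]) : ℚ_[p]).valuation = 0 := by
    have h1 := PadicInt.norm_units u
    rw [PadicInt.norm_def, Padic.norm_eq_zpow_neg_valuation hu, zpow_eq_one_iff_right₀] at h1
    · omega
    · positivity
    · exact_mod_cast (Fact.out : p.Prime).one_lt.ne'
  omega

/-- The second residue at `p` of a nonzero `p`-adic number, with values transported along a map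
on the units of the residue field. -/
noncomputable def padicResidue (g : (ZMod p)ˣ → A) (x : ℚ_[p]ˣ) : A :=
  if Even (Padic.exists_eq_zpow_mul_unit x).choose then 0
  else g (Units.map (PadicInt.toZMod : ℤ_[p] →+* ZMod p)
    (Padic.exists_eq_zpow_mul_unit x).choose_spec.choose)

lemma padicResidue_eq (g : (ZMod p)ˣ → A) {x : ℚ_[p]ˣ} {k : ℤ} {u : ℤ_[p]ˣ}
    (h : (x : ℚ_[p]) = (p : ℚ_[p]) ^ k * ((u : ℤ_[p]) : ℚ_[p])) :
    padicResidue g x =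
      if Even k then 0 else g (Units.map (PadicInt.toZMod : ℤ_[p] →+* ZMod p) u) := by
  have hp : (p : ℚ_[p]) ≠ 0 := by exact_mod_cast (Fact.out : p.Prime).ne_zero
  have hspec := (Padic.exists_eq_zpow_mul_unit x).choose_spec.choose_spec
  unfold padicResidue
  generalize (Padic.exists_eq_zpow_mul_unit x).choose_spec.choose = v at *
  generalize (Padic.exists_eq_zpow_mul_unit x).choose = l at *
  have hkl : l = k := by
    rw [← Padic.valuation_zpow_mul_unit l v, ← hspec, h, Padic.valuation_zpow_mul_unit]
  subst hkl
  have huv : v = u := by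
    rw [hspec] at h
    exact Units.ext (Subtype.ext (mul_left_cancel₀ (zpow_ne_zero _ hp) h))
  rw [huv]

lemma IsWittMap.padicResidue {g : (ZMod p)ˣ → A} (hg : IsWittMap g) :
    IsWittMap (padicResidue g) := by
  have hp : (p : ℚ_[p]) ≠ 0 := by exact_mod_cast (Fact.out : p.Prime).ne_zero
  have hneg : ∀ u, _root_.padicResidue g (-u) = -_root_.padicResidue g u := by
    intro x
    obtain ⟨k, u, hu⟩ := Padic.exists_eq_zpow_mul_unit x
    rw [padicResidue_eq g hu, padicResidue_eq g (k := k) (u := -u) (by simp [hu])]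
    split_ifs
    · simp
    · rw [← hg.map_neg]
      exact congrArg g (Units.ext (by simp))
  have hsq : ∀ u v, _root_.padicResidue g (u * v ^ 2) = _root_.padicResidue g u := by
    intro x y
    obtain ⟨k, u, hu⟩ := Padic.exists_eq_zpow_mul_unit x
    obtain ⟨l, v, hv⟩ := Padic.exists_eq_zpow_mul_unit y
    rw [padicResidue_eq g hu, padicResidue_eq g (k := k + (l + l)) (u := u * v ^ 2) (by
      rw [Units.val_mul, Units.val_pow_eq_pow_val, Units.val_mul, Units.val_pow_eq_pow_val, hu, hv,
        zpow_add₀ hp, zpow_add₀ hp]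
      push_cast
      ring)]
    simp [Int.even_add, hg.map_mul_sq]
  refine ⟨hsq, hneg, ?_⟩
  suffices h : ∀ (k l : ℤ) (u v : ℤ_[p]ˣ) (x y z : ℚ_[p]ˣ), k ≤ l →
      (x : ℚ_[p]) = (p : ℚ_[p]) ^ k * ((u : ℤ_[p]) : ℚ_[p]) →
      (y : ℚ_[p]) = (p : ℚ_[p]) ^ l * ((v : ℤ_[p]) : ℚ_[p]) → (x : ℚ_[p]) + y = z →
      _root_.padicResidue g x + _root_.padicResidue g y =
        _root_.padicResidue g z + _root_.padicResidue g (x * y * z) by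
    intro x y z hz
    obtain ⟨k, u, hu⟩ := Padic.exists_eq_zpow_mul_unit x
    obtain ⟨l, v, hv⟩ := Padic.exists_eq_zpow_mul_unit y
    rcases le_total k l with hkl | hkl
    · exact h k l u v x y z hkl hu hv hz
    · rw [add_comm (_root_.padicResidue g x), mul_comm x y]
      exact h l k v u y x z hkl hv hu (by rw [← hz, add_comm])
  intro k l u v x y z hkl hx hy hz
  obtain ⟨j, w, hw⟩ := Padic.exists_eq_zpow_mul_unit z
  have hxyz : ((x * y * z : ℚ_[p]ˣ) : ℚ_[p]) =
      (p : ℚ_[p]) ^ (k + l + j) * ((u * v * w : ℤ_[p]ˣ) : ℤ_[p]) := by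
    simp [hx, hy, hw, zpow_add₀ hp]; ring
  rw [padicResidue_eq g hx, padicResidue_eq g hy, padicResidue_eq g hw, padicResidue_eq g hxyz]
  rw [map_mul, map_mul]
  obtain ⟨d, rfl⟩ := Int.le.dest hkl
  -- the unit part of the sum, before normalisation
  have hsum : (p : ℚ_[p]) ^ j * ((w : ℤ_[p]) : ℚ_[p]) =
      (p : ℚ_[p]) ^ k * (((u : ℤ_[p]) + (p : ℤ_[p]) ^ d * (v : ℤ_[p]) : ℤ_[p]) : ℚ_[p]) := by
    rw [← hw, ← hz, hx, hy, zpow_add₀ hp]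
    push_cast
    rw [zpow_natCast]
    ring
  have hunit : ∀ s : ℤ_[p]ˣ, (s : ℤ_[p]) = (u : ℤ_[p]) + (p : ℤ_[p]) ^ d * (v : ℤ_[p]) →
      j = k ∧ w = s := by
    intro s hs
    rw [← hs] at hsum
    have hjk : j = k := by
      rw [← Padic.valuation_zpow_mul_unit j w, hsum, Padic.valuation_zpow_mul_unit]
    subst hjk
    exact ⟨rfl, Units.ext (Subtype.ext (mul_left_cancel₀ (zpow_ne_zero _ hp) hsum))⟩
  have hisunit : ∀ t : ℤ_[p], PadicInt.toZMod t ≠ 0 → IsUnit t := by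
    intro t ht
    by_contra hnu
    apply ht
    rw [← RingHom.mem_ker, PadicInt.ker_toZMod]
    exact (IsLocalRing.mem_maximalIdeal t).mpr hnu
  have hpz : (PadicInt.toZMod (p : ℤ_[p]) : ZMod p) = 0 := by simp
  set U := Units.map ((PadicInt.toZMod : ℤ_[p] →+* ZMod p) : ℤ_[p] →* ZMod p) u with hU
  set V := Units.map ((PadicInt.toZMod : ℤ_[p] →+* ZMod p) : ℤ_[p] →* ZMod p) v with hV
  set W := Units.map ((PadicInt.toZMod : ℤ_[p] →+* ZMod p) : ℤ_[p] →* ZMod p) w with hW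
  have hUv : (U : ZMod p) = PadicInt.toZMod (u : ℤ_[p]) := rfl
  have hVv : (V : ZMod p) = PadicInt.toZMod (v : ℤ_[p]) := rfl
  have hWv : (W : ZMod p) = PadicInt.toZMod (w : ℤ_[p]) := rfl
  rcases Nat.eq_zero_or_pos d with rfl | hd
  · by_cases huv : (U : ZMod p) + V = 0
    · have hUV : V = -U := Units.ext (by rw [Units.val_neg, eq_neg_iff_add_eq_zero, add_comm, huv])
      rw [hUV, show U * -U * W = -W * U ^ 2 by
        rw [mul_neg, neg_mul, neg_mul, sq, mul_comm], hg.map_mul_sq, hg.map_neg, hg.map_neg]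
      have e : Even (k + (k + (0 : ℕ)) + j) ↔ Even j := by
        simp [Int.even_add]
      simp only [Nat.cast_zero, add_zero] at e ⊢
      simp only [e]
      split_ifs <;> simp
    · obtain ⟨s, hs⟩ := hisunit ((u : ℤ_[p]) + (p : ℤ_[p]) ^ 0 * (v : ℤ_[p])) (by
        simpa [hUv, hVv] using huv)
      obtain ⟨rfl, rfl⟩ := hunit s hs
      have e : Even (j + (j + (0 : ℕ)) + j) ↔ Even j := by
        simp [Int.even_add]
      simp only [Nat.cast_zero, add_zero] at e ⊢
      simp only [e]
      split_ifs
      · simp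
      · exact hg.map_add U V W (by rw [hWv, hs, pow_zero, one_mul, _root_.map_add, hUv, hVv])
  · have hres : PadicInt.toZMod ((u : ℤ_[p]) + (p : ℤ_[p]) ^ d * (v : ℤ_[p])) = (U : ZMod p) := by
      rw [_root_.map_add, map_mul, map_pow, hpz, zero_pow hd.ne', zero_mul, add_zero, hUv]
    obtain ⟨s, hs⟩ := hisunit ((u : ℤ_[p]) + (p : ℤ_[p]) ^ d * (v : ℤ_[p])) (by
      rw [hres]; exact U.ne_zero)
    obtain ⟨rfl, rfl⟩ := hunit s hs
    have hWU : W = U := Units.ext (by rw [hWv, hs, hres])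
    rw [hWU, show U * V * U = V * U ^ 2 by rw [sq, mul_comm U V, mul_assoc], hg.map_mul_sq]
    have e : Even (j + (j + (d : ℤ)) + j) ↔ Even (j + (d : ℤ)) := by
      rw [show j + (j + (d : ℤ)) + j = (j + d) + 2 * j by ring]
      simp [Int.even_add]
    simp only [e]

end Residue

section PrimeFiltration

/-- All prime factors of the nonzero integer `N` are smaller than `b`. -/
def SmoothInt (b : ℕ) (N : ℤ) : Prop := N ≠ 0 ∧ ∀ q : ℕ, q.Prime → (q : ℤ) ∣ N → q < b

lemma SmoothInt.mul {b : ℕ} {M N : ℤ} (hM : SmoothInt b M) (hN : SmoothInt b N) :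
    SmoothInt b (M * N) :=
  ⟨mul_ne_zero hM.1 hN.1, fun q hq h =>
    ((Nat.prime_iff_prime_int.mp hq).dvd_or_dvd h).elim (hM.2 q hq) (hN.2 q hq)⟩

lemma SmoothInt.of_dvd {b : ℕ} {M N : ℤ} (hN : SmoothInt b N) (h : M ∣ N) : SmoothInt b M :=
  ⟨fun h0 => hN.1 (by rw [h0, zero_dvd_iff] at h; exact h),
    fun q hq hqM => hN.2 q hq (hqM.trans h)⟩

lemma SmoothInt.neg {b : ℕ} {N : ℤ} (hN : SmoothInt b N) : SmoothInt b (-N) :=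
  hN.of_dvd (by simp)

lemma smoothInt_of_natAbs_lt {b : ℕ} {N : ℤ} (h0 : N ≠ 0) (h : N.natAbs < b) : SmoothInt b N :=
  ⟨h0, fun _ _ hqN => lt_of_le_of_lt
    (Nat.le_of_dvd (Int.natAbs_pos.mpr h0) (Int.natCast_dvd.mp hqN)) h⟩

lemma SmoothInt.not_dvd {p : ℕ} [hp : Fact p.Prime] {N : ℤ} (h : SmoothInt p N) :
    ¬ (p : ℤ) ∣ N :=
  fun hd => lt_irrefl _ (h.2 p hp.out hd)

namespace WittGroup

/-- The class of the rank one form `N x²` over `ℚ`; zero for `N = 0`. -/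
noncomputable def intUnary (N : ℤ) : WittGroup ℚ :=
  if h : (N : ℚ) = 0 then 0 else unary (Units.mk0 (N : ℚ) h)

lemma intUnary_zero : intUnary 0 = 0 := by simp [intUnary]

lemma intUnary_eq {N : ℤ} {u : ℚˣ} (h : (u : ℚ) = N) : intUnary N = unary u := by
  have hN : (N : ℚ) ≠ 0 := h ▸ u.ne_zero
  rw [intUnary, dif_neg hN]
  exact congrArg _ (Units.ext h.symm)

lemma intUnary_mul_sq (N : ℤ) {M : ℤ} (hM : M ≠ 0) : intUnary (N * M ^ 2) = intUnary N := by
  have hM' : (M : ℚ) ≠ 0 := by exact_mod_cast hM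
  by_cases hN : (N : ℚ) = 0
  · have : N = 0 := by exact_mod_cast hN
    simp [this]
  · rw [intUnary_eq (N := N) (u := Units.mk0 _ hN) rfl, ← unary_mul_sq _ (Units.mk0 _ hM'),
      intUnary_eq]
    simp

lemma intUnary_neg (N : ℤ) : intUnary (-N) = -intUnary N := by
  by_cases hN : (N : ℚ) = 0
  · have : N = 0 := by exact_mod_cast hN
    simp [this, intUnary_zero]
  · rw [intUnary_eq (N := N) (u := Units.mk0 _ hN) rfl, ← unary_neg, intUnary_eq]
    simp

lemma intUnary_add (N M : ℤ) :
    intUnary N + intUnary M = intUnary (N + M) + intUnary (N * M * (N + M)) := by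
  by_cases hN : N = 0
  · simp [hN, intUnary_zero]
  by_cases hM : M = 0
  · simp [hM, intUnary_zero]
  by_cases hS : N + M = 0
  · rw [eq_neg_of_add_eq_zero_left hS, intUnary_neg]
    simp [intUnary_zero]
  have hN' : (N : ℚ) ≠ 0 := by exact_mod_cast hN
  have hM' : (M : ℚ) ≠ 0 := by exact_mod_cast hM
  have hS' : (N : ℚ) + M ≠ 0 := by exact_mod_cast hS
  rw [intUnary_eq (u := Units.mk0 _ hN') rfl, intUnary_eq (u := Units.mk0 _ hM') rfl,
    intUnary_eq (u := Units.mk0 _ hS') (by simp), unary_add_unary _ _ (Units.mk0 _ hS') rfl]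
  congr 1
  exact (intUnary_eq (by simp)).symm

/-- Every nonzero rational is an integer up to squares. -/
lemma exists_unary_eq_intUnary (u : ℚˣ) : ∃ N : ℤ, N ≠ 0 ∧ unary u = intUnary N := by
  have hd : ((u : ℚ).den : ℚ) ≠ 0 := by exact_mod_cast (u : ℚ).den_nz
  have hn : (u : ℚ).num ≠ 0 := by simp
  refine ⟨(u : ℚ).num * (u : ℚ).den, mul_ne_zero hn (by simp), ?_⟩
  rw [← unary_mul_sq u (Units.mk0 _ hd)]
  symm
  apply intUnary_eq
  simp only [Units.val_mul, Units.val_pow_eq_pow_val, Units.val_mk0]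
  push_cast
  nth_rewrite 1 [← Rat.num_div_den (u : ℚ)]
  field_simp

/-- The subgroup generated by the forms `N x²` with all prime factors of `N` less than `b`. -/
noncomputable def primeFiltration (b : ℕ) : AddSubgroup (WittGroup ℚ) :=
  AddSubgroup.closure (intUnary '' {N | SmoothInt b N})

lemma intUnary_mem_primeFiltration {b : ℕ} {N : ℤ} (h : SmoothInt b N) :
    intUnary N ∈ primeFiltration b := AddSubgroup.subset_closure ⟨N, h, rfl⟩

lemma exists_mem_primeFiltration (x : WittGroup ℚ) : ∃ b, x ∈ primeFiltration b := by
  obtain ⟨n, a, rfl⟩ := exists_eq_cls x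
  rw [cls_eq_sum]
  choose N hN hu using fun i => exists_unary_eq_intUnary (a i)
  refine ⟨∑ i, (N i).natAbs + 1, sum_mem fun i _ => ?_⟩
  rw [hu]
  exact intUnary_mem_primeFiltration (smoothInt_of_natAbs_lt (hN i)
    (Nat.lt_succ_of_le (Finset.single_le_sum (f := fun i => (N i).natAbs)
      (fun _ _ => Nat.zero_le _) (Finset.mem_univ i))))

lemma primeFiltration_succ_of_not_prime {b : ℕ} (hb : ¬ b.Prime) :
    primeFiltration (b + 1) ≤ primeFiltration b := by
  refine AddSubgroup.closure_mono (Set.image_mono fun N hN => ⟨hN.1, fun q hq h => ?_⟩)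
  rcases (Nat.lt_succ_iff.mp (hN.2 q hq h)).lt_or_eq with h | rfl
  · exact h
  · exact (hb hq).elim

lemma primeFiltration_zero_le : primeFiltration 0 ≤ AddSubgroup.zmultiples (intUnary 1) := by
  rw [primeFiltration, AddSubgroup.closure_le]
  rintro _ ⟨N, hN, rfl⟩
  have h1 : N.natAbs = 1 := by
    by_contra h
    obtain ⟨q, hq, hqN⟩ := Nat.exists_prime_and_dvd h
    exact absurd (hN.2 q hq (Int.natCast_dvd.mpr hqN)) (by omega)
  rcases Int.natAbs_eq N with h | h <;> rw [h, h1]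
  · exact AddSubgroup.mem_zmultiples _
  · rw [intUnary_neg]
    exact neg_mem (AddSubgroup.mem_zmultiples _)

variable {p : ℕ} [hp : Fact p.Prime]

lemma intUnary_prime_mul_sub_mem {M m r l : ℤ} (hM : SmoothInt p M) (hm : SmoothInt p m)
    (hr : SmoothInt p r) (hl : l = 0 ∨ SmoothInt p l) (h : m = r + l * p) :
    intUnary (p * (M * m)) - intUnary (p * (M * r)) ∈ primeFiltration p := by
  rcases hl with rfl | hl
  · simp [h, zero_mem]
  · have hp0 : (p : ℤ) ≠ 0 := by exact_mod_cast hp.out.ne_zero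
    have key := intUnary_add (p * (M * r)) (M * l * p ^ 2)
    rw [show p * (M * r) + M * l * (p : ℤ) ^ 2 = p * (M * m) by rw [h]; ring,
      show p * (M * r) * (M * l * (p : ℤ) ^ 2) * (p * (M * m)) =
        (M * (r * (l * m))) * (M * p ^ 2) ^ 2 by ring, intUnary_mul_sq _ hp0,
      intUnary_mul_sq _ (mul_ne_zero hM.1 (pow_ne_zero 2 hp0))] at key
    have : intUnary (p * (M * m)) - intUnary (p * (M * r)) =
        intUnary (M * l) - intUnary (M * (r * (l * m))) := by
      rw [sub_eq_sub_iff_add_eq_add, ← key, add_comm]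
    rw [this]
    exact sub_mem (intUnary_mem_primeFiltration (hM.mul hl))
      (intUnary_mem_primeFiltration (hM.mul (hr.mul (hl.mul hm))))

lemma smoothInt_emod {N : ℤ} (h : ¬ (p : ℤ) ∣ N) : SmoothInt p (N % p) := by
  have hp0 : (0 : ℤ) < p := by exact_mod_cast hp.out.pos
  have h1 := Int.emod_nonneg N hp0.ne'
  have h2 := Int.emod_lt_of_pos N hp0
  exact smoothInt_of_natAbs_lt (fun h0 => h (Int.dvd_of_emod_eq_zero h0)) (by omega)

lemma intUnary_prime_mul_sub_emod_mem {M N : ℤ} (hM : SmoothInt p M) (hN : SmoothInt p N) :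
    intUnary (p * (M * N)) - intUnary (p * (M * (N % p))) ∈ primeFiltration p := by
  have hp0 : (0 : ℤ) < p := by exact_mod_cast hp.out.pos
  have hp2 : (2 : ℤ) ≤ p := by exact_mod_cast hp.out.two_le
  induction hk : N.natAbs using Nat.strong_induction_on generalizing M N with
  | _ k ih =>
    by_cases h1 : N.natAbs = 1
    · rcases Int.natAbs_eq N with h | h <;> rw [h1] at h
      · rw [h, Nat.cast_one, Int.emod_eq_of_lt (by omega) (by omega), sub_self]
        exact zero_mem _
      · have hmod : N % p = N + 1 * p := by
          rw [one_mul, ← Int.add_emod_right, Int.emod_eq_of_lt] <;> omega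
        rw [← neg_sub]
        exact neg_mem (intUnary_prime_mul_sub_mem hM (smoothInt_emod hN.not_dvd) hN
          (Or.inr (smoothInt_of_natAbs_lt one_ne_zero (by omega))) hmod)
    · obtain ⟨q, hq, hqN⟩ := Nat.exists_prime_and_dvd h1
      obtain ⟨N', rfl⟩ := Int.natCast_dvd.mpr hqN
      have hq' : SmoothInt p (q : ℤ) := hN.of_dvd (dvd_mul_right _ _)
      have hN' : SmoothInt p N' := hN.of_dvd (dvd_mul_left _ _)
      have hlt : N'.natAbs < k := by
        rw [← hk, Int.natAbs_mul, Int.natAbs_natCast]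
        exact lt_mul_of_one_lt_left (Int.natAbs_pos.mpr hN'.1) hq.one_lt
      have step1 := ih _ hlt (hM.mul hq') hN' rfl
      have hr := smoothInt_emod hN'.not_dvd
      have hqr := hq'.mul hr
      have hqp : (q : ℤ) < p := by exact_mod_cast hN.2 q hq (dvd_mul_right _ _)
      have hr0 := Int.emod_nonneg N' hp0.ne'
      have hr1 := Int.emod_lt_of_pos N' hp0
      have hl : (q : ℤ) * (N' % p) / p = 0 ∨ SmoothInt p ((q : ℤ) * (N' % p) / p) := by
        by_cases h0 : (q : ℤ) * (N' % p) / p = 0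
        · exact Or.inl h0
        · refine Or.inr (smoothInt_of_natAbs_lt h0 ?_)
          have h3 : 0 ≤ (q : ℤ) * (N' % p) / p := by positivity
          have h4 : (q : ℤ) * (N' % p) / p < p := by
            apply Int.ediv_lt_of_lt_mul hp0
            nlinarith
          omega
      have step2 := intUnary_prime_mul_sub_mem hM hqr (smoothInt_emod hqr.not_dvd) hl
        (by rw [mul_comm (_ / _)]; exact (Int.emod_add_mul_ediv _ _).symm)
      have hmod : (q * N') % p = (q * (N' % p)) % (p : ℤ) := by simp [Int.mul_emod]
      rw [hmod]
      have := add_mem step1 step2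
      rwa [mul_assoc, mul_assoc, sub_add_sub_cancel] at this

variable (p) in
/-- The class of `p u x²`, for `u` a unit modulo `p`. -/
noncomputable def residueUnary (u : (ZMod p)ˣ) : WittGroup ℚ ⧸ primeFiltration p :=
  QuotientAddGroup.mk (intUnary (p * ((u : ZMod p).val : ℤ)))

lemma residueUnary_eq {N : ℤ} (hN : SmoothInt p N) {u : (ZMod p)ˣ} (h : (u : ZMod p) = N) :
    residueUnary p u = QuotientAddGroup.mk (intUnary (p * N)) := by
  have h1 : SmoothInt p 1 := smoothInt_of_natAbs_lt one_ne_zero hp.out.one_lt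
  have := intUnary_prime_mul_sub_emod_mem h1 hN
  rw [one_mul, one_mul] at this
  rw [residueUnary, h, ZMod.val_intCast, eq_comm, ← sub_eq_zero, ← QuotientAddGroup.mk_sub]
  exact (QuotientAddGroup.eq_zero_iff _).mpr this

lemma smoothInt_val (u : (ZMod p)ˣ) : SmoothInt p ((u : ZMod p).val : ℤ) :=
  smoothInt_of_natAbs_lt (by exact_mod_cast (ZMod.val_ne_zero _).mpr u.ne_zero)
    (by rw [Int.natAbs_natCast]; exact ZMod.val_lt _)

lemma isWittMap_residueUnary : IsWittMap (residueUnary p) where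
  map_mul_sq u v := by
    rw [residueUnary_eq (N := (u : ZMod p).val * (v : ZMod p).val ^ 2) _ (by simp), ← mul_assoc,
      intUnary_mul_sq _ (smoothInt_val v).1, residueUnary]
    rw [sq]
    exact (smoothInt_val u).mul ((smoothInt_val v).mul (smoothInt_val v))
  map_neg u := by
    rw [residueUnary_eq (N := -(u : ZMod p).val) (smoothInt_val u).neg (by simp), mul_neg,
      intUnary_neg, residueUnary, QuotientAddGroup.mk_neg]
  map_add u v w h := by
    have hp0 : (p : ℤ) ≠ 0 := by exact_mod_cast hp.out.ne_zero
    suffices H : ∃ M : ℤ, SmoothInt p M ∧ (v : ZMod p) = M ∧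
        SmoothInt p ((u : ZMod p).val + M) by
      obtain ⟨M, hM, hvM, hS⟩ := H
      have hw : (w : ZMod p) = ((u : ZMod p).val + M : ℤ) := by simp [← h, hvM]
      rw [residueUnary_eq hM hvM, residueUnary_eq hS hw,
        residueUnary_eq (u := u * v * w) (((smoothInt_val u).mul hM).mul hS)
          (by simp [← h, hvM]), residueUnary, ← QuotientAddGroup.mk_add, ← QuotientAddGroup.mk_add,
          intUnary_add, ← mul_add]
      rw [show (p : ℤ) * ((u : ZMod p).val : ℤ) * (p * M) * (p * (((u : ZMod p).val : ℤ) + M)) =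
        (p * (((u : ZMod p).val : ℤ) * M * (((u : ZMod p).val : ℤ) + M))) * p ^ 2 by ring,
        intUnary_mul_sq _ hp0]
    have hu := ZMod.val_lt (u : ZMod p)
    have hv := ZMod.val_lt (v : ZMod p)
    have hu0 := (smoothInt_val u).1
    have hv0 := (smoothInt_val v).1
    rcases lt_trichotomy ((u : ZMod p).val + (v : ZMod p).val) p with hlt | heq | hgt
    · exact ⟨(v : ZMod p).val, smoothInt_val v, by simp,
        smoothInt_of_natAbs_lt (by omega) (by omega)⟩
    · refine (w.ne_zero ?_).elim
      rw [← h, ← ZMod.natCast_zmod_val (u : ZMod p), ← ZMod.natCast_zmod_val (v : ZMod p),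
        ← Nat.cast_add, heq, ZMod.natCast_self]
    · exact ⟨(v : ZMod p).val - p, smoothInt_of_natAbs_lt (by omega) (by omega), by simp,
        smoothInt_of_natAbs_lt (by omega) (by omega)⟩

variable (p) in
/-- The second residue homomorphism at `p`. -/
noncomputable def secondResidue : WittGroup ℚ →+ WittGroup ℚ ⧸ primeFiltration p :=
  ((isWittMap_residueUnary (p := p)).padicResidue.comp_ringHom (algebraMap ℚ ℚ_[p])).lift

lemma secondResidue_intUnary {N : ℤ} {k : ℕ} {u : (ZMod p)ˣ} (h : (u : ZMod p) = N) :
    secondResidue p (intUnary (p ^ k * N)) = if Even k then 0 else residueUnary p u := by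
  have hp0 : (p : ℚ) ≠ 0 := by exact_mod_cast hp.out.ne_zero
  have hpN : ¬ (p : ℤ) ∣ N := by
    rw [← ZMod.intCast_zmod_eq_zero_iff_dvd, ← h]
    exact u.ne_zero
  have hN : (N : ℚ) ≠ 0 := by
    intro h0
    exact hpN (by rw [Int.cast_eq_zero.mp h0]; exact dvd_zero _)
  have hunit : IsUnit (N : ℤ_[p]) := by
    rw [PadicInt.isUnit_iff]
    refine le_antisymm (PadicInt.norm_le_one _) (not_lt.mp ?_)
    rwa [PadicInt.norm_int_lt_one_iff_dvd]
  obtain ⟨s, hs⟩ := hunit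
  rw [intUnary_eq (u := Units.mk0 ((p : ℚ) ^ k * N) (mul_ne_zero (pow_ne_zero k hp0) hN))
    (by simp), secondResidue, IsWittMap.lift_unary, padicResidue_eq _ (k := k) (u := s)]
  · have : Units.map ((PadicInt.toZMod : ℤ_[p] →+* ZMod p) : ℤ_[p] →* ZMod p) s = u :=
      Units.ext (by
        change PadicInt.toZMod (s : ℤ_[p]) = _
        rw [hs, map_intCast, h])
    rw [this]
    simp only [Int.even_coe_nat]
  · rw [hs]
    simp

lemma secondResidue_intUnary_of_smooth {N : ℤ} (hN : SmoothInt (p + 1) N) :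
    secondResidue p (intUnary N) = QuotientAddGroup.mk (intUnary N) := by
  have hp0 : (p : ℤ) ≠ 0 := by exact_mod_cast hp.out.ne_zero
  have hfin : FiniteMultiplicity (p : ℤ) N :=
    Int.finiteMultiplicity_iff.mpr ⟨by simpa using hp.out.ne_one, hN.1⟩
  obtain ⟨M, hM, hpM⟩ := hfin.exists_eq_pow_mul_and_not_dvd
  generalize multiplicity (p : ℤ) N = k at hM
  subst hM
  have hMs : SmoothInt p M := by
    refine ⟨right_ne_zero_of_mul hN.1, fun q hq hqM => ?_⟩
    rcases (Nat.lt_succ_iff.mp (hN.2 q hq (hqM.mul_left _))).lt_or_eq with h | rfl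
    · exact h
    · exact (hpM hqM).elim
  have hu : (M : ZMod p) ≠ 0 := by rwa [Ne, ZMod.intCast_zmod_eq_zero_iff_dvd]
  rw [secondResidue_intUnary (u := Units.mk0 _ hu) rfl]
  split_ifs with hk
  · obtain ⟨l, rfl⟩ := hk
    rw [← two_mul, mul_comm 2 l, pow_mul, mul_comm, intUnary_mul_sq _ (pow_ne_zero l hp0)]
    exact ((QuotientAddGroup.eq_zero_iff _).mpr (intUnary_mem_primeFiltration hMs)).symm
  · obtain ⟨l, rfl⟩ := Nat.not_even_iff_odd.mp hk
    rw [residueUnary_eq hMs rfl, show (p : ℤ) ^ (2 * l + 1) * M = p * M * (p ^ l) ^ 2 by ring,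
      intUnary_mul_sq _ (pow_ne_zero l hp0)]

lemma secondResidue_eq_mk {x : WittGroup ℚ} (hx : x ∈ primeFiltration (p + 1)) :
    secondResidue p x = QuotientAddGroup.mk x := by
  induction hx using AddSubgroup.closure_induction with
  | mem x hx =>
    obtain ⟨N, hN, rfl⟩ := hx
    exact secondResidue_intUnary_of_smooth hN
  | zero => simp
  | add x y _ _ hx hy => rw [map_add, hx, hy, QuotientAddGroup.mk_add]
  | neg x _ hx => rw [map_neg, hx, QuotientAddGroup.mk_neg]

/-- A class over `ℚ` all of whose second residues vanish is a multiple of `⟨1⟩`. -/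
lemma mem_zmultiples_of_secondResidue_eq_zero {x : WittGroup ℚ}
    (h : ∀ (p : ℕ) [Fact p.Prime], secondResidue p x = 0) :
    x ∈ AddSubgroup.zmultiples (intUnary 1) := by
  obtain ⟨b, hb⟩ := exists_mem_primeFiltration x
  induction b with
  | zero => exact primeFiltration_zero_le hb
  | succ b ih =>
    by_cases hbp : b.Prime
    · have : Fact b.Prime := ⟨hbp⟩
      exact ih ((QuotientAddGroup.eq_zero_iff _).mp ((secondResidue_eq_mk hb).symm.trans (h b)))
    · exact ih (primeFiltration_succ_of_not_prime hbp hb)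

end WittGroup

end PrimeFiltration

section SelfDual

lemma sum_eq_sum_subtype {ι A : Type*} [Fintype ι] [AddCommMonoid A] {P : ι → Prop}
    [DecidablePred P] {F : ι → A} (h : ∀ i, ¬ P i → F i = 0) :
    ∑ i, F i = ∑ i : {i // P i}, F i := by
  rw [← Finset.sum_subtype (Finset.univ.filter P) (by simp) F]
  refine (Finset.sum_subset (Finset.filter_subset _ _) fun i _ hi => h i ?_).symm
  simpa using hi

variable {ι : Type*} [Fintype ι]

lemma dualSubmodule_dualSubmodule_of_isLattice (a : ι → ℚˣ) (Λ : Submodule ℤ (ι → ℚ))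
    [Submodule.IsLattice ℚ Λ] :
    (diagForm a).dualSubmodule ((diagForm a).dualSubmodule Λ) = Λ := by
  have := Submodule.IsLattice.free ℚ Λ
  let b := (Module.Free.chooseBasis ℤ Λ).extendOfIsLattice ℚ
  have hb : Submodule.span ℤ (Set.range b) = Λ := by
    have : Set.range b = Λ.subtype '' Set.range (Module.Free.chooseBasis ℤ Λ) := by
      rw [← Set.range_comp]
      congr 1
      funext i
      simp [b]
    rw [this, ← Submodule.map_span, Module.Basis.span_eq, Submodule.map_top,
      Submodule.range_subtype]
  rw [← hb, LinearMap.BilinForm.dualSubmodule_dualSubmodule_of_basis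
    (diagForm a) (diagForm_nondegenerate a) (diagForm_isSymm a) b]

lemma mem_one_iff_exists_intCast {x : ℚ} : x ∈ (1 : Submodule ℤ ℚ) ↔ ∃ n : ℤ, (n : ℚ) = x := by
  simp [Submodule.mem_one]

variable (ι) in
/-- The standard lattice of integer vectors. -/
def integerVectors : Submodule ℤ (ι → ℚ) where
  carrier := {x | ∃ c : ι → ℤ, ∀ i, x i = c i}
  add_mem' := by
    rintro x y ⟨c, hc⟩ ⟨d, hd⟩
    exact ⟨c + d, fun i => by simp [hc, hd]⟩
  zero_mem' := ⟨0, by simp⟩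
  smul_mem' := by
    rintro n x ⟨c, hc⟩
    exact ⟨n • c, fun i => by simp [hc]⟩

instance : Submodule.IsLattice ℚ (integerVectors ι) := by
  classical
  have h : integerVectors ι =
      Submodule.span ℤ (Set.range fun i : ι => (Pi.single i 1 : ι → ℚ)) := by
    apply le_antisymm
    · rintro x ⟨c, hc⟩
      have : x = ∑ i, c i • (Pi.single i 1 : ι → ℚ) := by
        funext j
        simp [hc, Finset.sum_apply, Pi.single_apply]
      rw [this]
      exact sum_mem fun i _ => Submodule.smul_mem _ _ (Submodule.subset_span ⟨i, rfl⟩)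
    · rw [Submodule.span_le]
      rintro _ ⟨i, rfl⟩
      exact ⟨Pi.single i 1, fun j => by by_cases h : j = i <;> simp [h]⟩
  refine ⟨h ▸ Submodule.fg_span (Set.finite_range _), ?_⟩
  rw [h, Submodule.span_span_of_tower]
  rw [← (Pi.basisFun ℚ ι).span_eq]
  congr 2

open WittGroup

variable {p : ℕ} [hp : Fact p.Prime]

lemma metabolic_residue {N n : ι → ℤ} {a : ι → ℚˣ}
    (ha : ∀ i, (a i : ℚ) = N i) (Λ : Submodule ℤ (ι → ℚ)) [Submodule.IsLattice ℚ Λ]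
    (hΛ : (diagForm a).dualSubmodule Λ = Λ) (hn : ∀ i, ¬ (p : ℤ) ∣ n i)
    (hT : ∀ i, (p : ℤ) ∣ N i → N i = p * n i) (hT' : ∀ i, ¬ (p : ℤ) ∣ N i → N i = n i)
    (t : {i // (p : ℤ) ∣ N i} → (ZMod p)ˣ) (ht : ∀ i, (t i : ZMod p) = n i) :
    Metabolic t := by
  classical
  have hp0 : (p : ℚ) ≠ 0 := by exact_mod_cast hp.out.ne_zero
  let U : Submodule (ZMod p) ({i // (p : ℤ) ∣ N i} → ZMod p) :=
    { carrier := {w | ∃ x ∈ Λ, ∃ c : ι → ℤ, (∀ i, N i * x i = c i) ∧ ∀ i, t i * w i = c i}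
      add_mem' := by
        rintro w w' ⟨x, hx, c, hc, hw⟩ ⟨x', hx', c', hc', hw'⟩
        exact ⟨x + x', add_mem hx hx', c + c', fun i => by simp [mul_add, hc, hc'],
          fun i => by simp [mul_add, hw, hw']⟩
      zero_mem' := ⟨0, zero_mem _, 0, by simp, by simp⟩
      smul_mem' := by
        rintro r w ⟨x, hx, c, hc, hw⟩
        refine ⟨(r.val : ℤ) • x, Λ.smul_mem _ hx, (r.val : ℤ) • c, fun i => ?_, fun i => ?_⟩
        · simp only [Pi.smul_apply, zsmul_eq_mul, smul_eq_mul]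
          push_cast
          rw [← hc]
          ring
        · simp only [Pi.smul_apply, smul_eq_mul]
          push_cast
          rw [← hw, ZMod.natCast_zmod_val]
          ring }
  have hiso : ∀ w ∈ U, ∀ w' ∈ U, diagForm t w w' = 0 := by
    rintro w ⟨x, hx, c, hc, hw⟩ w' ⟨x', hx', c', hc', hw'⟩
    rw [← hΛ] at hx
    obtain ⟨e, he⟩ := mem_one_iff_exists_intCast.mp (hx x' hx')
    let s : ι → ℤ := fun i => if (p : ℤ) ∣ N i then 1 else p
    have hs : ∀ i, N i * s i = p * n i := fun i => by
      by_cases h : (p : ℤ) ∣ N i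
      · simp only [s, if_pos h, mul_one, hT i h]
      · simp only [s, if_neg h, hT' i h, mul_comm]
    let E : ι → ℤ := fun i => ∏ j ∈ Finset.univ.erase i, n j
    have hE : ∀ i, n i * E i = ∏ j, n j := fun i => Finset.mul_prod_erase _ _ (Finset.mem_univ i)
    have hsum : ∑ i, E i * s i * c i * c' i = p * (∏ j, n j) * e := by
      have : ((∑ i, E i * s i * c i * c' i : ℤ) : ℚ) = (p * (∏ j, n j) * e : ℤ) := by
        push_cast
        rw [he, diagForm_apply, Finset.mul_sum]
        refine Finset.sum_congr rfl fun i _ => ?_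
        have h1 : (N i : ℚ) * s i = p * n i := by exact_mod_cast hs i
        have h2 : (n i : ℚ) * E i = ∏ j, (n j : ℚ) := by exact_mod_cast hE i
        rw [← hc, ← hc', ha, ← h2]
        linear_combination (E i * N i * x i * x' i : ℚ) * h1
      exact_mod_cast this
    have hD : ((∏ j, n j : ℤ) : ZMod p) ≠ 0 := by
      rw [Ne, ZMod.intCast_zmod_eq_zero_iff_dvd]
      intro h
      obtain ⟨j, -, hj⟩ := (Nat.prime_iff_prime_int.mp hp.out).exists_mem_finset_dvd h
      exact hn j hj
    have hmod := congrArg (Int.cast : ℤ → ZMod p) hsum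
    rw [Int.cast_sum, sum_eq_sum_subtype (P := fun i => (p : ℤ) ∣ N i)] at hmod
    · apply (mul_eq_zero.mp _).resolve_left hD
      rw [diagForm_apply, Finset.mul_sum]
      refine Eq.trans (Finset.sum_congr rfl fun i _ => ?_) (hmod.trans (by simp))
      have h2 : ((n i : ℤ) : ZMod p) * E i = (∏ j, n j : ℤ) := by exact_mod_cast congrArg _ (hE i)
      simp only [s, if_pos i.2]
      push_cast
      rw [← hw, ← hw', ← Int.cast_prod, ← h2, ← ht]
      ring
    · intro i hi
      simp [s, hi]
  refine ⟨U, hiso, ?_⟩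
  have hle : (diagForm t).orthogonal U ≤ U := by
    intro z hz
    let y : ι → ℚ := fun i => if h : (p : ℤ) ∣ N i then ((z ⟨i, h⟩).val : ℚ) / p else 0
    have hy : y ∈ Λ ⊔ integerVectors ι := by
      rw [← dualSubmodule_dualSubmodule_of_isLattice a (Λ ⊔ integerVectors ι)]
      intro x hx
      have hxΛ : x ∈ Λ := by
        rw [← hΛ]
        exact fun v hv => hx v (Submodule.mem_sup_left hv)
      have hxc : ∀ i, ∃ c : ℤ, (c : ℚ) = N i * x i := fun i => by
        have := hx (Pi.single i 1) (Submodule.mem_sup_right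
          ⟨Pi.single i 1, fun j => by by_cases h : j = i <;> simp [h]⟩)
        obtain ⟨c, hc⟩ := mem_one_iff_exists_intCast.mp this
        exact ⟨c, by rw [hc, diagForm_apply]; simp [Pi.single_apply, ha]⟩
      choose c hc using hxc
      let w : {i // (p : ℤ) ∣ N i} → ZMod p := fun i => (↑(t i)⁻¹ : ZMod p) * c i
      have hw : w ∈ U := ⟨x, hxΛ, c, fun i => (hc i).symm,
        fun i => Units.mul_inv_cancel_left _ _⟩
      have hwz := hz w hw
      rw [diagForm_apply] at hwz
      have hdvd : (p : ℤ) ∣ ∑ i : {i // (p : ℤ) ∣ N i}, c i * ((z i).val : ℤ) := by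
        rw [← ZMod.intCast_zmod_eq_zero_iff_dvd, ← hwz]
        push_cast
        refine Finset.sum_congr rfl fun i _ => ?_
        rw [Units.mul_inv_cancel_left, ZMod.natCast_zmod_val]
      obtain ⟨e, he⟩ := hdvd
      refine mem_one_iff_exists_intCast.mpr ⟨e, ?_⟩
      rw [diagForm_apply, sum_eq_sum_subtype (P := fun i => (p : ℤ) ∣ N i)]
      · apply mul_left_cancel₀ hp0
        rw [show (p : ℚ) * e = ((p * e : ℤ) : ℚ) by push_cast; rfl, ← he, Finset.mul_sum]
        push_cast
        refine Finset.sum_congr rfl fun i _ => ?_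
        simp only [y, dif_pos i.2, hc, ha]
        field_simp
      · intro i hi
        simp [y, hi]
    obtain ⟨l, hl, m, ⟨d, hd⟩, hlm⟩ := Submodule.mem_sup.mp hy
    have hli : ∀ i, l i = y i - d i := fun i => by rw [← hlm, Pi.add_apply, hd]; ring
    refine ⟨l, hl, fun i => if h : (p : ℤ) ∣ N i then n i * (z ⟨i, h⟩).val - N i * d i
      else - (N i * d i), fun i => ?_, fun i => ?_⟩
    · rw [hli]
      by_cases h : (p : ℤ) ∣ N i
      · have h3 : (N i : ℚ) = p * n i := by exact_mod_cast hT i h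
        simp only [y, dif_pos h]
        push_cast
        rw [mul_sub, h3]
        field_simp
      · simp only [y, dif_neg h]
        push_cast
        ring
    · simp only [dif_pos i.2]
      have : ((N i : ℤ) : ZMod p) = 0 := (ZMod.intCast_zmod_eq_zero_iff_dvd _ _).mpr i.2
      push_cast
      rw [this, ht]
      simp
  have h1 := Submodule.finrank_mono hle
  have h2 := LinearMap.BilinForm.finrank_orthogonal (diagForm_nondegenerate t) U
  have h3 := Submodule.finrank_le U
  rw [Module.finrank_fintype_fun_eq_card] at h2 h3
  omega

/-- Over `ℚ` a form containing a self-dual lattice is a multiple of `⟨1⟩` in the Witt group. -/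
lemma sum_intUnary_mem_zmultiples {N : ι → ℤ} (hN : ∀ i, Squarefree (N i)) {a : ι → ℚˣ}
    (ha : ∀ i, (a i : ℚ) = N i) (Λ : Submodule ℤ (ι → ℚ)) [Submodule.IsLattice ℚ Λ]
    (hΛ : (diagForm a).dualSubmodule Λ = Λ) :
    ∑ i, unary (a i) ∈ AddSubgroup.zmultiples (unary (1 : ℚˣ)) := by
  classical
  have h1 : unary (1 : ℚˣ) = intUnary 1 := (intUnary_eq (by simp)).symm
  have h2 : ∀ i, unary (a i) = intUnary (N i) := fun i => (intUnary_eq (ha i)).symm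
  simp only [h1, h2]
  refine mem_zmultiples_of_secondResidue_eq_zero fun p hp => ?_
  have hpZ := Nat.prime_iff_prime_int.mp hp.out
  have hn : ∀ i, ∃ n : ℤ, ¬ (p : ℤ) ∣ n ∧ ((p : ℤ) ∣ N i → N i = p * n) ∧
      (¬ (p : ℤ) ∣ N i → N i = n) := fun i => by
    by_cases h : (p : ℤ) ∣ N i
    · obtain ⟨n, hn⟩ := id h
      refine ⟨n, fun ⟨m, hm⟩ => hpZ.not_isUnit (hN i p ⟨m, by rw [hn, hm, mul_assoc]⟩),
        fun _ => hn, fun h' => (h' h).elim⟩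
    · exact ⟨N i, h, fun h' => (h h').elim, fun _ => rfl⟩
  choose n hn hT hT' using hn
  have hu : ∀ i, ((n i : ℤ) : ZMod p) ≠ 0 := fun i => by
    rw [Ne, ZMod.intCast_zmod_eq_zero_iff_dvd]
    exact hn i
  have hmet := metabolic_residue ha Λ hΛ hn hT hT' (fun i => Units.mk0 _ (hu i)) fun _ => rfl
  rw [map_sum, sum_eq_sum_subtype (P := fun i => (p : ℤ) ∣ N i),
    ← isWittMap_residueUnary.sum_eq_zero hmet]
  · refine Finset.sum_congr rfl fun i _ => ?_
    have := secondResidue_intUnary (p := p) (k := 1) (u := Units.mk0 _ (hu i)) rfl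
    rw [pow_one, if_neg (by decide)] at this
    rw [hT i i.2, this]
  · intro i hi
    have := secondResidue_intUnary (p := p) (k := 0) (u := Units.mk0 _ (hu i)) rfl
    rw [pow_zero, one_mul, if_pos (by decide)] at this
    rw [hT' i hi, this]

end SelfDual

section Isotropy

lemma exists_mul_sq_squarefree (q : ℚˣ) :
    ∃ (s : ℚˣ) (N : ℤ), Squarefree N ∧ (q : ℚ) * s ^ 2 = N := by
  have hd : ((q : ℚ).den : ℚ) ≠ 0 := by exact_mod_cast (q : ℚ).den_nz
  have hn : (q : ℚ).num ≠ 0 := by simp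
  obtain ⟨a, b, hab, ha⟩ := Nat.sq_mul_squarefree ((q : ℚ).num * (q : ℚ).den).natAbs
  have hM : ((q : ℚ).num * (q : ℚ).den).natAbs ≠ 0 := by simp
  have hb : (b : ℚ) ≠ 0 := by
    have : b ≠ 0 := by
      rintro rfl
      rw [← hab] at hM
      simp at hM
    exact_mod_cast this
  have hq : (q : ℚ) * (q : ℚ).den ^ 2 = (((q : ℚ).num * (q : ℚ).den : ℤ) : ℚ) := by
    push_cast
    nth_rewrite 1 [← Rat.num_div_den (q : ℚ)]
    field_simp
  have hdb : (q : ℚ) * ((q : ℚ).den / b) ^ 2 =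
      (((q : ℚ).num * (q : ℚ).den : ℤ) : ℚ) / b ^ 2 := by
    rw [← hq]
    ring
  refine ⟨Units.mk0 ((q : ℚ).den / b) (div_ne_zero hd hb), ?_⟩
  rw [Units.val_mk0, hdb]
  have ha' : Squarefree (a : ℤ) := Int.squarefree_natCast.mpr ha
  rcases Int.natAbs_eq ((q : ℚ).num * (q : ℚ).den) with h | h <;> rw [h, ← hab]
  · refine ⟨a, ha', ?_⟩
    push_cast
    field_simp
  · refine ⟨-a, (Int.squarefree_natAbs.mp (by simpa using ha)), ?_⟩
    push_cast
    field_simp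

/-- A nondegenerate symmetric form on a lattice is diagonal with squarefree integral entries in
suitable rational coordinates. -/
lemma exists_rational_diagonalization {L : Type*} [AddCommGroup L] [Module.Free ℤ L]
    [Module.Finite ℤ L] (B : LinearMap.BilinForm ℤ L) (hs : B.IsSymm)
    (hB : B.Nondegenerate) :
    ∃ (n : ℕ) (e : L →ₗ[ℤ] (Fin n → ℚ)) (a : Fin n → ℚˣ) (N : Fin n → ℤ),
      (∀ i, Squarefree (N i)) ∧ (∀ i, (a i : ℚ) = N i) ∧ Function.Injective e ∧
      (∀ x y, diagForm a (e x) (e y) = B x y) ∧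
      ∀ w, ∃ d : ℤ, d ≠ 0 ∧ ∃ x, e x = (d : ℚ) • w := by
  classical
  let κ := Module.Free.ChooseBasisIndex ℤ L
  let b : Module.Basis κ ℤ L := Module.Free.chooseBasis ℤ L
  let G : Matrix κ κ ℚ := (LinearMap.BilinForm.toMatrix b B).map (Int.cast : ℤ → ℚ)
  let Bq : LinearMap.BilinForm ℚ (κ → ℚ) := Matrix.toBilin' G
  let j : L →ₗ[ℤ] (κ → ℚ) :=
    { toFun := fun x i => (b.repr x i : ℚ)
      map_add' := fun x y => by funext i; simp
      map_smul' := fun m x => by funext i; simp }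
  have hj : ∀ x y, Bq (j x) (j y) = B x y := by
    intro x y
    rw [Matrix.toBilin'_apply]
    conv_rhs => rw [← b.sum_repr x, ← b.sum_repr y]
    simp only [map_sum, LinearMap.sum_apply, map_smul, LinearMap.smul_apply, smul_eq_mul]
    push_cast
    rw [Finset.sum_comm]
    refine Finset.sum_congr rfl fun i _ => ?_
    rw [Finset.mul_sum]
    refine Finset.sum_congr rfl fun l _ => ?_
    simp only [j, G, LinearMap.coe_mk, AddHom.coe_mk, Matrix.map_apply,
      LinearMap.BilinForm.toMatrix_apply]
    ring
  have hBq : Bq.Nondegenerate := by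
    rw [LinearMap.BilinForm.nondegenerate_toBilin'_iff_det_ne_zero]
    have := (LinearMap.BilinForm.nondegenerate_iff_det_ne_zero b).mp hB
    rw [← Int.cast_det]
    exact_mod_cast this
  have hBqs : Bq.IsSymm := by
    rw [Matrix.isSymm_toBilin'_iff_isSymm]
    exact ((LinearMap.BilinForm.isSymm_toMatrix_iff_isSymm b).mpr hs).map _
  obtain ⟨v, hv⟩ := LinearMap.BilinForm.exists_orthogonal_basis
    (B := Bq) ⟨fun x y => hBqs.eq x y⟩
  have hv0 : ∀ i, Bq (v i) (v i) ≠ 0 := fun i =>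
    hv.not_isOrtho_basis_self_of_separatingLeft hBq.1 i
  choose s N hN hsN using fun i => exists_mul_sq_squarefree (Units.mk0 _ (hv0 i))
  let v' := v.unitsSMul s
  have hN0 : ∀ i, (N i : ℚ) ≠ 0 := fun i => by
    exact_mod_cast (hN i).ne_zero
  refine ⟨_, (v'.equivFun.toLinearMap.restrictScalars ℤ).comp j, fun i => Units.mk0 _ (hN0 i), N,
    hN, fun i => rfl, ?_, ?_, ?_⟩
  · refine v'.equivFun.injective.comp fun x y hxy => b.repr.injective ?_
    ext i
    have : (b.repr x i : ℚ) = b.repr y i := congrFun hxy i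
    exact_mod_cast this
  · intro x y
    have hvv : ∀ i l, Bq (v' i) (v' l) = if i = l then (N i : ℚ) else 0 := by
      intro i l
      rw [Module.Basis.unitsSMul_apply, Module.Basis.unitsSMul_apply]
      simp only [Units.smul_def, map_smul, LinearMap.smul_apply, smul_eq_mul]
      split_ifs with h
      · subst h
        rw [← hsN, Units.val_mk0]
        ring
      · rw [show Bq (v i) (v l) = 0 from hv h, mul_zero, mul_zero]
    rw [← hj, diagForm_apply]
    conv_rhs => rw [← v'.sum_equivFun (j x), ← v'.sum_equivFun (j y)]
    simp only [map_sum, LinearMap.sum_apply, map_smul, LinearMap.smul_apply, smul_eq_mul, hvv,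
      mul_ite, mul_zero, Finset.sum_ite_eq', Finset.mem_univ, if_true,
      LinearMap.comp_apply, LinearMap.restrictScalars_apply, LinearEquiv.coe_coe, Units.val_mk0]
    exact Finset.sum_congr rfl fun i _ => by ring
  · intro w
    obtain ⟨d, hd⟩ := IsLocalization.exist_integer_multiples_of_finite (nonZeroDivisors ℤ)
      (v'.equivFun.symm w)
    choose c hc using hd
    refine ⟨d, nonZeroDivisors.coe_ne_zero d, b.repr.symm (Finsupp.equivFunOnFinite.symm c), ?_⟩
    have : j (b.repr.symm (Finsupp.equivFunOnFinite.symm c)) =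
        (d : ℚ) • (v'.equivFun.symm w) := by
      funext i
      simpa [j] using hc i
    rw [LinearMap.comp_apply, this]
    change v'.equivFun ((d : ℚ) • v'.equivFun.symm w) = _
    rw [map_smul, LinearEquiv.apply_symm_apply]

lemma isLattice_range {n : ℕ} {L : Type*} [AddCommGroup L] [Module.Finite ℤ L]
    (e : L →ₗ[ℤ] (Fin n → ℚ)) (he : ∀ w, ∃ d : ℤ, d ≠ 0 ∧ ∃ x, e x = (d : ℚ) • w) :
    Submodule.IsLattice ℚ (LinearMap.range e) := by
  refine ⟨Module.Finite.fg_top.map e |> fun h => by rwa [Submodule.map_top] at h, ?_⟩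
  rw [eq_top_iff]
  intro w _
  obtain ⟨d, hd, x, hx⟩ := he w
  have hd' : (d : ℚ) ≠ 0 := by exact_mod_cast hd
  rw [← inv_smul_smul₀ hd' w, ← hx]
  exact Submodule.smul_mem _ _ (Submodule.subset_span ⟨x, rfl⟩)

lemma dualSubmodule_range_eq {n : ℕ} {L : Type*} [AddCommGroup L] [Module.Finite ℤ L]
    {B : LinearMap.BilinForm ℤ L} (hB : Function.Bijective B) {a : Fin n → ℚˣ}
    (e : L →ₗ[ℤ] (Fin n → ℚ)) (he : ∀ w, ∃ d : ℤ, d ≠ 0 ∧ ∃ x, e x = (d : ℚ) • w)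
    (ha : ∀ x y, diagForm a (e x) (e y) = B x y) :
    (diagForm a).dualSubmodule (LinearMap.range e) = LinearMap.range e := by
  apply le_antisymm
  · intro x hx
    obtain ⟨l, hl⟩ := hB.2
      (((diagForm a).dualSubmoduleToDual (LinearMap.range e) ⟨x, hx⟩).comp e.rangeRestrict)
    refine ⟨l, ?_⟩
    rw [← sub_eq_zero]
    apply (diagForm_nondegenerate a).1
    intro w
    obtain ⟨d, hd, y, hy⟩ := he w
    have hd' : (d : ℚ) ≠ 0 := by exact_mod_cast hd
    have h0 : diagForm a (e l - x) (e y) = 0 := by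
      rw [map_sub, LinearMap.sub_apply, ha, hl]
      have := (diagForm a).dualSubmoduleParing_spec (N := LinearMap.range e) ⟨x, hx⟩
        (e.rangeRestrict y)
      simpa [sub_eq_zero] using this
    rw [hy, map_smul, smul_eq_mul] at h0
    exact (mul_eq_zero.mp h0).resolve_left hd'
  · rintro _ ⟨x, rfl⟩ _ ⟨y, rfl⟩
    exact mem_one_iff_exists_intCast.mpr ⟨B x y, (ha x y).symm⟩

open WittGroup

lemma exists_isotropic_of_sum_unary {ι : Type*} [Fintype ι] {a : ι → ℚˣ} {k : ℕ}
    (h : ∑ i, unary (a i) = k • unary 1) {v : ι → ℚ} (hv : diagForm a v v < 0) :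
    ∃ w ≠ 0, diagForm a w w = 0 := by
  have hmet : Metabolic (Sum.elim a fun _ : Fin k => -1) := by
    rw [← sum_unary_eq_zero_iff]
    simp [h, unary_neg]
  obtain ⟨W, hW, hcard⟩ := hmet
  by_contra! hno
  have hinj : ∀ f ∈ W, f ∘ Sum.inr = 0 → f = 0 := by
    intro f hf h0
    have h1 := hW f hf f hf
    rw [diagForm_sumElim, h0] at h1
    have h2 : f ∘ Sum.inl = 0 := by
      by_contra hne
      exact hno _ hne (by simpa using h1)
    funext i
    rcases i with i | i
    · exact congrFun h2 i
    · exact congrFun h0 i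
  let ρ : W →ₗ[ℚ] (Fin k → ℚ) := (LinearMap.funLeft ℚ ℚ Sum.inr).comp W.subtype
  have hρ : Function.Injective ρ := by
    rw [← LinearMap.ker_eq_bot, LinearMap.ker_eq_bot']
    exact fun f hf => Subtype.ext (hinj f f.2 hf)
  have h1 := LinearMap.finrank_le_finrank_of_injective hρ
  let ψ : (ℚ × (Fin k → ℚ)) →ₗ[ℚ] (ι ⊕ Fin k → ℚ) :=
    { toFun := fun c => Sum.elim (c.1 • v) c.2
      map_add' := fun c d => by funext i; rcases i with i | i <;> simp [add_mul]
      map_smul' := fun c d => by funext i; rcases i with i | i <;> simp [mul_assoc] }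
  have hneg : ∀ c, diagForm (Sum.elim a fun _ : Fin k => -1) (ψ c) (ψ c) = 0 → c = 0 := by
    intro c hc
    rw [diagForm_sumElim] at hc
    simp only [ψ, LinearMap.coe_mk, AddHom.coe_mk, Sum.elim_comp_inl, Sum.elim_comp_inr, map_smul,
      LinearMap.smul_apply, smul_eq_mul] at hc
    rw [diagForm_apply (fun _ => -1)] at hc
    simp only [Units.val_neg, Units.val_one, neg_mul, one_mul, Finset.sum_neg_distrib] at hc
    have h2 : 0 ≤ ∑ i, c.2 i * c.2 i := Finset.sum_nonneg fun i _ => mul_self_nonneg _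
    have h3 : c.1 = 0 := by
      by_contra h0
      have : 0 < c.1 * c.1 := mul_self_pos.mpr h0
      nlinarith
    refine Prod.ext h3 (funext fun i => ?_)
    rw [h3] at hc
    have h4 : ∑ i, c.2 i * c.2 i = 0 := by linarith
    have := (Finset.sum_eq_zero_iff_of_nonneg fun i _ => mul_self_nonneg _).mp h4 i
      (Finset.mem_univ i)
    simpa using this
  have hψ : Function.Injective ψ := by
    rw [← LinearMap.ker_eq_bot, LinearMap.ker_eq_bot']
    exact fun c hc => hneg c (by rw [hc]; simp)
  have hdisj : Disjoint W (LinearMap.range ψ) := by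
    rw [Submodule.disjoint_def]
    rintro _ hf ⟨c, rfl⟩
    rw [hneg c (hW _ hf _ hf), map_zero]
  have h2 := Submodule.finrank_add_finrank_le_of_disjoint hdisj
  rw [LinearMap.finrank_range_of_inj hψ] at h2
  simp at h1 h2 hcard
  omega

/-- An indefinite unimodular lattice contains a nonzero isotropic vector. -/
theorem exists_isotropic_of_indefinite {L : Type*} [AddCommGroup L] [Module.Free ℤ L]
    [Module.Finite ℤ L] {B : LinearMap.BilinForm ℤ L} (hs : B.IsSymm)
    (hB : Function.Bijective B) (hpos : ∃ x, 0 < B x x) (hneg : ∃ x, B x x < 0) :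
    ∃ x ≠ 0, B x x = 0 := by
  have hnd : B.Nondegenerate := by
    refine (LinearMap.BilinForm.IsSymm.isRefl hs).nondegenerate_iff_separatingLeft.mpr
      fun x hx => hB.1 ?_
    rw [map_zero]
    exact LinearMap.ext hx
  obtain ⟨n, e, a, N, hN, haN, hinj, ha, he⟩ := exists_rational_diagonalization B hs hnd
  have := isLattice_range e he
  obtain ⟨z, hz⟩ := sum_intUnary_mem_zmultiples hN haN _ (dualSubmodule_range_eq hB e he ha)
  have hw : ∃ w ≠ 0, diagForm a w w = 0 := by
    obtain ⟨k, rfl | rfl⟩ := z.eq_nat_or_neg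
    · obtain ⟨x, hx⟩ := hneg
      refine exists_isotropic_of_sum_unary (k := k) (by simpa using hz.symm) (v := e x) ?_
      rw [ha]
      exact_mod_cast hx
    · obtain ⟨x, hx⟩ := hpos
      obtain ⟨w, hw0, hw⟩ := exists_isotropic_of_sum_unary (k := k) (a := fun i => -a i)
        (by simp [unary_neg, ← hz]) (v := e x) (by
          rw [diagForm_neg, ha]
          exact_mod_cast neg_neg_of_pos hx)
      exact ⟨w, hw0, by simpa [diagForm_neg] using hw⟩
  obtain ⟨w, hw0, hw⟩ := hw
  obtain ⟨d, hd, x, hx⟩ := he w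
  refine ⟨x, ?_, ?_⟩
  · rintro rfl
    rw [map_zero] at hx
    have hd' : (d : ℚ) ≠ 0 := by exact_mod_cast hd
    exact (smul_ne_zero hd' hw0) hx.symm
  · have := ha x x
    rw [hx] at this
    simp [hw] at this
    exact_mod_cast this.symm

end Isotropy

section Unimodular

variable {L : Type*} [AddCommGroup L] {B : LinearMap.BilinForm ℤ L}

/-- A symmetric bilinear form over `ℤ` identifying the lattice with its dual. -/
structure IsUnimodular {L : Type*} [AddCommGroup L] (B : LinearMap.BilinForm ℤ L) : Prop where
  symm : ∀ x y, B x y = B y x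
  bijective : Function.Bijective B

namespace IsUnimodular

theorem ext_left (hB : IsUnimodular B) {x y : L} (h : ∀ z, B x z = B y z) : x = y :=
  hB.bijective.1 (LinearMap.ext h)

theorem exists_apply_eq (hB : IsUnimodular B) (f : L →ₗ[ℤ] ℤ) : ∃ x, ∀ y, B x y = f y := by
  obtain ⟨x, rfl⟩ := hB.bijective.2 f
  exact ⟨x, fun _ => rfl⟩

theorem isotropic [Module.Free ℤ L] [Module.Finite ℤ L] (hB : IsUnimodular B)
    (hpos : ∃ x, 0 < B x x) (hneg : ∃ x, B x x < 0) : ∃ x ≠ 0, B x x = 0 :=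
  exists_isotropic_of_indefinite ⟨fun x y => hB.symm x y⟩ hB.bijective hpos hneg

/-- A sublattice with an orthogonal projection onto it is again unimodular. -/
theorem restrict_of_projection (hB : IsUnimodular B) {K : Submodule ℤ L} (p : L →ₗ[ℤ] L)
    (hpK : ∀ v, p v ∈ K) (hpp : ∀ v ∈ K, p v = v) (hp : ∀ v, ∀ k ∈ K, B v k = B (p v) k) :
    IsUnimodular (B.domRestrict₁₂ K K) := by
  refine ⟨fun x y => hB.symm x y, fun x y hxy => ?_, fun f => ?_⟩
  · refine Subtype.ext (hB.ext_left fun z => ?_)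
    have := LinearMap.congr_fun hxy ⟨p z, hpK z⟩
    simp only [LinearMap.domRestrict₁₂_apply] at this
    rw [hB.symm x z, hB.symm y z, hp z x x.2, hp z y y.2, hB.symm _ (x : L), hB.symm _ (y : L),
      this]
  · obtain ⟨x, hx⟩ := hB.exists_apply_eq (f ∘ₗ p.codRestrict K hpK)
    refine ⟨⟨p x, hpK x⟩, LinearMap.ext fun k => ?_⟩
    simp only [LinearMap.domRestrict₁₂_apply]
    rw [← hp x k k.2, hx]
    exact congr_arg f (Subtype.ext (hpp k k.2))

theorem restrict_ker (hB : IsUnimodular B) {e : L} {ε : ℤ} (he : B e e = ε)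
    (hε : ε = 1 ∨ ε = -1) :
    IsUnimodular (B.domRestrict₁₂ (LinearMap.ker (B e)) (LinearMap.ker (B e))) := by
  have hεε : ε * ε = 1 := by rcases hε with rfl | rfl <;> rfl
  refine hB.restrict_of_projection
    (LinearMap.id - ((B e).smulRight (ε • e))) (fun v => ?_) (fun v hv => ?_) fun v k hk => ?_
  · simp only [LinearMap.mem_ker, LinearMap.sub_apply, LinearMap.id_apply,
      LinearMap.smulRight_apply, map_sub, map_smul, he, smul_eq_mul, hεε]
    ring
  · simp [LinearMap.mem_ker.1 hv]
  · simp [LinearMap.mem_ker.1 hk]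

theorem restrict_ker_inf_ker (hB : IsUnimodular B) {x y : L} (hx : B x x = 0) (hy : B y y = 0)
    (hxy : B x y = 1) :
    IsUnimodular (B.domRestrict₁₂ (LinearMap.ker (B x) ⊓ LinearMap.ker (B y))
      (LinearMap.ker (B x) ⊓ LinearMap.ker (B y))) := by
  have hyx : B y x = 1 := by rw [hB.symm, hxy]
  refine hB.restrict_of_projection
    (LinearMap.id - (B x).smulRight y - (B y).smulRight x) (fun v => ?_) (fun v hv => ?_)
    fun v k hk => ?_
  · simp [hx, hy, hxy, hyx]
  · simp [LinearMap.mem_ker.1 hv.1, LinearMap.mem_ker.1 hv.2]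
  · simp [LinearMap.mem_ker.1 hk.1, LinearMap.mem_ker.1 hk.2]

theorem exists_hyperbolic_pair (hB : IsUnimodular B) (h : ∃ x ≠ 0, B x x = 0) :
    ∃ x y, B x x = 0 ∧ B x y = 1 := by
  obtain ⟨x, hx0, hx⟩ := h
  obtain ⟨d, hd⟩ := (inferInstance : (LinearMap.range (B x)).IsPrincipal)
  have hdvd : ∀ v, ∃ c, B x v = d * c := fun v => by
    have : B x v ∈ Submodule.span ℤ {d} := hd ▸ LinearMap.mem_range_self _ v
    obtain ⟨c, hc⟩ := Submodule.mem_span_singleton.1 this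
    exact ⟨c, by rw [← hc, smul_eq_mul, mul_comm]⟩
  obtain ⟨y, hy⟩ : d ∈ LinearMap.range (B x) := hd ▸ Submodule.mem_span_singleton_self d
  choose f hf using hdvd
  have hd0 : d ≠ 0 := by
    rintro rfl
    exact hx0 (hB.ext_left fun z => by simp [hf z])
  obtain ⟨z, hz⟩ := hB.exists_apply_eq
    (AddMonoidHom.mk' f fun a b => mul_left_cancel₀ hd0 (by
      rw [← hf, map_add, hf, hf, mul_add])).toIntLinearMap
  have hz' : ∀ v, B z v = f v := hz
  have hxz : x = d • z := hB.ext_left fun v => by simp [hf, hz']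
  refine ⟨z, y, ?_, ?_⟩
  · rw [hxz] at hx
    simpa [hd0] using hx
  · refine mul_left_cancel₀ hd0 ?_
    rw [hz', ← hf, hy, mul_one]

end IsUnimodular

/-- The lattice has an orthogonal basis of vectors of norm `1` and `-1`. -/
def HasSignBasis {L : Type*} [AddCommGroup L] (B : LinearMap.BilinForm ℤ L) : Prop :=
  ∃ (n : ℕ) (b : Module.Basis (Fin n) ℤ L) (ε : Fin n → ℤ), (∀ i, ε i = 1 ∨ ε i = -1) ∧
    ∀ i j, B (b i) (b j) = if i = j then ε i else 0

/-- A basis of `e^⊥` and `e` form a basis if `e` has norm `±1`. -/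
noncomputable def basisConsKer {e : L} {ε : ℤ} (he : B e e = ε) (hε : ε = 1 ∨ ε = -1) {n : ℕ}
    (b : Module.Basis (Fin n) ℤ (LinearMap.ker (B e))) : Module.Basis (Fin (n + 1)) ℤ L :=
  b.mkFinCons e
    (fun c x hx h => by
      have := congr_arg (B e) h
      rw [map_add, LinearMap.mem_ker.1 hx, map_smul, he, map_zero, smul_eq_mul, add_zero] at this
      rcases hε with rfl | rfl <;> simpa using this)
    (fun z => ⟨-(B e z * ε), by
      rw [LinearMap.mem_ker, map_add, map_smul, he, smul_eq_mul]
      rcases hε with rfl | rfl <;> ring⟩)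

theorem coe_basisConsKer {e : L} {ε : ℤ} (he : B e e = ε) (hε : ε = 1 ∨ ε = -1) {n : ℕ}
    (b : Module.Basis (Fin n) ℤ (LinearMap.ker (B e))) :
    ⇑(basisConsKer he hε b) = Fin.cons e (Subtype.val ∘ b) :=
  Module.Basis.coe_mkFinCons ..

theorem HasSignBasis.of_ker (hs : ∀ x y, B x y = B y x) {e : L} {ε : ℤ} (he : B e e = ε)
    (hε : ε = 1 ∨ ε = -1)
    (h : HasSignBasis (B.domRestrict₁₂ (LinearMap.ker (B e)) (LinearMap.ker (B e)))) :
    HasSignBasis B := by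
  obtain ⟨n, b, δ, hδ, hb⟩ := h
  refine ⟨n + 1, basisConsKer he hε b, Fin.cons ε δ, Fin.cases hε hδ, ?_⟩
  have h0 (k) : B e (b k) = 0 := (b k).2
  rw [coe_basisConsKer]
  refine Fin.cases (Fin.cases (by simp [he]) fun j => ?_) fun i => Fin.cases ?_ fun j => ?_
  · simp [h0, (Fin.succ_ne_zero j).symm]
  · simp [hs _ e, h0]
  · simp only [Fin.cons_succ, Function.comp_apply, Fin.succ_inj]
    exact hb i j

theorem finrank_ker_lt [Module.Free ℤ L] [Module.Finite ℤ L] {e : L} {ε : ℤ} (he : B e e = ε)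
    (hε : ε = 1 ∨ ε = -1) :
    Module.finrank ℤ (LinearMap.ker (B e)) < Module.finrank ℤ L := by
  rw [Module.finrank_eq_card_basis
    (basisConsKer he hε (Module.finBasis ℤ (LinearMap.ker (B e)))), Fintype.card_fin]
  exact Nat.lt_succ_self _

theorem IsUnimodular.exists_odd_hyperbolic_pair (hB : IsUnimodular B) (h : ∃ x ≠ 0, B x x = 0)
    (hodd : ∃ t, Odd (B t t)) : ∃ x y, B x x = 0 ∧ B x y = 1 ∧ Odd (B y y) := by
  obtain ⟨x, y, hx, hxy⟩ := hB.exists_hyperbolic_pair h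
  obtain ⟨t, ht⟩ := hodd
  by_cases hy : Odd (B y y)
  · exact ⟨x, y, hx, hxy, hy⟩
  rw [Int.not_odd_iff_even] at hy
  refine ⟨x, t + (1 - B x t) • y, hx, ?_, ?_⟩
  · simp [hxy]
  · have : B (t + (1 - B x t) • y) (t + (1 - B x t) • y) =
      B t t + 2 * ((1 - B x t) * B t y) + (1 - B x t) ^ 2 * B y y := by
      simp only [map_add, map_smul, LinearMap.add_apply, LinearMap.smul_apply, smul_eq_mul,
        hB.symm y t]
      ring
    rw [this]
    exact (ht.add_even (even_two_mul _)).add_even (hy.mul_left _)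

/-- An odd indefinite unimodular lattice contains orthogonal vectors of norms `1` and `-1`. -/
theorem IsUnimodular.exists_orthogonal_pair (hB : IsUnimodular B) (h : ∃ x ≠ 0, B x x = 0)
    (hodd : ∃ t, Odd (B t t)) : ∃ e f, B e e = 1 ∧ B f f = -1 ∧ B e f = 0 := by
  obtain ⟨x, y, hx, hxy, m, hy⟩ := hB.exists_odd_hyperbolic_pair h hodd
  have hyx : B y x = 1 := by rw [hB.symm, hxy]
  refine ⟨y - m • x, y - (m + 1) • x, ?_, ?_, ?_⟩ <;>
  · simp only [map_sub, map_smul, LinearMap.sub_apply, LinearMap.smul_apply, smul_eq_mul, hx, hy,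
      hxy, hyx]
    ring

theorem hasSignBasis_of_subsingleton [Subsingleton L] : HasSignBasis B :=
  ⟨0, .empty L, 0, fun i => i.elim0, fun i => i.elim0⟩

/-- Odd indefinite unimodular lattices are diagonalizable. -/
theorem IsUnimodular.hasSignBasis : ∀ (k : ℕ) {L : Type*} [AddCommGroup L] [Module.Free ℤ L]
    [Module.Finite ℤ L] {B : LinearMap.BilinForm ℤ L}, IsUnimodular B → (∃ t, Odd (B t t)) →
    (∃ x, 0 < B x x) → (∃ x, B x x < 0) → Module.finrank ℤ L = k → HasSignBasis B := by
  intro k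
  induction k using Nat.strong_induction_on with
  | _ k ih =>
  intro L _ _ _ B hB hodd hpos hneg hk
  obtain ⟨e, f, he, hf, hef⟩ := hB.exists_orthogonal_pair (hB.isotropic hpos hneg) hodd
  have hfe : B f e = 0 := by rw [hB.symm, hef]
  by_cases hz : ∃ z, B e z = 0 ∧ B f z = 0 ∧ B z z ≠ 0
  · obtain ⟨z, hez, hfz, hz⟩ := hz
    rcases hz.lt_or_gt with hz | hz
    · refine .of_ker hB.symm hf (.inr rfl) (ih _ (hk ▸ finrank_ker_lt hf (.inr rfl))
        (hB.restrict_ker hf (.inr rfl)) ⟨⟨e, hfe⟩, ?_⟩ ⟨⟨e, hfe⟩, ?_⟩ ⟨⟨z, hfz⟩, hz⟩ rfl)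
      · exact he ▸ odd_one
      · exact he ▸ one_pos
    · refine .of_ker hB.symm he (.inl rfl) (ih _ (hk ▸ finrank_ker_lt he (.inl rfl))
        (hB.restrict_ker he (.inl rfl)) ⟨⟨f, hef⟩, ?_⟩ ⟨⟨z, hez⟩, hz⟩ ⟨⟨f, hef⟩, ?_⟩ rfl)
      · exact hf ▸ odd_neg_one
      · exact hf ▸ neg_one_lt_zero
  · push Not at hz
    have hK := hB.restrict_ker he (.inl rfl)
    let f' : LinearMap.ker (B e) := ⟨f, hef⟩
    have hf' : B.domRestrict₁₂ (LinearMap.ker (B e)) (LinearMap.ker (B e)) f' f' = -1 := hf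
    have hF := hK.restrict_ker hf' (.inr rfl)
    refine .of_ker hB.symm he (.inl rfl) (.of_ker hK.symm hf' (.inr rfl) ?_)
    have hzero (z : LinearMap.ker ((B.domRestrict₁₂ (LinearMap.ker (B e))
        (LinearMap.ker (B e))) f')) : B z z = 0 := hz z z.1.2 z.2
    have : Subsingleton (LinearMap.ker ((B.domRestrict₁₂ (LinearMap.ker (B e))
        (LinearMap.ker (B e))) f')) := by
      refine ⟨fun u v => hF.ext_left fun w => ?_⟩
      have key (u v : LinearMap.ker ((B.domRestrict₁₂ (LinearMap.ker (B e))
        (LinearMap.ker (B e))) f')) : B u v = 0 := by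
        have := hzero (u + v)
        simp only [Submodule.coe_add, map_add, LinearMap.add_apply, hzero,
          hB.symm (v : L) u] at this
        linarith
      exact (key u w).trans (key v w).symm
    exact hasSignBasis_of_subsingleton

end Unimodular

section Hyperbolic

variable {F' F : Type*} [AddCommGroup F'] [AddCommGroup F]

/-- The orthogonal sum of the form `⟨1⟩ ⊕ ⟨-1⟩` and `C`. -/
def oddForm (C : LinearMap.BilinForm ℤ F) : LinearMap.BilinForm ℤ (ℤ × ℤ × F) :=
  LinearMap.mk₂ ℤ (fun u v => u.1 * v.1 - u.2.1 * v.2.1 + C u.2.2 v.2.2)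
    (fun _ _ _ => by simp; ring) (fun _ _ _ => by simp; ring) (fun _ _ _ => by simp; ring)
    (fun _ _ _ => by simp; ring)

/-- The orthogonal sum of the hyperbolic plane and `C`. -/
def evenForm (C : LinearMap.BilinForm ℤ F) : LinearMap.BilinForm ℤ (ℤ × ℤ × F) :=
  LinearMap.mk₂ ℤ (fun u v => u.1 * v.2.1 + u.2.1 * v.1 + C u.2.2 v.2.2)
    (fun _ _ _ => by simp; ring) (fun _ _ _ => by simp; ring) (fun _ _ _ => by simp; ring)
    (fun _ _ _ => by simp; ring)

theorem oddForm_apply (C : LinearMap.BilinForm ℤ F) (u v : ℤ × ℤ × F) :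
    oddForm C u v = u.1 * v.1 - u.2.1 * v.2.1 + C u.2.2 v.2.2 := rfl

theorem evenForm_apply (C : LinearMap.BilinForm ℤ F) (u v : ℤ × ℤ × F) :
    evenForm C u v = u.1 * v.2.1 + u.2.1 * v.1 + C u.2.2 v.2.2 := rfl

theorem IsUnimodular.oddForm {C : LinearMap.BilinForm ℤ F} (hC : IsUnimodular C) :
    IsUnimodular (oddForm C) := by
  refine ⟨fun u v => by simp only [oddForm_apply, hC.symm u.2.2]; ring, fun u v h => ?_,
    fun f => ?_⟩
  · have h (w) : _root_.oddForm C u w = _root_.oddForm C v w := LinearMap.congr_fun h w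
    simp only [oddForm_apply] at h
    have h1 := h (1, 0, 0)
    have h2 := h (0, 1, 0)
    have h3 : u.2.2 = v.2.2 := hC.ext_left fun z => by simpa using h (0, 0, z)
    simp at h1 h2
    exact Prod.ext h1 (Prod.ext h2 h3)
  · obtain ⟨r, hr⟩ := hC.exists_apply_eq
      (f ∘ₗ LinearMap.inr ℤ ℤ (ℤ × F) ∘ₗ LinearMap.inr ℤ ℤ F)
    refine ⟨(f (1, 0, 0), -f (0, 1, 0), r), LinearMap.ext fun v => ?_⟩
    have : v = v.1 • (1, 0, 0) + v.2.1 • (0, 1, 0) + (0, 0, v.2.2) := by ext <;> simp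
    have hv : f v = v.1 * f (1, 0, 0) + v.2.1 * f (0, 1, 0) + f (0, 0, v.2.2) := by
      conv_lhs => rw [this]
      simp only [map_add, map_smul, smul_eq_mul]
    simp [oddForm_apply, hr, hv]
    ring

/-- A similitude of ratio `4` from the even to the odd form. -/
def evenToOdd : (ℤ × ℤ × F) →ₗ[ℤ] (ℤ × ℤ × F) where
  toFun u := (u.1 + 2 * u.2.1, u.1 - 2 * u.2.1, (2 : ℤ) • u.2.2)
  map_add' u v := by ext <;> simp <;> ring
  map_smul' c u := by ext <;> simp [smul_comm c] <;> ring

/-- Similitudes of ratio `4` from the odd to the even form, indexed by a sign. -/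
def oddToEven (σ : ℤ) : (ℤ × ℤ × F) →ₗ[ℤ] (ℤ × ℤ × F) where
  toFun u := (2 * (u.1 + σ * u.2.1), u.1 - σ * u.2.1, (2 : ℤ) • u.2.2)
  map_add' u v := by ext <;> simp <;> ring
  map_smul' c u := by ext <;> simp [smul_comm c] <;> ring

theorem evenToOdd_apply (u : ℤ × ℤ × F) :
    evenToOdd u = (u.1 + 2 * u.2.1, u.1 - 2 * u.2.1, (2 : ℤ) • u.2.2) := rfl

theorem oddToEven_apply (σ : ℤ) (u : ℤ × ℤ × F) :
    oddToEven σ u = (2 * (u.1 + σ * u.2.1), u.1 - σ * u.2.1, (2 : ℤ) • u.2.2) := rfl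

theorem oddForm_evenToOdd (C : LinearMap.BilinForm ℤ F) (u v : ℤ × ℤ × F) :
    oddForm C (evenToOdd u) (evenToOdd v) = 4 * evenForm C u v := by
  simp only [oddForm_apply, evenForm_apply, evenToOdd_apply, map_smul, LinearMap.smul_apply,
    smul_eq_mul]
  ring

theorem evenForm_oddToEven (C : LinearMap.BilinForm ℤ F) {σ : ℤ} (hσ : σ * σ = 1)
    (u v : ℤ × ℤ × F) : evenForm C (oddToEven σ u) (oddToEven σ v) = 4 * oddForm C u v := by
  simp only [oddForm_apply, evenForm_apply, oddToEven_apply, map_smul, LinearMap.smul_apply,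
    smul_eq_mul]
  linear_combination (-4 * u.2.1 * v.2.1) * hσ

theorem IsUnimodular.exists_two_smul_eq {C : LinearMap.BilinForm ℤ F} (hC : IsUnimodular C) {h : F}
    (hh : ∀ r, Even (C h r)) : ∃ k, h = (2 : ℤ) • k := by
  choose f hf using hh
  have hf' (r) : C h r = 2 * f r := by rw [hf, two_mul]
  obtain ⟨k, hk⟩ := hC.exists_apply_eq
    (AddMonoidHom.mk' f fun a b => mul_left_cancel₀ two_ne_zero (by
      rw [← hf', map_add, hf', hf', mul_add])).toIntLinearMap
  have hk' : ∀ v, C k v = f v := hk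
  exact ⟨k, hC.ext_left fun z => by simp [hf', hk']⟩

theorem IsUnimodular.smul_right_injective {C : LinearMap.BilinForm ℤ F} (hC : IsUnimodular C)
    {c : ℤ} (hc : c ≠ 0) : Function.Injective fun x : F => c • x := fun x y h =>
  hC.ext_left fun z => by
    have := congr_arg (fun w => C w z) h
    simpa [hc] using this

theorem IsUnimodular.exists_smul_eq {M : Type*} [AddCommGroup M] {C : LinearMap.BilinForm ℤ F}
    (hC : IsUnimodular C) {c : ℤ} (hc : c ≠ 0) (f : M →ₗ[ℤ] F) (hf : ∀ v, ∃ w, f v = c • w) :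
    ∃ g : M →ₗ[ℤ] F, ∀ v, f v = c • g v := by
  choose g hg using hf
  exact ⟨(AddMonoidHom.mk' g fun a b => hC.smul_right_injective hc (by
    simp only [smul_add, ← hg, map_add])).toIntLinearMap, hg⟩

theorem forall_dvd_or_forall_dvd {M : Type*} [AddCommGroup M] {c : ℤ} (p q : M →+ ℤ)
    (h : ∀ v, c ∣ p v ∨ c ∣ q v) : (∀ v, c ∣ p v) ∨ ∀ v, c ∣ q v := by
  by_contra! ⟨⟨v, hv⟩, w, hw⟩
  have hqv := (h v).resolve_left hv
  have hpw := (h w).resolve_right hw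
  rcases h (v + w) with h | h <;> rw [map_add] at h
  · exact hv ((dvd_add_left hpw).1 h)
  · exact hw ((dvd_add_right hqv).1 h)

theorem four_dvd_sub_or_four_dvd_add {c d : ℤ} (hcd : Even (c - d)) (h : 8 ∣ c * c - d * d) :
    4 ∣ c - d ∨ 4 ∣ c + d := by
  obtain ⟨r, hr⟩ := hcd
  obtain rfl : c = d + 2 * r := by linarith
  obtain ⟨t, ht⟩ := h
  have : r * (d + r) = 2 * t := by linarith
  rcases Int.even_or_odd' r with ⟨s, rfl | rfl⟩
  · left; exact ⟨s, by ring⟩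
  · right
    have h2 : Even ((2 * s + 1) * (d + (2 * s + 1))) := this ▸ even_two_mul t
    obtain ⟨l, hl⟩ := (Int.even_mul.1 h2).resolve_left (by simp)
    exact ⟨l, by linarith⟩

/-- An isometry of the odd forms takes the image of the even lattice to vectors satisfying
congruences. -/
theorem exists_eq_two_smul_of_isometry {C : LinearMap.BilinForm ℤ F} {C' : LinearMap.BilinForm ℤ F'}
    (hC' : IsUnimodular C') (hev : ∀ x, Even (C x x)) (hev' : ∀ x, Even (C' x x))
    (φ : (ℤ × ℤ × F) ≃ₗ[ℤ] (ℤ × ℤ × F'))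
    (hφ : ∀ u v, oddForm C' (φ u) (φ v) = oddForm C u v) (u : ℤ × ℤ × F) :
    (∃ k, (φ (evenToOdd u)).2.2 = (2 : ℤ) • k) ∧
      (4 ∣ (φ (evenToOdd u)).1 - (φ (evenToOdd u)).2.1 ∨
      4 ∣ (φ (evenToOdd u)).1 + (φ (evenToOdd u)).2.1) := by
  have key (w : ℤ × ℤ × F') (hw : Even (oddForm C' w w)) :
      Even (oddForm C' (φ (evenToOdd u)) w) := by
    obtain ⟨w, rfl⟩ := φ.surjective w
    rw [hφ, oddForm_apply] at hw ⊢
    have := hev w.2.2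
    have h1 : Even (w.1 - w.2.1) := by
      simp only [Int.even_add, Int.even_sub, Int.even_mul, or_self] at hw this ⊢
      tauto
    simp only [evenToOdd_apply, map_smul, LinearMap.smul_apply, smul_eq_mul]
    have : (u.1 + 2 * u.2.1) * w.1 - (u.1 - 2 * u.2.1) * w.2.1 + 2 * C u.2.2 w.2.2 =
      u.1 * (w.1 - w.2.1) + 2 * (u.2.1 * w.1 + u.2.1 * w.2.1 + C u.2.2 w.2.2) := by ring
    rw [this]
    exact (h1.mul_left _).add (even_two_mul _)
  obtain ⟨k, hk⟩ : ∃ k, (φ (evenToOdd u)).2.2 = (2 : ℤ) • k := hC'.exists_two_smul_eq fun r => by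
    have := key (0, 0, r) (by simpa [oddForm_apply] using hev' r)
    simpa [oddForm_apply] using this
  refine ⟨⟨k, hk⟩, four_dvd_sub_or_four_dvd_add ?_ ?_⟩
  · have := key (1, 1, 0) (by simp [oddForm_apply])
    simpa [oddForm_apply] using this
  · have h := (hφ (evenToOdd u) (evenToOdd u)).trans (oddForm_evenToOdd C u u)
    rw [oddForm_apply, evenForm_apply, hk] at h
    simp only [map_smul, LinearMap.smul_apply, smul_eq_mul] at h
    obtain ⟨s, hs⟩ := hev u.2.2
    obtain ⟨t, ht⟩ := hev' k
    rw [hs, ht] at h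
    exact ⟨u.1 * u.2.1 + s - t, by linarith⟩

/-- Even lattices `U ⊕ F` and `U ⊕ F'` are isometric if the odd lattices `⟨1⟩ ⊕ ⟨-1⟩ ⊕ F` and
`⟨1⟩ ⊕ ⟨-1⟩ ⊕ F'` are. -/
theorem exists_isometry_evenForm {C : LinearMap.BilinForm ℤ F} {C' : LinearMap.BilinForm ℤ F'}
    (hC' : IsUnimodular C') (hev : ∀ x, Even (C x x)) (hev' : ∀ x, Even (C' x x))
    (φ : (ℤ × ℤ × F) ≃ₗ[ℤ] (ℤ × ℤ × F'))
    (hφ : ∀ u v, oddForm C' (φ u) (φ v) = oddForm C u v) :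
    ∃ g : (ℤ × ℤ × F) →ₗ[ℤ] (ℤ × ℤ × F'), ∀ u v, evenForm C' (g u) (g v) = evenForm C u v := by
  have h := exists_eq_two_smul_of_isometry hC' hev hev' φ hφ
  obtain ⟨σ, hσ, hdvd⟩ : ∃ σ : ℤ, σ * σ = 1 ∧
      ∀ u, 4 ∣ (φ (evenToOdd u)).1 - σ * (φ (evenToOdd u)).2.1 := by
    let ψ := φ.toLinearMap ∘ₗ evenToOdd
    let p := LinearMap.fst ℤ ℤ (ℤ × F') ∘ₗ ψ
    let q := LinearMap.fst ℤ ℤ F' ∘ₗ LinearMap.snd ℤ ℤ (ℤ × F') ∘ₗ ψ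
    rcases forall_dvd_or_forall_dvd (p - q).toAddMonoidHom (p + q).toAddMonoidHom
      fun v => (h v).2 with h | h
    · exact ⟨1, rfl, fun u => by rw [one_mul]; exact h u⟩
    · exact ⟨-1, rfl, fun u => by rw [neg_one_mul, sub_neg_eq_add]; exact h u⟩
  obtain ⟨g, hg⟩ := hC'.oddForm.exists_smul_eq (c := 4) (by norm_num)
    (oddToEven σ ∘ₗ φ.toLinearMap ∘ₗ evenToOdd) fun u => by
      obtain ⟨⟨k, hk⟩, -⟩ := h u
      obtain ⟨t, ht⟩ := hdvd u
      refine ⟨(2 * t + σ * (φ (evenToOdd u)).2.1, t, k), ?_⟩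
      simp only [LinearMap.comp_apply, LinearEquiv.coe_coe, oddToEven_apply, ht, hk, smul_smul]
      ext
      · simp
        linarith
      · simp
      · simp
  refine ⟨g, fun u v => ?_⟩
  have : evenForm C' ((4 : ℤ) • g u) ((4 : ℤ) • g v) = 16 * evenForm C u v := by
    simp only [← hg, LinearMap.comp_apply, LinearEquiv.coe_coe]
    rw [evenForm_oddToEven C' hσ, hφ, oddForm_evenToOdd]
    ring
  simp only [map_smul, LinearMap.smul_apply, smul_eq_mul] at this
  linarith

/-- An even unimodular lattice with an isotropic vector splits off a hyperbolic plane. -/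
theorem IsUnimodular.exists_equiv_evenForm {L : Type*} [AddCommGroup L]
    {B : LinearMap.BilinForm ℤ L}
    (hB : IsUnimodular B) (hev : ∀ x, Even (B x x)) (h : ∃ x ≠ 0, B x x = 0) :
    ∃ (F : Submodule ℤ L) (ψ : (ℤ × ℤ × F) ≃ₗ[ℤ] L), IsUnimodular (B.domRestrict₁₂ F F) ∧
      ∀ u v, B (ψ u) (ψ v) = evenForm (B.domRestrict₁₂ F F) u v := by
  obtain ⟨x, y, hx, hxy, hy⟩ : ∃ x y, B x x = 0 ∧ B x y = 1 ∧ B y y = 0 := by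
    obtain ⟨x, y, hx, hxy⟩ := hB.exists_hyperbolic_pair h
    obtain ⟨s, hs⟩ := hev y
    refine ⟨x, y - s • x, hx, by simp [hx, hxy], ?_⟩
    simp [hs, hx, hxy, hB.symm y x]
  have hyx : B y x = 1 := by rw [hB.symm, hxy]
  let F : Submodule ℤ L := LinearMap.ker (B x) ⊓ LinearMap.ker (B y)
  have hFx (f : F) : B x f = 0 := f.2.1
  have hFy (f : F) : B y f = 0 := f.2.2
  let ψ : (ℤ × ℤ × F) →ₗ[ℤ] L := (LinearMap.toSpanSingleton ℤ L x).coprod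
    ((LinearMap.toSpanSingleton ℤ L y).coprod F.subtype)
  have hψ (u) : ψ u = u.1 • x + (u.2.1 • y + u.2.2) := rfl
  have hiso (u v) : B (ψ u) (ψ v) = evenForm (B.domRestrict₁₂ F F) u v := by
    simp only [hψ, evenForm_apply, map_add, map_smul, LinearMap.add_apply, LinearMap.smul_apply,
      smul_eq_mul, hx, hy, hxy, hyx, hFx, hFy, hB.symm (u.2.2 : L) x, hB.symm (u.2.2 : L) y,
      LinearMap.domRestrict₁₂_apply]
    ring
  refine ⟨F, LinearEquiv.ofBijective ψ ⟨?_, fun v => ?_⟩, hB.restrict_ker_inf_ker hx hy hxy, hiso⟩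
  · rw [injective_iff_map_eq_zero]
    intro u hu
    have h1 : u.2.1 = 0 := by simpa [hψ, hx, hxy, hFx] using congr_arg (B x) hu
    have h2 : u.1 = 0 := by simpa [hψ, hy, hyx, hFy] using congr_arg (B y) hu
    have h3 : (u.2.2 : L) = 0 := by simpa [hψ, h1, h2] using hu
    exact Prod.ext h2 (Prod.ext h1 (Subtype.ext h3))
  · refine ⟨(B y v, B x v, ⟨v - B y v • x - B x v • y, ?_, ?_⟩), ?_⟩
    · simp [hx, hxy]
    · simp [hy, hyx]
    · rw [hψ]
      module

theorem IsUnimodular.hasSignBasis_oddForm {C : LinearMap.BilinForm ℤ F} [Module.Free ℤ F]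
    [Module.Finite ℤ F] (hC : IsUnimodular C) : HasSignBasis (_root_.oddForm C) := by
  refine hC.oddForm.hasSignBasis _ ⟨(1, 0, 0), ?_⟩ ⟨(1, 0, 0), ?_⟩ ⟨(0, 1, 0), ?_⟩ rfl <;>
  simp [oddForm_apply]

end Hyperbolic

section Signature

variable {ι : Type*} [Fintype ι]

/-- A real quadratic form with integer coefficients that is positive somewhere is positive at an
integer vector. -/
theorem exists_int_dotProduct_mulVec_pos {A : Matrix ι ι ℤ} {v : ι → ℝ}
    (hv : 0 < v ⬝ᵥ (A.map ((↑) : ℤ → ℝ)) *ᵥ v) : ∃ x : ι → ℤ, 0 < x ⬝ᵥ A *ᵥ x := by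
  obtain ⟨q, hq⟩ := (DenseRange.piMap fun _ : ι => Rat.denseRange_cast (𝕜 := ℝ)).exists_mem_open
    (s := {v | 0 < v ⬝ᵥ (A.map ((↑) : ℤ → ℝ)) *ᵥ v}) (isOpen_lt (by fun_prop) (by fun_prop)) ⟨v, hv⟩
  obtain ⟨d, hd⟩ := IsLocalization.exist_integer_multiples_of_finite (nonZeroDivisors ℤ) q
  choose x hx using hd
  refine ⟨x, ?_⟩
  have hd0 : ((d : ℤ) : ℝ) ≠ 0 := by exact_mod_cast nonZeroDivisors.ne_zero d.2
  have hxq : (fun i => (x i : ℝ)) = ((d : ℤ) : ℝ) • Pi.map (fun _ => Rat.cast) q := by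
    ext i
    have : (x i : ℚ) = ((d : ℤ) : ℚ) * q i := by simpa [Algebra.smul_def] using hx i
    simpa using congr_arg (Rat.cast (K := ℝ)) this
  have key : ((x ⬝ᵥ A *ᵥ x : ℤ) : ℝ) =
      (fun i => (x i : ℝ)) ⬝ᵥ (A.map ((↑) : ℤ → ℝ)) *ᵥ fun i => (x i : ℝ) := by
    simp [dotProduct, mulVec]
  rw [hxq, mulVec_smul, smul_dotProduct, dotProduct_smul, smul_eq_mul, smul_eq_mul,
    ← mul_assoc] at key
  have := mul_pos (mul_self_pos.2 hd0) hq
  rw [Set.mem_ofPred_eq] at hq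
  rw [← key] at this
  exact_mod_cast this

variable [DecidableEq ι]

theorem sigPos_toQuadraticForm'_of_diagonal {A R : Matrix ι ι ℝ} {w : ι → ℝ} (hR : IsUnit R.det)
    (h : Rᵀ * A * R = diagonal w) : sigPos A.toQuadraticForm' = {i | 0 < w i}.ncard := by
  refine QuadraticForm.sigPos_of_equiv_weightedSumSquares
    (QuadraticMap.Equivalent.symm
      ⟨{ Matrix.toLinearEquiv' R (R.invertibleOfIsUnitDet hR) with map_app' := fun x => ?_ }⟩)
  have : (R *ᵥ x) ⬝ᵥ A *ᵥ (R *ᵥ x) = x ⬝ᵥ diagonal w *ᵥ x := by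
    rw [← h, ← mulVec_mulVec, ← mulVec_mulVec, dotProduct_comm (R *ᵥ x), dotProduct_mulVec x Rᵀ,
      vecMul_transpose, dotProduct_comm]
  change (toLinearMap₂' ℝ A) (R *ᵥ x) (R *ᵥ x) = _
  rw [toLinearMap₂'_apply', this, QuadraticMap.weightedSumSquares_apply]
  refine Finset.sum_congr rfl fun i _ => ?_
  rw [mulVec_diagonal, smul_eq_mul]
  ring

/-- Sylvester's law of inertia for the eigenvalues. -/
theorem Matrix.IsHermitian.ncard_pos_eigenvalues_eq {A R : Matrix ι ι ℝ} (hA : A.IsHermitian)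
    {w : ι → ℝ} (hw : ∀ i, w i ≠ 0) (h : Rᵀ * A * R = diagonal w) :
    {i | 0 < hA.eigenvalues i}.ncard = {i | 0 < w i}.ncard := by
  rw [← sigPos_toQuadraticForm'_of_diagonal (A := A) (R := hA.eigenvectorUnitary),
    sigPos_toQuadraticForm'_of_diagonal (R := R) _ h]
  · have := congr_arg det h
    rw [det_mul, det_diagonal] at this
    refine isUnit_iff_ne_zero.2 fun h0 => ?_
    rw [h0, mul_zero] at this
    exact Finset.prod_ne_zero_iff.2 (fun i _ => hw i) this.symm
  · exact (Matrix.isUnit_iff_isUnit_det _).1 (Unitary.isUnit_coe (U := hA.eigenvectorUnitary))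
  · have := hA.conjStarAlgAut_star_eigenvectorUnitary
    rw [Unitary.conjStarAlgAut_star_apply] at this
    simpa [star_eq_conjTranspose, mul_assoc] using this

theorem Matrix.IsHermitian.exists_int_pos_of_eigenvalues_pos {A : Matrix ι ι ℤ}
    (hA : (A.map ((↑) : ℤ → ℝ)).IsHermitian) {i : ι} (hi : 0 < hA.eigenvalues i) :
    ∃ x : ι → ℤ, 0 < x ⬝ᵥ A *ᵥ x := by
  rw [hA.eigenvalues_eq] at hi
  exact exists_int_dotProduct_mulVec_pos (by simpa using hi)

theorem Matrix.IsHermitian.exists_int_neg_of_eigenvalues_neg {A : Matrix ι ι ℤ}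
    (hA : (A.map ((↑) : ℤ → ℝ)).IsHermitian) {i : ι} (hi : hA.eigenvalues i < 0) :
    ∃ x : ι → ℤ, x ⬝ᵥ A *ᵥ x < 0 := by
  rw [hA.eigenvalues_eq] at hi
  obtain ⟨x, hx⟩ := exists_int_dotProduct_mulVec_pos (A := -A)
    (v := (hA.eigenvectorBasis i).ofLp) (by
      rw [Matrix.map_neg _ (fun _ => Int.cast_neg _), neg_mulVec, dotProduct_neg]
      simpa using hi)
  exact ⟨x, by simpa [neg_mulVec] using hx⟩

end Signature

section Matrices

variable {N : ℕ}

theorem isUnimodular_toBilin' {A : Matrix (Fin N) (Fin N) ℤ} (hs : A.IsSymm)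
    (hA : A.det = 1 ∨ A.det = -1) : IsUnimodular (toBilin' A) := by
  have hu : IsUnit A.det := Int.isUnit_iff.2 hA
  refine ⟨fun x y => ?_, fun x y h => ?_, fun f => ⟨(fun i => f (Pi.single i 1)) ᵥ* A⁻¹, ?_⟩⟩
  · rw [toBilin'_apply', toBilin'_apply', dotProduct_comm, ← vecMul_transpose, hs.eq,
      dotProduct_mulVec]
  · have : x ᵥ* A = y ᵥ* A := by
      ext i
      have := LinearMap.congr_fun h (Pi.single i 1)
      rw [toBilin'_apply', dotProduct_mulVec, toBilin'_apply', dotProduct_mulVec] at this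
      simpa only [dotProduct_single_one] using this
    simpa [vecMul_vecMul, mul_nonsing_inv _ hu] using congr_arg (· ᵥ* A⁻¹) this
  · refine (Pi.basisFun ℤ (Fin N)).ext fun i => ?_
    rw [toBilin'_apply', dotProduct_mulVec, vecMul_vecMul, nonsing_inv_mul _ hu]
    simp

/-- A similitude of ratio `4` from a lattice with a sign basis determines the number of positive
signs. -/
theorem ncard_signs_eq {A : Matrix (Fin N) (Fin N) ℤ} (hA : (A.map ((↑) : ℤ → ℝ)).IsHermitian)
    {E : Type*} [AddCommGroup E] {C : LinearMap.BilinForm ℤ E} {b : Fin N → E} {ε : Fin N → ℤ}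
    (hε : ∀ i, ε i = 1 ∨ ε i = -1) (hb : ∀ i j, C (b i) (b j) = if i = j then ε i else 0)
    (f : E → Fin N → ℤ) (hf : ∀ u v, toBilin' A (f u) (f v) = 4 * C u v) :
    {i | ε i = 1}.ncard = {i | 0 < hA.eigenvalues i}.ncard := by
  let R : Matrix (Fin N) (Fin N) ℤ := (of fun i => f (b i))ᵀ
  have hR : Rᵀ * A * R = diagonal fun i => 4 * ε i := by
    ext i j
    have : (Rᵀ * A * R) i j = toBilin' A (f (b i)) (f (b j)) := by
      rw [toBilin'_apply', dotProduct_mulVec]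
      rfl
    rw [this, hf, hb, diagonal_apply]
    split_ifs <;> simp
  have hR' : (R.map ((↑) : ℤ → ℝ))ᵀ * A.map ((↑) : ℤ → ℝ) * R.map ((↑) : ℤ → ℝ) =
      diagonal fun i => 4 * (ε i : ℝ) := by
    have := congr_arg (fun M => M.map (Int.castRingHom ℝ)) hR
    simp only [Matrix.map_mul] at this
    rw [diagonal_map (map_zero _)] at this
    simpa [Function.comp_def, transpose_map] using this
  rw [hA.ncard_pos_eigenvalues_eq _ hR']
  · congr 1
    ext i
    rcases hε i with h | h <;> simp [h]
  · intro i
    rcases hε i with h | h <;> simp [h]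

theorem exists_sign_model {A : Matrix (Fin N) (Fin N) ℤ} (hs : A.IsSymm)
    (hev : ∀ x : Fin N → ℤ, Even (x ⬝ᵥ A *ᵥ x)) (hdet : A.det = 1 ∨ A.det = -1)
    (hA : (A.map ((↑) : ℤ → ℝ)).IsHermitian) (hpos : ∃ i, 0 < hA.eigenvalues i)
    (hneg : ∃ i, hA.eigenvalues i < 0) :
    ∃ (F : Submodule ℤ (Fin N → ℤ)) (C : LinearMap.BilinForm ℤ F)
      (ψ : (ℤ × ℤ × F) ≃ₗ[ℤ] (Fin N → ℤ)) (b : Module.Basis (Fin N) ℤ (ℤ × ℤ × F))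
      (ε : Fin N → ℤ), IsUnimodular C ∧ (∀ x, Even (C x x)) ∧
      (∀ u v, toBilin' A (ψ u) (ψ v) = evenForm C u v) ∧ (∀ i, ε i = 1 ∨ ε i = -1) ∧
      (∀ i j, oddForm C (b i) (b j) = if i = j then ε i else 0) ∧
      {i | ε i = 1}.ncard = {i | 0 < hA.eigenvalues i}.ncard := by
  have hB := isUnimodular_toBilin' hs hdet
  simp only [← toBilin'_apply'] at hev
  obtain ⟨i, hi⟩ := hpos
  obtain ⟨j, hj⟩ := hneg
  obtain ⟨F, ψ, hC, hψ⟩ := hB.exists_equiv_evenForm hev <| hB.isotropic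
    (by simpa only [toBilin'_apply'] using hA.exists_int_pos_of_eigenvalues_pos hi)
    (by simpa only [toBilin'_apply'] using hA.exists_int_neg_of_eigenvalues_neg hj)
  obtain ⟨n, b, ε, hε, hb⟩ := hC.hasSignBasis_oddForm
  obtain rfl : n = N := by
    have := ψ.finrank_eq
    rwa [Module.finrank_eq_card_basis b, Module.finrank_fin_fun, Fintype.card_fin] at this
  exact ⟨F, _, ψ, b, ε, hC, fun x => hev x, hψ, hε, hb,
    ncard_signs_eq hA hε hb (ψ ∘ oddToEven 1) fun u v =>
      (hψ _ _).trans (evenForm_oddToEven _ (one_mul 1) u v)⟩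

theorem exists_perm_signs_eq {ε ε' : Fin N → ℤ} (hε : ∀ i, ε i = 1 ∨ ε i = -1)
    (hε' : ∀ i, ε' i = 1 ∨ ε' i = -1) (h : {i | ε i = 1}.ncard = {i | ε' i = 1}.ncard) :
    ∃ σ : Equiv.Perm (Fin N), ∀ i, ε' (σ i) = ε i := by
  obtain ⟨e⟩ : Nonempty ({i // ε i = 1} ≃ {i // ε' i = 1}) := Finite.card_eq.1 h
  refine ⟨e.extendSubtype, fun i => ?_⟩
  by_cases hi : ε i = 1
  · rw [hi, e.extendSubtype_mem i hi]
  · rw [(hε i).resolve_left hi, (hε' _).resolve_left (e.extendSubtype_not_mem i hi)]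

theorem exists_oddForm_equiv {F F' : Type*} [AddCommGroup F] [AddCommGroup F']
    {C : LinearMap.BilinForm ℤ F} {C' : LinearMap.BilinForm ℤ F'} {ε ε' : Fin N → ℤ}
    {b : Module.Basis (Fin N) ℤ F} {b' : Module.Basis (Fin N) ℤ F'}
    (hb : ∀ i j, C (b i) (b j) = if i = j then ε i else 0)
    (hb' : ∀ i j, C' (b' i) (b' j) = if i = j then ε' i else 0) (σ : Equiv.Perm (Fin N))
    (hσ : ∀ i, ε' (σ i) = ε i) (u v : F) :
    C' (b.equiv b' σ u) (b.equiv b' σ v) = C u v := by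
  suffices C'.compl₁₂ (b.equiv b' σ).toLinearMap (b.equiv b' σ).toLinearMap = C from
    LinearMap.congr_fun₂ this u v
  refine LinearMap.BilinForm.ext_basis b fun i j => ?_
  simp [hb, hb', hσ]

end Matrices

/-- Indefinite even unimodular integer matrices of the same signature `(m, n)` with
`m, n ≥ 1` are integrally equivalent. -/
theorem even_unimodular_indefinite_unique
    (m n : ℕ) (hm : 1 ≤ m) (hn : 1 ≤ n)
    (A A' : Matrix (Fin (m + n)) (Fin (m + n)) ℤ)
    (hsymmA : A.IsSymm) (hsymmA' : A'.IsSymm)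
    (hevenA : ∀ x : Fin (m + n) → ℤ, Even (x ⬝ᵥ A.mulVec x))
    (hevenA' : ∀ x : Fin (m + n) → ℤ, Even (x ⬝ᵥ A'.mulVec x))
    (hdetA : A.det = 1 ∨ A.det = -1) (hdetA' : A'.det = 1 ∨ A'.det = -1)
    (hHA : (A.map ((↑) : ℤ → ℝ)).IsHermitian)
    (hHA' : (A'.map ((↑) : ℤ → ℝ)).IsHermitian)
    (hposA : (Finset.univ.filter fun i => 0 < hHA.eigenvalues i).card = m)
    (hnegA : (Finset.univ.filter fun i => hHA.eigenvalues i < 0).card = n)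
    (hposA' : (Finset.univ.filter fun i => 0 < hHA'.eigenvalues i).card = m)
    (hnegA' : (Finset.univ.filter fun i => hHA'.eigenvalues i < 0).card = n) :
    ∃ P : Matrix (Fin (m + n)) (Fin (m + n)) ℤ,
      (P.det = 1 ∨ P.det = -1) ∧ Pᵀ * A * P = A' := by
  have hex {p : Fin (m + n) → Prop} [DecidablePred p] {k : ℕ} (hk : 1 ≤ k)
      (h : (Finset.univ.filter p).card = k) : ∃ i, p i := by
    obtain ⟨i, hi⟩ := Finset.card_pos.1 (h ▸ hk)
    exact ⟨i, (Finset.mem_filter.1 hi).2⟩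
  obtain ⟨F, C, ψ, b, ε, hC, hevC, hψ, hε, hb, hcard⟩ :=
    exists_sign_model hsymmA hevenA hdetA hHA (hex hm hposA) (hex hn hnegA)
  obtain ⟨F', C', ψ', b', ε', -, hevC', hψ', hε', hb', hcard'⟩ :=
    exists_sign_model hsymmA' hevenA' hdetA' hHA' (hex hm hposA') (hex hn hnegA')
  obtain ⟨σ, hσ⟩ := exists_perm_signs_eq hε' hε (by
    rw [hcard, hcard', Set.ncard_eq_toFinset_card', Set.ncard_eq_toFinset_card',
      Set.toFinset_ofPred, Set.toFinset_ofPred, hposA, hposA'])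
  obtain ⟨g, hg⟩ := exists_isometry_evenForm hC hevC' hevC (b'.equiv b σ)
    (exists_oddForm_equiv hb' hb σ hσ)
  let P : Matrix (Fin (m + n)) (Fin (m + n)) ℤ :=
    LinearMap.toMatrix' (ψ.toLinearMap ∘ₗ g ∘ₗ ψ'.symm.toLinearMap)
  have hP : Pᵀ * A * P = A' := by
    refine toBilin'.injective (LinearMap.ext₂ fun x y => ?_)
    have hx (x) : P *ᵥ x = ψ (g (ψ'.symm x)) := LinearMap.toMatrix'_mulVec _ x
    have h1 : toBilin' (Pᵀ * A * P) x y = toBilin' A (P *ᵥ x) (P *ᵥ y) := by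
      rw [toBilin'_apply', toBilin'_apply', ← mulVec_mulVec, ← mulVec_mulVec,
        dotProduct_mulVec x Pᵀ, vecMul_transpose]
    rw [h1, hx, hx, hψ, hg, ← hψ', ψ'.apply_symm_apply, ψ'.apply_symm_apply]
  refine ⟨P, ?_, hP⟩
  have hdet : IsUnit (P.det * (A.det * P.det)) := by
    rw [← mul_assoc, ← det_transpose P, ← det_mul, det_transpose, ← det_mul, hP]
    exact Int.isUnit_iff.2 hdetA'
  exact Int.isUnit_iff.1 (isUnit_of_mul_isUnit_left hdet)
end

section
/- Let Λ be the 24×24 block-diagonal integer matrix whose diagonal blocks are four copies of U, where U denotes the 2×2 matrix with rows (0,1) and (1,0), and two copies of −E₈ (the negative of the E₈ Cartan matrix); Λ is the Gram matrix of the even unimodular lattice Γ_{4,20} of signature (4,20). Call a vector u ∈ ℤ²⁴ primitive if the greatest common divisor of its coordinates is 1, and isotropic if uᵀΛu = 0. Then for any two primitive isotropic vectors u, v ∈ ℤ²⁴ there exists an integer matrix P with det P = ±1 such that PᵀΛP = Λ and Pu = v. -/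
open Matrix

/-- The hyperbolic plane: the `2 × 2` matrix with rows `(0,1)` and `(1,0)`. -/
def hyperbolicU : Matrix (Fin 2) (Fin 2) ℤ := !![0, 1; 1, 0]

/-- Block-diagonal sum of two square integer matrices. -/
def blockSum {m n : ℕ} (A : Matrix (Fin m) (Fin m) ℤ) (B : Matrix (Fin n) (Fin n) ℤ) :
    Matrix (Fin (m + n)) (Fin (m + n)) ℤ :=
  Matrix.reindex finSumFinEquiv finSumFinEquiv (Matrix.fromBlocks A 0 0 B)

/-- The Gram matrix of `Γ_{4,20}`: block-diagonal with four copies of `U` and two copies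
of `-E₈`. -/
def GammaFourTwenty : Matrix (Fin 24) (Fin 24) ℤ :=
  blockSum hyperbolicU (blockSum hyperbolicU (blockSum hyperbolicU
    (blockSum hyperbolicU (blockSum (-CartanMatrix.E₈) (-CartanMatrix.E₈)))))

section
variable {V : Type*} [AddCommGroup V]

/-- `x` and `y` lie in the same orbit of the isometry group of `B`. -/
def IsometryRel (B : LinearMap.BilinForm ℤ V) (x y : V) : Prop :=
  ∃ φ : V ≃ₗ[ℤ] V, (∀ a b, B (φ a) (φ b) = B a b) ∧ φ x = y

namespace IsometryRel
variable {B : LinearMap.BilinForm ℤ V} {x y z : V}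

theorem symm (h : IsometryRel B x y) : IsometryRel B y x := by
  obtain ⟨φ, hφ, rfl⟩ := h
  refine ⟨φ.symm, fun a b => ?_, by simp⟩
  rw [← hφ]; simp

theorem trans (h : IsometryRel B x y) (h' : IsometryRel B y z) : IsometryRel B x z := by
  obtain ⟨φ, hφ, rfl⟩ := h
  obtain ⟨ψ, hψ, rfl⟩ := h'
  exact ⟨φ.trans ψ, fun a b => by simp [hφ, hψ], by simp⟩

theorem refl (x : V) : IsometryRel B x x :=
  ⟨LinearEquiv.refl ℤ V, fun _ _ => rfl, rfl⟩

theorem neg_self (x : V) : IsometryRel B (-x) x :=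
  ⟨LinearEquiv.neg ℤ, fun a b => by simp, by simp⟩

end IsometryRel

/-- The Eichler transvection attached to an isotropic vector `f` and a vector `k` orthogonal
to `f` with `B k k = 2 * h`. -/
def eichlerTransvection (B : LinearMap.BilinForm ℤ V) (f k : V) (h : ℤ) : V →ₗ[ℤ] V :=
  LinearMap.id - (B k).smulRight f + (B f).smulRight k - (h • B f).smulRight f

theorem eichlerTransvection_apply (B : LinearMap.BilinForm ℤ V) (f k : V) (h : ℤ) (x : V) :
    eichlerTransvection B f k h x = x - B k x • f + B f x • k - (h * B f x) • f := by
  simp [eichlerTransvection]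

theorem eichlerTransvection_neg_comp {B : LinearMap.BilinForm ℤ V} {f k : V} {h : ℤ}
    (hff : B f f = 0) (hkf : B k f = 0) (hfk : B f k = 0) (hkk : B k k = 2 * h) :
    eichlerTransvection B f (-k) h ∘ₗ eichlerTransvection B f k h = LinearMap.id := by
  ext x
  simp only [LinearMap.comp_apply, eichlerTransvection_apply, map_add, map_sub, map_neg, map_smul,
    LinearMap.neg_apply, hff, hkf, hfk, hkk, LinearMap.id_apply]
  module

theorem isometryRel_eichler {B : LinearMap.BilinForm ℤ V} (hB : ∀ x y, B x y = B y x)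
    {e f k : V} {h : ℤ} (hff : B f f = 0) (hef : B e f = 1)
    (hke : B k e = 0) (hkf : B k f = 0) (hkk : B k k = 2 * h) :
    IsometryRel B e (e + k - h • f) := by
  have hfk : B f k = 0 := by rw [hB, hkf]
  have hfe : B f e = 1 := by rw [hB, hef]
  refine ⟨LinearEquiv.ofLinearMap (eichlerTransvection B f k h) (eichlerTransvection B f (-k) h)
    ?_ (eichlerTransvection_neg_comp hff hkf hfk hkk), fun x y => ?_, ?_⟩
  · simpa using eichlerTransvection_neg_comp (k := -k) hff (by simpa) (by simpa) (by simpa)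
  · simp only [LinearEquiv.coe_ofLinearMap, eichlerTransvection_apply, map_add, map_sub, map_smul,
      LinearMap.add_apply, LinearMap.sub_apply, LinearMap.smul_apply, hff, hkf, hfk, hkk,
      smul_eq_mul, hB x f, hB x k]
    ring
  · simp [eichlerTransvection_apply, hke, hfe]

/-- `e` and `f` are isotropic vectors with `B e f = 1`. -/
structure IsHyperbolicPair (B : LinearMap.BilinForm ℤ V) (e f : V) : Prop where
  left : B e e = 0
  right : B f f = 0
  pairing : B e f = 1

/-- `(e, f)` and `(e', f')` are two mutually orthogonal hyperbolic pairs. -/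
structure IsHyperbolicQuad (B : LinearMap.BilinForm ℤ V) (e f e' f' : V) : Prop where
  fst : IsHyperbolicPair B e f
  snd : IsHyperbolicPair B e' f'
  left_left : B e e' = 0
  left_right : B e f' = 0
  right_left : B f e' = 0
  right_right : B f f' = 0

variable {B : LinearMap.BilinForm ℤ V} {e f e' f' u : V}

theorem IsHyperbolicPair.swap (hB : ∀ x y, B x y = B y x) (h : IsHyperbolicPair B e f) :
    IsHyperbolicPair B f e :=
  ⟨h.right, h.left, by rw [hB, h.pairing]⟩

theorem IsHyperbolicQuad.swap_fst (hB : ∀ x y, B x y = B y x) (h : IsHyperbolicQuad B e f e' f') :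
    IsHyperbolicQuad B f e e' f' :=
  ⟨h.fst.swap hB, h.snd, h.right_left, h.right_right, h.left_left, h.left_right⟩

theorem IsHyperbolicQuad.swap (hB : ∀ x y, B x y = B y x) (h : IsHyperbolicQuad B e f e' f') :
    IsHyperbolicQuad B e' f' e f :=
  ⟨h.snd, h.fst, by rw [hB, h.left_left], by rw [hB, h.right_left], by rw [hB, h.left_right],
    by rw [hB, h.right_right]⟩

theorem IsHyperbolicQuad.map (h : IsHyperbolicQuad B e f e' f') {φ : V ≃ₗ[ℤ] V}
    (hφ : ∀ a b, B (φ a) (φ b) = B a b) : IsHyperbolicQuad B (φ e) (φ f) (φ e') (φ f') := by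
  obtain ⟨⟨_, _, _⟩, ⟨_, _, _⟩, _, _, _, _⟩ := h
  refine ⟨⟨?_, ?_, ?_⟩, ⟨?_, ?_, ?_⟩, ?_, ?_, ?_, ?_⟩ <;> simpa only [hφ]

theorem IsHyperbolicQuad.isometryRel_left (hB : ∀ x y, B x y = B y x)
    (h : IsHyperbolicQuad B e f e' f') : IsometryRel B e e' := by
  have key {e f e' f' : V} (h : IsHyperbolicQuad B e f e' f') : IsometryRel B e (e + e') := by
    simpa using isometryRel_eichler hB (k := e') (h := 0) h.fst.right h.fst.pairing
      (h.swap hB).left_left (h.swap hB).left_right h.snd.left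
  exact (key h).trans (add_comm e e' ▸ (key (h.swap hB)).symm)

theorem IsHyperbolicQuad.isometryRel_pair (hB : ∀ x y, B x y = B y x)
    (h : IsHyperbolicQuad B e f e' f') : IsometryRel B e f :=
  (h.isometryRel_left hB).trans ((h.swap_fst hB).isometryRel_left hB).symm

/-- The orbit of `f` contains some `g` such that `B u g` is minimal in the following sense: if every member of a residue class modulo `B u g` is a pairing of `u` with an element of the orbit,
then it is the zero class. -/
theorem exists_isometryRel_dvd (B : LinearMap.BilinForm ℤ V) (u f : V) :
    ∃ g, IsometryRel B f g ∧ ∀ c : ℤ,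
      (∀ s : ℤ, ∃ h, IsometryRel B f h ∧ B u h = c + B u g * s) → B u g ∣ c := by
  by_cases hne : ∃ g, IsometryRel B f g ∧ B u g ≠ 0
  · obtain ⟨g, ⟨hg, hg0⟩, hmin⟩ := exists_minimalFor_of_wellFoundedLT
      (fun g : V => IsometryRel B f g ∧ B u g ≠ 0) (fun g => (B u g).natAbs) hne
    refine ⟨g, hg, fun c hc => ?_⟩
    obtain ⟨h, hfh, hh⟩ := hc (-(c / B u g))
    replace hh : B u h = c % B u g := by rw [hh, Int.emod_def]; ring
    refine Int.dvd_of_emod_eq_zero (hh ▸ by_contra fun h0 => ?_)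
    have hle := hmin ⟨hfh, h0⟩
    have hnn := Int.emod_nonneg c hg0
    have hlt := Int.abs_eq_natAbs (B u g) ▸ Int.emod_lt_abs c hg0
    simp only [hh] at hle
    lia
  · push Not at hne
    refine ⟨f, .refl f, fun c hc => ?_⟩
    obtain ⟨h, hfh, hh⟩ := hc 0
    rw [hne h hfh, mul_zero, add_zero] at hh
    exact hh ▸ dvd_zero _

/-- If `B u f` is minimal over the orbit of `f`, then it divides all the pairings of `u`. -/
theorem dvd_of_minimal (hB : ∀ x y, B x y = B y x) (heven : ∀ x, Even (B x x))
    (hq : IsHyperbolicQuad B e f e' f')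
    (hmin : ∀ c : ℤ, (∀ s : ℤ, ∃ h, IsometryRel B f h ∧ B u h = c + B u f * s) → B u f ∣ c)
    (x : V) : B u f ∣ B u x := by
  have hfe := (hq.isometryRel_pair hB).symm
  have hsnd {e' f' : V} (hq : IsHyperbolicQuad B e f e' f') : B u f ∣ B u e' := by
    refine hmin _ fun s => ⟨e' + s • f, ?_, by simp [mul_comm]⟩
    have h := isometryRel_eichler hB (e := e') (f := f') (k := s • f) (h := 0) hq.snd.right
      hq.snd.pairing (by simp [hq.right_left]) (by simp [hq.right_right]) (by simp [hq.fst.right])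
    exact ((hq.swap_fst hB).isometryRel_left hB).trans (by simpa using h)
  obtain ⟨p, hp⟩ := hsnd hq
  obtain ⟨q, hq'⟩ := hsnd ((hq.swap hB).swap_fst hB |>.swap hB)
  have hperp {k : V} (hke : B k e = 0) (hkf : B k f = 0) : B u f ∣ B u e + B u k := by
    obtain ⟨h, hh⟩ := heven k
    refine hmin _ fun s => ?_
    -- These coefficients make the coefficient of `B u f` in the pairing equal to `s`.
    let β : ℤ := p - B k e' - 1
    let α : ℤ := s + h - β * (q - B k f')
    refine ⟨e + (k + α • e' + β • f') - (h + α * β + α * B k e' + β * B k f') • f,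
      hfe.trans (isometryRel_eichler hB hq.fst.right hq.fst.pairing ?_ ?_ ?_), ?_⟩
    · simp [hke, hB e' e, hB f' e, hq.left_left, hq.left_right]
    · simp [hkf, hB e' f, hB f' f, hq.right_left, hq.right_right]
    · simp [hh, hB e' k, hB f' k, hB f' e', hq.snd.left, hq.snd.right, hq.snd.pairing]
      ring
    · simp [hp, hq']
      ring
  have he : B u f ∣ B u e := by simpa using hperp (k := 0) (by simp) (by simp)
  have hk := (Int.dvd_add_right he).mp (hperp (k := x - B x f • e - B x e • f)
    (by simp [hq.fst.left, hB f e, hq.fst.pairing]) (by simp [hq.fst.right, hq.fst.pairing]))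
  have hx : B u x = B u (x - B x f • e - B x e • f) + (B x f * B u e + B x e * B u f) := by
    simp
  rw [hx]
  exact dvd_add hk (dvd_add (he.mul_left _) (dvd_mul_left _ _))

theorem isometryRel_of_pairing_eq_one (hB : ∀ x y, B x y = B y x)
    (hp : IsHyperbolicPair B e f) (hu : B u u = 0) (huf : B u f = 1) : IsometryRel B e u := by
  let k := u - e - B u e • f
  have hkk : B k k = 2 * (-B u e) := by
    simp [k, hp.left, hp.right, hB f e, hp.pairing, hu, huf, hB e u, hB f u]
    ring
  have h := isometryRel_eichler hB (k := k) hp.right hp.pairing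
    (by simp [k, hp.left, hB f e, hp.pairing]) (by simp [k, hp.right, hp.pairing, huf]) hkk
  convert h using 1
  simp only [k]
  module

/-- In an even lattice containing two orthogonal hyperbolic planes, every isotropic vector that
pairs to `1` with some vector is in the orbit of a given hyperbolic basis vector. -/
theorem IsHyperbolicQuad.isometryRel_of_isotropic (hB : ∀ x y, B x y = B y x)
    (heven : ∀ x, Even (B x x))
    (hq : IsHyperbolicQuad B e f e' f') (hu : B u u = 0) (hprim : ∃ w, B u w = 1) :
    IsometryRel B e u := by
  obtain ⟨g, ⟨φ, hφ, rfl⟩, hmin⟩ := exists_isometryRel_dvd B u f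
  have hf : IsometryRel B f (φ f) := ⟨φ, hφ, rfl⟩
  have hqφ := hq.map hφ
  obtain ⟨w, hw⟩ := hprim
  have hdvd := dvd_of_minimal hB heven hqφ
    (fun c hc => hmin c fun s => (hc s).imp fun _ h => ⟨hf.trans h.1, h.2⟩) w
  rw [hw] at hdvd
  have he : IsometryRel B e (φ e) := ⟨φ, hφ, rfl⟩
  rcases Int.isUnit_iff.mp (isUnit_of_dvd_one hdvd) with h1 | h1
  · exact he.trans (isometryRel_of_pairing_eq_one hB hqφ.fst hu h1)
  · exact (he.trans (isometryRel_of_pairing_eq_one (u := -u) hB hqφ.fst (by simpa)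
      (by simp [h1]))).trans (.neg_self u)
end

theorem blockSum_add {m n : ℕ}
    (A A' : Matrix (Fin m) (Fin m) ℤ) (B B' : Matrix (Fin n) (Fin n) ℤ) :
    blockSum (A + A') (B + B') = blockSum A B + blockSum A' B' := by
  have h := fromBlocks_add A 0 0 B A' 0 0 B'
  simp only [add_zero] at h
  simp only [blockSum, ← h]
  rfl

theorem blockSum_transpose {m n : ℕ} (A : Matrix (Fin m) (Fin m) ℤ) (B : Matrix (Fin n) (Fin n) ℤ) :
    (blockSum A B)ᵀ = blockSum Aᵀ Bᵀ := by
  simp [blockSum, fromBlocks_transpose]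

theorem det_blockSum {m n : ℕ} (A : Matrix (Fin m) (Fin m) ℤ) (B : Matrix (Fin n) (Fin n) ℤ) :
    (blockSum A B).det = A.det * B.det := by
  simp [blockSum]

/-- Gram matrices of even unimodular lattices; evenness is expressed by `G = A + Aᵀ`. -/
structure IsEvenUnimodular {n : Type*} [Fintype n] [DecidableEq n] (G : Matrix n n ℤ) : Prop where
  exists_eq_add_transpose : ∃ A, G = A + Aᵀ
  isUnit_det : IsUnit G.det

theorem IsEvenUnimodular.blockSum {m n : ℕ} {A : Matrix (Fin m) (Fin m) ℤ}
    {B : Matrix (Fin n) (Fin n) ℤ} (hA : IsEvenUnimodular A) (hB : IsEvenUnimodular B) :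
    IsEvenUnimodular (blockSum A B) := by
  obtain ⟨⟨A', rfl⟩, hA⟩ := hA
  obtain ⟨⟨B', rfl⟩, hB⟩ := hB
  exact ⟨⟨_root_.blockSum A' B', by rw [blockSum_add, blockSum_transpose]⟩,
    by rw [det_blockSum]; exact hA.mul hB⟩

theorem isEvenUnimodular_hyperbolicU : IsEvenUnimodular hyperbolicU :=
  ⟨⟨!![0, 1; 0, 0], by decide⟩, by simp [hyperbolicU, det_fin_two]⟩

theorem isEvenUnimodular_neg_E₈ : IsEvenUnimodular (-CartanMatrix.E₈) := by
  refine ⟨⟨of fun i j => if i < j then -CartanMatrix.E₈ i j else if i = j then -1 else 0,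
    by decide +kernel⟩, ?_⟩
  exact isUnit_det_of_right_inverse (B := -!![
     4,  5,  7, 10,  8,  6,  4,  2;
     5,  8, 10, 15, 12,  9,  6,  3;
     7, 10, 14, 20, 16, 12,  8,  4;
    10, 15, 20, 30, 24, 18, 12,  6;
     8, 12, 16, 24, 20, 15, 10,  5;
     6,  9, 12, 18, 15, 12,  8,  4;
     4,  6,  8, 12, 10,  8,  6,  3;
     2,  3,  4,  6,  5,  4,  3,  2]) (by decide +kernel)

theorem isEvenUnimodular_GammaFourTwenty : IsEvenUnimodular GammaFourTwenty :=
  have hU := isEvenUnimodular_hyperbolicU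
  have hE := isEvenUnimodular_neg_E₈
  hU.blockSum (hU.blockSum (hU.blockSum (hU.blockSum (hE.blockSum hE))))

theorem IsEvenUnimodular.toBilin'_comm {n : Type*} [Fintype n] [DecidableEq n]
    {G : Matrix n n ℤ} (hG : IsEvenUnimodular G) (x y : n → ℤ) :
    toBilin' G x y = toBilin' G y x := by
  obtain ⟨⟨A, rfl⟩, -⟩ := hG
  simp only [toBilin'_apply', add_mulVec, dotProduct_add, dotProduct_transpose_mulVec]
  rw [add_comm]

theorem IsEvenUnimodular.even_toBilin' {n : Type*} [Fintype n] [DecidableEq n]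
    {G : Matrix n n ℤ} (hG : IsEvenUnimodular G) (x : n → ℤ) :
    Even (toBilin' G x x) := by
  obtain ⟨⟨A, rfl⟩, -⟩ := hG
  refine ⟨x ⬝ᵥ A *ᵥ x, ?_⟩
  simp only [toBilin'_apply', add_mulVec, dotProduct_add, dotProduct_transpose_mulVec]

theorem IsEvenUnimodular.exists_toBilin'_eq_one {n : Type*} [Fintype n] [DecidableEq n]
    {G : Matrix n n ℤ} (hG : IsEvenUnimodular G)
    {u : n → ℤ} (hu : Finset.univ.gcd u = 1) : ∃ w, toBilin' G u w = 1 := by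
  obtain ⟨c, hc⟩ := Finset.univ.gcd_eq_sum_mul u
  refine ⟨G⁻¹ *ᵥ c, ?_⟩
  rw [toBilin'_apply', mulVec_mulVec, mul_nonsing_inv _ hG.isUnit_det, one_mulVec, ← hu, hc]
  rfl

theorem IsometryRel.exists_matrix {n : Type*} [Fintype n] [DecidableEq n]
    {G : Matrix n n ℤ} {u v : n → ℤ}
    (h : IsometryRel (toBilin' G) u v) :
    ∃ P : Matrix n n ℤ, (P.det = 1 ∨ P.det = -1) ∧ Pᵀ * G * P = G ∧ P *ᵥ u = v := by
  obtain ⟨φ, hφ, rfl⟩ := h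
  refine ⟨LinearMap.toMatrix' φ, ?_, ?_, by simp⟩
  · rw [← Int.isUnit_iff, LinearMap.det_toMatrix']
    exact φ.isUnit_det'
  · apply toBilin'.injective
    rw [← toBilin'_comp]
    ext
    simp [hφ]

theorem isHyperbolicQuad_GammaFourTwenty : IsHyperbolicQuad (toBilin' GammaFourTwenty)
    (Pi.single 0 1) (Pi.single 1 1) (Pi.single 2 1) (Pi.single 3 1) := by
  refine ⟨⟨?_, ?_, ?_⟩, ⟨?_, ?_, ?_⟩, ?_, ?_, ?_, ?_⟩ <;> rw [toBilin'_single] <;> decide +kernel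

/-- The integral isometry group `O(Γ_{4,20})` acts transitively on primitive isotropic
vectors: for any two vectors `u, v ∈ ℤ²⁴` with `gcd` of coordinates `1` and
`uᵀΛu = vᵀΛv = 0`, some integral isometry `P` of `Λ = Γ_{4,20}` maps `u` to `v`. -/
theorem GammaFourTwenty_transitive_on_primitive_isotropic
    (u v : Fin 24 → ℤ)
    (hu_prim : Finset.univ.gcd u = 1) (hv_prim : Finset.univ.gcd v = 1)
    (hu_iso : u ⬝ᵥ GammaFourTwenty.mulVec u = 0)
    (hv_iso : v ⬝ᵥ GammaFourTwenty.mulVec v = 0) :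
    ∃ P : Matrix (Fin 24) (Fin 24) ℤ,
      (P.det = 1 ∨ P.det = -1) ∧
      Pᵀ * GammaFourTwenty * P = GammaFourTwenty ∧
      P.mulVec u = v := by
  have hG := isEvenUnimodular_GammaFourTwenty
  have key {w : Fin 24 → ℤ} (hw : Finset.univ.gcd w = 1)
      (hiso : w ⬝ᵥ GammaFourTwenty.mulVec w = 0) :=
    isHyperbolicQuad_GammaFourTwenty.isometryRel_of_isotropic hG.toBilin'_comm hG.even_toBilin'
      (u := w) (by rwa [toBilin'_apply']) (hG.exists_toBilin'_eq_one hw)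
  exact ((key hu_prim hu_iso).symm.trans (key hv_prim hv_iso)).exists_matrix
end
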